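/- Let n ≥ 2 and let W be a normalized double-well potential (stability in the radial decreasing case). There exist universal constants ε₀ > 0 and C such that for every ε < ε₀, with u_ε the unique radial decreasing minimizer of ψ(ε), one has C √( AC_ε(u) − ψ(ε) ) ≥ d_Φ(u, u_ε) whenever u ∈ H¹(ℝⁿ;[0,1]) is radial decreasing with ∫_{ℝⁿ}V(u) dx = 1. -/

import Mathlib

noncomputable section

open MeasureTheory Real Set Filter

abbrev En (n : ℕ) : Type := EuclideanSpace ℝ (Fin n)

/-- Volume of the unit ball of `ℝⁿ`. -/
def ballVol (n : ℕ) : ℝ := (volume (Metric.ball (0 : En n) 1)).toReal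

/-- A normalized double-well potential. -/
structure DoubleWell (W : ℝ → ℝ) : Prop where
  contDiffOn : ContDiffOn ℝ 2 W (Icc 0 1)
  lipschitzSecond : ∃ L : NNReal, LipschitzOnWith L (iteratedDerivWithin 2 W (Icc 0 1)) (Icc 0 1)
  zero_at_zero : W 0 = 0
  zero_at_one : W 1 = 0
  pos_on : ∀ t ∈ Ioo (0:ℝ) 1, 0 < W t
  second_pos_zero : 0 < iteratedDerivWithin 2 W (Icc 0 1) 0
  second_pos_one : 0 < iteratedDerivWithin 2 W (Icc 0 1) 1
  normalized : ∫ t in (0:ℝ)..1, Real.sqrt (W t) = 1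

/-- `Φ(t) = ∫₀ᵗ √W`. -/
def Phi (W : ℝ → ℝ) (t : ℝ) : ℝ := ∫ s in (0:ℝ)..t, Real.sqrt (W s)

/-- `V(t) = Φ(t)^{n/(n-1)}`. -/
def Vpot (n : ℕ) (W : ℝ → ℝ) (t : ℝ) : ℝ := Phi W t ^ ((n : ℝ) / ((n : ℝ) - 1))

/-- Membership in `H¹(ℝⁿ;[0,1])`. -/
structure H1Box (n : ℕ) (u : En n → ℝ) : Prop where
  mem_Icc : ∀ x, u x ∈ Icc (0:ℝ) 1
  diff : Differentiable ℝ u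
  memL2 : MemLp u 2 (volume : Measure (En n))
  grad_memL2 : MemLp (fun x => fderiv ℝ u x) 2 (volume : Measure (En n))

/-- The Allen–Cahn energy. -/
def AC (n : ℕ) (W : ℝ → ℝ) (σ : ℝ) (u : En n → ℝ) : ℝ :=
  σ * (∫ x : En n, ‖fderiv ℝ u x‖ ^ 2) + σ⁻¹ * (∫ x : En n, W (u x))

/-- The isoperimetric-type infimum `Ψ(σ,m)`. -/
def Psi (n : ℕ) (W : ℝ → ℝ) (σ m : ℝ) : ℝ :=
  sInf ((fun u => AC n W σ u) ''
    {u : En n → ℝ | H1Box n u ∧ (∫ x : En n, Vpot n W (u x)) = m})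

/-- `u` is a minimizer of `ψ(ε) = Ψ(ε,1)`. -/
def Minimizes (n : ℕ) (W : ℝ → ℝ) (ε : ℝ) (u : En n → ℝ) : Prop :=
  H1Box n u ∧ (∫ x : En n, Vpot n W (u x)) = 1 ∧ AC n W ε u = Psi n W ε 1

/-- Radial function. -/
def Radial (n : ℕ) (u : En n → ℝ) : Prop :=
  ∃ ζ : ℝ → ℝ, ∀ x : En n, u x = ζ ‖x‖

/-- Radial decreasing function. -/
def RadialDecreasing (n : ℕ) (u : En n → ℝ) : Prop :=
  ∃ ζ : ℝ → ℝ, AntitoneOn ζ (Ici 0) ∧ ∀ x : En n, u x = ζ ‖x‖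

/-- The Laplacian as the trace of the second derivative. -/
def lap (n : ℕ) (u : En n → ℝ) (x : En n) : ℝ :=
  ∑ i : Fin n,
    fderiv ℝ (fun y => fderiv ℝ u y (EuclideanSpace.single i 1)) x (EuclideanSpace.single i 1)

/-- The optimal transition profile `η`. -/
structure TransitionProfile (W : ℝ → ℝ) (η : ℝ → ℝ) : Prop where
  mem : ∀ s, η s ∈ Ioo (0:ℝ) 1
  init : η 0 = 1/2
  ode : ∀ s, HasDerivAt η (-(Real.sqrt (W (η s)))) s
  anti : StrictAnti η
  tendsto_bot : Tendsto η atBot (nhds 1)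
  tendsto_top : Tendsto η atTop (nhds 0)

/-- `d_Φ(u,v)`. -/
def dPhi (n : ℕ) (W : ℝ → ℝ) (u v : En n → ℝ) : ℝ :=
  ∫ x : En n, |Phi W (u x) - Phi W (v x)| ^ ((n : ℝ) / ((n : ℝ) - 1))

/-- `R₀ = ω_n^{-1/n}`. -/
def R0 (n : ℕ) : ℝ := ballVol n ^ (-(1:ℝ) / (n : ℝ))


namespace S15


/-- abstract potential hypotheses -/
structure Pot (W V : ℝ → ℝ) (τ c K : ℝ) : Prop where
  τ0 : 0 < τ
  τ1 : τ < 1 / 2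
  c0 : 0 < c
  K1 : 1 ≤ K
  Wnn : ∀ t ∈ Icc (0:ℝ) 1, 0 ≤ W t
  W0 : W 0 = 0
  W1 : W 1 = 0
  Wlip : ∀ a ∈ Icc (0:ℝ) 1, ∀ b ∈ Icc (0:ℝ) 1, |W a - W b| ≤ K * |a - b| * (a + b)
  Wlow : ∀ t ∈ Icc 0 τ, c * t ^ 2 ≤ W t
  Wmid : ∀ t ∈ Icc τ (1 - τ), c ≤ W t
  Wconv : ∀ a b θ : ℝ, (a ∈ Icc 0 τ ∧ b ∈ Icc 0 τ) ∨ (a ∈ Icc (1 - τ) 1 ∧ b ∈ Icc (1 - τ) 1) →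
    θ ∈ Icc (0:ℝ) 1 →
    W ((1 - θ) * a + θ * b) ≤ (1 - θ) * W a + θ * W b - c * θ * (1 - θ) * (a - b) ^ 2
  Vmono : MonotoneOn V (Icc 0 1)
  V0 : V 0 = 0
  V1 : V 1 = 1
  Vlip : ∀ a ∈ Icc (0:ℝ) 1, ∀ b ∈ Icc (0:ℝ) 1, |V a - V b| ≤ K * |a - b| * (a + b)
  Vconc : ∀ a b θ : ℝ, (a ∈ Icc 0 τ ∧ b ∈ Icc 0 τ) ∨ (a ∈ Icc (1 - τ) 1 ∧ b ∈ Icc (1 - τ) 1) →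
    θ ∈ Icc (0:ℝ) 1 →
    (1 - θ) * V a + θ * V b - K * θ * (1 - θ) * (a - b) ^ 2 ≤ V ((1 - θ) * a + θ * b)
  VW : ∀ t ∈ Icc 0 (1 - τ), V t ≤ K * W t
  VW1 : ∀ t ∈ Icc (1 - τ) 1, 1 - V t ≤ K * W t
  Vτ : c ≤ V τ

/-- radial profiles -/
structure Prof (e : ℕ) (f : ℝ → ℝ) : Prop where
  diff : Differentiable ℝ f
  d0 : deriv f 0 = 0
  mem : ∀ r, f r ∈ Icc (0:ℝ) 1
  i0 : IntegrableOn (fun r => r ^ (e + 1) * (f r) ^ 2) (Ioi 0)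
  i1 : IntegrableOn (fun r => r ^ (e + 1) * (deriv f r) ^ 2) (Ioi 0)

def GG (e : ℕ) (f : ℝ → ℝ) : ℝ := ∫ r in Ioi (0:ℝ), r ^ (e + 1) * (deriv f r) ^ 2
def PP (e : ℕ) (W : ℝ → ℝ) (f : ℝ → ℝ) : ℝ := ∫ r in Ioi (0:ℝ), r ^ (e + 1) * W (f r)
def EE (e : ℕ) (W : ℝ → ℝ) (ε : ℝ) (f : ℝ → ℝ) : ℝ := ε * GG e f + PP e W f / ε

structure Mini (e : ℕ) (W V : ℝ → ℝ) (m ε : ℝ) (f : ℝ → ℝ) : Prop where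
  prof : Prof e f
  anti : AntitoneOn f (Ici 0)
  mass : PP e V f = m
  mini : ∀ g, Prof e g → PP e V g = m → EE e W ε f ≤ EE e W ε g

/-- functions with quadratic Lipschitz modulus -/
def QL (U : ℝ → ℝ) (K : ℝ) : Prop := U 0 = 0 ∧ 
  ∀ a ∈ Icc (0:ℝ) 1, ∀ b ∈ Icc (0:ℝ) 1, |U a - U b| ≤ K * |a - b| * (a + b)

variable {W V : ℝ → ℝ} {τ c K : ℝ} {e : ℕ} {f g : ℝ → ℝ}

lemma Pot.qlW (h : Pot W V τ c K) : QL W K := ⟨h.W0, h.Wlip⟩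
lemma Pot.qlV (h : Pot W V τ c K) : QL V K := ⟨h.V0, h.Vlip⟩

lemma QL.sq {U : ℝ → ℝ} (h : QL U K) {t : ℝ} (ht : t ∈ Icc (0:ℝ) 1) : |U t| ≤ K * t ^ 2 := by
  have := h.2 t ht 0 (by simp)
  rw [h.1, sub_zero, sub_zero, add_zero, abs_of_nonneg ht.1] at this
  nlinarith

lemma QL.contOn {U : ℝ → ℝ} (h : QL U K) : ContinuousOn U (Icc 0 1) := by
  intro a ha
  have hK : 0 ≤ K := by
    have := h.2 1 (by simp) 0 (by simp)
    have h2 := abs_nonneg (U 1 - U 0)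
    norm_num at this; linarith
  rw [ContinuousWithinAt, tendsto_iff_dist_tendsto_zero]
  refine squeeze_zero' (g := fun b => K * |b - a| * 2) (Eventually.of_forall fun _ => dist_nonneg) ?_ ?_
  · filter_upwards [self_mem_nhdsWithin] with b hb
    rw [Real.dist_eq]
    refine (h.2 b hb a ha).trans ?_
    have : 0 ≤ K * |b - a| := by positivity
    have h3 := hb.2
    have h4 := ha.2
    gcongr; linarith
  · have : ContinuousWithinAt (fun b => K * |b - a| * 2) (Icc 0 1) a := by fun_prop
    have h2 := this.tendsto
    simpa using h2

lemma QL.comp {U : ℝ → ℝ} (h : QL U K) (hf : Continuous f) (hm : ∀ r, f r ∈ Icc (0:ℝ) 1) :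
    Continuous (fun r => U (f r)) :=
  h.contOn.comp_continuous hf hm

lemma wt_meas (S : Set ℝ) {F : ℝ → ℝ} (hF : AEStronglyMeasurable F (volume.restrict S)) :
    AEStronglyMeasurable (fun r => r ^ (e + 1) * F r) (volume.restrict S) :=
  (by fun_prop : Continuous fun r : ℝ => r ^ (e + 1)).aestronglyMeasurable.mul hF

lemma Prof.intU {U : ℝ → ℝ} (hf : Prof e f) (h : QL U K) :
    IntegrableOn (fun r => r ^ (e + 1) * U (f r)) (Ioi 0) := by
  refine Integrable.mono' (hf.i0.const_mul K) ?_ ?_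
  · exact wt_meas _ (h.comp hf.diff.continuous hf.mem).aestronglyMeasurable
  · filter_upwards [ae_restrict_mem measurableSet_Ioi] with r hr
    have hr : (0:ℝ) < r := hr
    rw [norm_mul, Real.norm_eq_abs, Real.norm_eq_abs, abs_of_pos (by positivity)]
    have := h.sq (hf.mem r)
    have h2 : 0 < r ^ (e + 1) := by positivity
    nlinarith

lemma scal (F : ℝ → ℝ) {κ : ℝ} (hκ : 0 < κ) :
    ∫ r in Ioi (0:ℝ), r ^ (e + 1) * F (κ * r) = (κ ^ (e + 2))⁻¹ * ∫ r in Ioi (0:ℝ), r ^ (e + 1) * F r := by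
  have := integral_comp_mul_left_Ioi (fun r => r ^ (e + 1) * F r) 0 hκ
  simp only [mul_zero, smul_eq_mul] at this
  have h2 : ∀ r : ℝ, (κ * r) ^ (e + 1) * F (κ * r) = κ ^ (e + 1) * (r ^ (e + 1) * F (κ * r)) := by
    intro r; ring
  simp only [h2] at this
  rw [integral_const_mul] at this
  have h3 : κ ^ (e + 1) ≠ 0 := by positivity
  have h4 : κ ≠ 0 := hκ.ne'
  field_simp at this ⊢
  rw [← this]; ring

lemma scal_int (F : ℝ → ℝ) {κ : ℝ} (hκ : 0 < κ) 
    (h : IntegrableOn (fun r => r ^ (e + 1) * F r) (Ioi 0)) :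
    IntegrableOn (fun r => r ^ (e + 1) * F (κ * r)) (Ioi 0) := by
  have := (integrableOn_Ioi_comp_mul_left_iff (fun r => r ^ (e + 1) * F r) 0 hκ).2 (by simpa using h)
  refine IntegrableOn.congr_fun (this.const_mul (κ ^ (e + 1))⁻¹) ?_ measurableSet_Ioi
  intro r _
  have h3 : κ ^ (e + 1) ≠ 0 := by positivity
  simp only [mul_pow]; field_simp

lemma deriv_scale (hf : Differentiable ℝ f) (κ r : ℝ) :
    deriv (fun r => f (κ * r)) r = κ * deriv f (κ * r) := by
  have h1 : HasDerivAt (fun r => κ * r) (κ * 1) r := (hasDerivAt_id r).const_mul κ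
  have := (hf (κ * r)).hasDerivAt.scomp r h1
  have h2 := this.deriv
  simp only [mul_one, smul_eq_mul] at h2
  exact h2

lemma Prof.scale (hf : Prof e f) {κ : ℝ} (hκ : 0 < κ) : Prof e (fun r => f (κ * r)) where
  diff := hf.diff.comp (by fun_prop)
  d0 := by rw [deriv_scale hf.diff]; simp [hf.d0]
  mem r := hf.mem _
  i0 := scal_int (fun r => f r ^ 2) hκ hf.i0
  i1 := by
    simp only [deriv_scale hf.diff]
    have := (scal_int (fun r => (deriv f r) ^ 2) hκ hf.i1).const_mul (κ ^ 2)
    refine IntegrableOn.congr_fun this ?_ measurableSet_Ioi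
    intro r _; simp only; ring

lemma PP_scale (U : ℝ → ℝ) {κ : ℝ} (hκ : 0 < κ) : 
    PP e U (fun r => f (κ * r)) = (κ ^ (e + 2))⁻¹ * PP e U f := scal (fun r => U (f r)) hκ

lemma GG_scale (hf : Differentiable ℝ f) {κ : ℝ} (hκ : 0 < κ) : 
    GG e (fun r => f (κ * r)) = (κ ^ e)⁻¹ * GG e f := by
  unfold GG
  simp only [deriv_scale hf]
  have := scal (e := e) (fun r => (deriv f r) ^ 2) hκ
  have h2 : ∀ r : ℝ, r ^ (e + 1) * (κ * deriv f (κ * r)) ^ 2 = κ ^ 2 * (r ^ (e + 1) * (deriv f (κ * r)) ^ 2) := by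
    intro r; ring
  simp only [h2]
  rw [integral_const_mul, this]
  have h4 : κ ≠ 0 := hκ.ne'
  field_simp
  ring

lemma GG_nonneg : 0 ≤ GG e f := by
  refine setIntegral_nonneg measurableSet_Ioi fun r hr => ?_
  have : (0:ℝ) < r := hr
  positivity

lemma PP_nonneg {U : ℝ → ℝ} (hU : ∀ t ∈ Icc (0:ℝ) 1, 0 ≤ U t) (hf : ∀ r, f r ∈ Icc (0:ℝ) 1) : 0 ≤ PP e U f := by
  refine setIntegral_nonneg measurableSet_Ioi fun r hr => ?_
  have : (0:ℝ) < r := hr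
  have := hU _ (hf r)
  positivity

lemma pow_amgm (e : ℕ) {s : ℝ} (hs : 0 < s) : ((e:ℝ) + 2) * s ^ e ≤ 2 + e * s ^ (e + 2) := by
  induction e with
  | zero => simp
  | succ k ih =>
    -- (k+3)s^{k+1} ≤ 2 + (k+1)s^{k+3}
    have key : ∀ m : ℕ, ((m:ℝ) + 1) * s ^ m ≤ 1 + m * s ^ (m + 1) := by
      intro m
      induction m with
      | zero => simp
      | succ j hj =>
        have h1 : 0 ≤ s ^ j * (s - 1) ^ 2 := by positivity
        have h2 : ((j:ℝ) + 2) * s ^ (j + 1) - 1 - (j + 1) * s ^ (j + 2) 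
          = (((j:ℝ) + 1) * s ^ j - 1 - j * s ^ (j + 1)) - ((j:ℝ)+1) * (s ^ j * (s - 1) ^ 2) := by ring
        push_cast
        have h3 : 0 ≤ ((j:ℝ)+1) * (s ^ j * (s - 1) ^ 2) := by positivity
        have h4 : ((j:ℝ) + 1 + 1) * s ^ (j + 1) = ((j:ℝ) + 2) * s ^ (j + 1) := by ring
        have h5 : s ^ (j + 1 + 1) = s ^ (j + 2) := by ring_nf
        rw [h4, h5]; linarith
    have h1 := key (k + 1)
    have h2 := key (k + 2)
    push_cast at *
    have h6 : 0 ≤ s ^ (k+1) := by positivity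
    have e1 : s ^ (k + 1 + 2) = s ^ (k + 2 + 1) := by ring_nf
    have e2 : s ^ (k + 1 + 1) = s ^ (k + 2) := by ring_nf
    rw [e1]; rw [e2] at h1
    -- (k+2) A ≤ 1 + (k+1) B, (k+3) B ≤ 1 + (k+2) C ; want (k+3) A ≤ 2 + (k+1) C
    set A := s ^ (k + 1)
    set B := s ^ (k + 2)
    set C := s ^ (k + 2 + 1)
    have hk : (0:ℝ) ≤ k := Nat.cast_nonneg k
    -- multiply: (k+2)(k+3)A ≤ (k+3) + (k+1)(k+3) B ≤ (k+3)+(k+1)(1+(k+2)C)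
    have h7 : ((k:ℝ)+2) * ((k + 3) * A) ≤ (k + 2) * (2 + (k + 1) * C) := by nlinarith
    have h8 := le_of_mul_le_mul_left h7 (by positivity)
    nlinarith

/-- scaling quasi-minimality -/
lemma Mini.scaled {m ε : ℝ} (hε : 0 < ε) (hm : 0 < m) {f0 : ℝ → ℝ} (h0 : Mini e W V m ε f0) (hg : Prof e g) 
    {x : ℝ} (hx : 0 < x) (hgx : PP e V g = x * m) :
    EE e W ε f0 ≤ ε * GG e g * (1 + e / (e + 2) * (1 / x - 1)) + PP e W g / (ε * x) := by
  set κ : ℝ := x ^ (1 / ((e:ℝ) + 2)) with hκd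
  have hκ : 0 < κ := Real.rpow_pos_of_pos hx _
  have hκx : κ ^ (e + 2) = x := by
    rw [← Real.rpow_natCast, hκd, ← Real.rpow_mul hx.le]
    have : (1 / ((e:ℝ) + 2)) * ((e + 2 : ℕ) : ℝ) = 1 := by
      push_cast
      have : (e:ℝ) + 2 ≠ 0 := by positivity
      field_simp
    rw [this, Real.rpow_one]
  have h1 := h0.mini _ (hg.scale hκ) (by rw [PP_scale V hκ, hκx, hgx]; field_simp)
  refine h1.trans ?_
  unfold EE
  rw [PP_scale W hκ, hκx, GG_scale hg.diff hκ]
  have h2 : (κ ^ e)⁻¹ ≤ 1 + e / (e + 2) * (1 / x - 1) := by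
    have := pow_amgm e (inv_pos.2 hκ)
    rw [inv_pow, inv_pow, hκx] at this
    have h3 : (0:ℝ) < e + 2 := by positivity
    rw [← sub_nonneg]
    have h4 : 1 + (e:ℝ) / (e + 2) * (1 / x - 1) - (κ ^ e)⁻¹ = (2 + e * x⁻¹ - (e + 2) * (κ ^ e)⁻¹) / (e + 2) := by
      field_simp; ring
    rw [h4]; apply div_nonneg _ h3.le; linarith
  have h5 : ε * ((κ ^ e)⁻¹ * GG e g) ≤ ε * GG e g * (1 + e / (e + 2) * (1 / x - 1)) := by
    have : 0 ≤ ε * GG e g := mul_nonneg hε.le GG_nonneg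
    nlinarith
  have h6 : x⁻¹ * PP e W g / ε = PP e W g / (ε * x) := by field_simp
  rw [h6]; linarith

/-- Lagrange multiplier -/
def lam (e : ℕ) (W : ℝ → ℝ) (m ε : ℝ) (f0 : ℝ → ℝ) : ℝ :=
  ((e / (e + 2)) * ε * GG e f0 + PP e W f0 / ε) / m

def LL (e : ℕ) (W V : ℝ → ℝ) (ε l : ℝ) (f : ℝ → ℝ) : ℝ := EE e W ε f - l * PP e V f

lemma Mini.quasi {m ε : ℝ} (hε : 0 < ε) (hm : 0 < m) {f0 : ℝ → ℝ} (h0 : Mini e W V m ε f0) 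
    {A : ℝ} (hA : 0 ≤ A) :
    ∃ B, ∀ θ g, 0 ≤ θ → θ ≤ 1 → Prof e g → |GG e g - GG e f0| ≤ A * θ → |PP e W g - PP e W f0| ≤ A * θ →
      |PP e V g - m| ≤ A * θ → m / 2 ≤ PP e V g →
      LL e W V ε (lam e W m ε f0) f0 ≤ LL e W V ε (lam e W m ε f0) g + B * θ ^ 2 := by
  set β : ℝ := e / (e + 2) with hβd
  have hβ0 : 0 ≤ β := by positivity
  set G0 := GG e f0
  set P0 := PP e W f0
  refine ⟨(β * ε * A + A / ε) * (A / m) + (β * ε * (|G0| + A) + (|P0| + A) / ε) * (A / m) ^ 2 * 2, ?_⟩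
  intro θ g hθ hθ1 hg h1 h2 h3 h4
  set G := GG e g
  set P := PP e W g
  set x := PP e V g / m with hxd
  have hx2 : 1 / 2 ≤ x := by rw [hxd, le_div_iff₀ hm]; linarith
  have hx : 0 < x := by linarith
  have hgx : PP e V g = x * m := by rw [hxd]; field_simp
  have h5 := h0.scaled hε hm hg hx hgx
  set y := x - 1 with hyd
  have hy : |y| ≤ A / m * θ := by
    have : y = (PP e V g - m) / m := by rw [hyd, hxd]; field_simp
    rw [this, abs_div, abs_of_pos hm, div_le_iff₀ hm]
    have : A / m * θ * m = A * θ := by field_simp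
    rw [this]; exact h3
  have hxi : 1 / x = 1 - y + y ^ 2 / x := by field_simp; rw [hyd]; ring
  have hyx : y ^ 2 / x ≤ 2 * (A / m * θ) ^ 2 := by
    rw [div_le_iff₀ hx]
    have := sq_le_sq' (by linarith [neg_abs_le y]) ((le_abs_self y).trans hy)
    nlinarith [sq_nonneg (A / m * θ)]
  have hyx0 : 0 ≤ y ^ 2 / x := by positivity
  have h6 : EE e W ε f0 ≤ EE e W ε g - (β * ε * G + P / ε) * (y - y ^ 2 / x) := by
    have e1 : ε * G * (1 + β * (1 / x - 1)) + P / (ε * x) = ε * G + P / ε - (β * ε * G + P / ε) * (y - y ^ 2 / x) := by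
      have : P / (ε * x) = P / ε * (1 / x) := by field_simp
      rw [this, hxi]; ring
    rw [e1] at h5; exact h5
  have hAm : 0 ≤ A / m := by positivity
  have h7 : (β * ε * (G - G0) + (P - P0) / ε) * y ≥ - ((β * ε * A + A / ε) * (A / m) * θ ^ 2) := by
    have a1 : |β * ε * (G - G0) + (P - P0) / ε| ≤ (β * ε * A + A / ε) * θ := by
      refine (abs_add_le _ _).trans ?_
      rw [abs_mul, abs_div, abs_of_nonneg (by positivity : 0 ≤ β * ε), abs_of_pos hε]
      have : (β * ε * A + A / ε) * θ = β * ε * (A * θ) + (A * θ) / ε := by ring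
      rw [this]; gcongr
    have a2 : |(β * ε * (G - G0) + (P - P0) / ε) * y| ≤ (β * ε * A + A / ε) * θ * (A / m * θ) := by
      rw [abs_mul]; gcongr
    have := neg_abs_le ((β * ε * (G - G0) + (P - P0) / ε) * y)
    nlinarith
  have h8 : (β * ε * G + P / ε) * (y ^ 2 / x) ≤ (β * ε * (|G0| + A) + (|P0| + A) / ε) * (2 * (A / m * θ) ^ 2) := by
    have b1 : G ≤ |G0| + A := by
      have := (le_abs_self _).trans h1; have := le_abs_self G0; nlinarith
    have b2 : P ≤ |P0| + A := by
      have := (le_abs_self _).trans h2; have := le_abs_self P0; nlinarith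
    have b3 : β * ε * G + P / ε ≤ β * ε * (|G0| + A) + (|P0| + A) / ε := by gcongr
    refine (mul_le_mul_of_nonneg_right b3 hyx0).trans ?_
    gcongr
  have h9 : lam e W m ε f0 * m = β * ε * G0 + P0 / ε := by
    unfold lam; rw [div_mul_cancel₀ _ hm.ne']
  unfold LL
  rw [h0.mass, h9, hgx]
  have h10 : lam e W m ε f0 * (x * m) = (β * ε * G0 + P0 / ε) * (1 + y) := by
    rw [← h9, hyd]; ring
  rw [h10]
  have e2 : (β * ε * G + P / ε) * (y - y ^ 2 / x) = (β * ε * G0 + P0 / ε) * y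
    + (β * ε * (G - G0) + (P - P0) / ε) * y - (β * ε * G + P / ε) * (y ^ 2 / x) := by ring
  have e3 : ((β * ε * A + A / ε) * (A / m) + (β * ε * (|G0| + A) + (|P0| + A) / ε) * (A / m) ^ 2 * 2) * θ ^ 2
    = (β * ε * A + A / ε) * (A / m) * θ ^ 2 + (β * ε * (|G0| + A) + (|P0| + A) / ε) * (2 * (A / m * θ) ^ 2) := by ring
  rw [e2] at h6
  rw [e3]
  linarith

end S15

namespace S15

variable {W V : ℝ → ℝ} {τ c K : ℝ} {e : ℕ} {f g : ℝ → ℝ}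

lemma st_deriv_zero {s : ℝ} (hs : s ≤ 0 ∨ 1 ≤ s) : deriv Real.smoothTransition s = 0 := by
  rcases hs with hs | hs
  · apply IsLocalMin.deriv_eq_zero
    refine Eventually.of_forall fun t => ?_
    rw [Real.smoothTransition.zero_of_nonpos hs]; exact Real.smoothTransition.nonneg t
  · apply IsLocalMax.deriv_eq_zero
    refine Eventually.of_forall fun t => ?_
    rw [Real.smoothTransition.one_of_one_le hs]; exact Real.smoothTransition.le_one t

lemma st_contDiff : ContDiff ℝ 1 Real.smoothTransition := Real.smoothTransition.contDiff

lemma st_diff : Differentiable ℝ Real.smoothTransition := st_contDiff.differentiable (by norm_num)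

lemma st_deriv_cont : Continuous (deriv Real.smoothTransition) := 
  st_contDiff.continuous_deriv (by norm_num)

lemma st_deriv_bdd : ∃ B > 0, ∀ s, |deriv Real.smoothTransition s| ≤ B := by
  obtain ⟨B, hB⟩ := (isCompact_Icc (a := (0:ℝ)) (b := 1)).exists_bound_of_continuousOn st_deriv_cont.continuousOn
  refine ⟨|B| + 1, by positivity, fun s => ?_⟩
  by_cases h : s ∈ Icc (0:ℝ) 1
  · have := hB s h
    rw [Real.norm_eq_abs] at this
    linarith [le_abs_self B]
  · rw [st_deriv_zero]
    · simp; positivity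
    · by_contra h2; push Not at h2; exact h ⟨h2.1.le, h2.2.le⟩

lemma intOn_of_zero {F : ℝ → ℝ} {a b : ℝ} (hF : ContinuousOn F (Icc a b)) {S : Set ℝ} (hS : MeasurableSet S)
    (h : ∀ r ∈ S, r ∉ Icc a b → F r = 0) : IntegrableOn F S := by
  have h1 : IntegrableOn F (Icc a b) := hF.integrableOn_Icc
  refine h1.of_forall_sdiff_eq_zero hS ?_
  intro r hr; exact h r hr.1 hr.2

lemma int_pow (R : ℝ) (hR : 0 ≤ R) : ∫ r in Ioc 0 R, r ^ (e + 1) = R ^ (e + 2) / (e + 2) := by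
  rw [← intervalIntegral.integral_of_le hR, integral_pow]
  push_cast; simp; ring

lemma int_pow_le {F : ℝ → ℝ} {a b B : ℝ} (ha : 0 ≤ a) (hab : a ≤ b) (hB : 0 ≤ B) 
    (hF : ∀ r ∈ Ioi (0:ℝ), r ∉ Icc a b → F r = 0) (hFb : ∀ r ∈ Icc a b, F r ≤ B) :
    ∫ r in Ioi 0, r ^ (e + 1) * F r ≤ b ^ (e + 1) * B * (b - a) := by
  by_cases hi : IntegrableOn (fun r => r ^ (e + 1) * F r) (Ioi 0)
  · have h1 : ∫ r in Ioi 0, r ^ (e + 1) * F r ≤ ∫ r in Ioi 0, (Icc a b).indicator (fun _ => b ^ (e + 1) * B) r := by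
      refine setIntegral_mono_on hi ?_ measurableSet_Ioi ?_
      · refine Integrable.integrableOn ?_
        rw [integrable_indicator_iff measurableSet_Icc]
        exact integrableOn_const (by simp)
      · intro r hr
        by_cases h : r ∈ Icc a b
        · rw [indicator_of_mem h]
          have hr0 : (0:ℝ) < r := hr
          have h2 : r ^ (e + 1) ≤ b ^ (e + 1) := pow_le_pow_left₀ hr0.le h.2 _
          have h3 := hFb r h
          have h4 : 0 < r ^ (e + 1) := by positivity
          nlinarith
        · rw [indicator_of_notMem h, hF r hr h, mul_zero]
    refine h1.trans ?_
    rw [setIntegral_indicator measurableSet_Icc]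
    simp only [setIntegral_const, smul_eq_mul]
    have h5 : volume.real (Ioi (0:ℝ) ∩ Icc a b) ≤ b - a := by
      have : volume.real (Ioi (0:ℝ) ∩ Icc a b) ≤ volume.real (Icc a b) := 
        measureReal_mono inter_subset_right (by simp)
      rwa [Real.volume_real_Icc_of_le hab] at this
    have h6 : 0 ≤ b ^ (e + 1) * B := by have : 0 ≤ b := ha.trans hab
                                        positivity
    nlinarith
  · rw [integral_undef hi]
    have : 0 ≤ b := ha.trans hab
    have : 0 ≤ b - a := by linarith
    positivity

lemma energy_bound (hP : Pot W V τ c K) {m : ℝ} (hm : 0 < m) : 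
    ∃ Λ > 0, ∀ ε, 0 < ε → ε ≤ 1 → ∀ f0, Mini e W V m ε f0 → EE e W ε f0 ≤ Λ := by
  obtain ⟨B, hB, hst⟩ := st_deriv_bdd
  have hK := hP.K1
  set x0 : ℝ := 1 / ((e + 2) * m) with hx0d
  have hx0 : 0 < x0 := by positivity
  refine ⟨2 ^ (e + 1) * B ^ 2 * (1 + 1 / x0) + 2 ^ (e + 1) * K / x0, by positivity, ?_⟩
  intro ε hε hε1 f0 h0
  set g : ℝ → ℝ := fun r => 1 - Real.smoothTransition ((r - 1) / ε) with hgd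
  have hgder : ∀ r, HasDerivAt g (-(deriv Real.smoothTransition ((r - 1) / ε) * (1 / ε))) r := by
    intro r
    have h1 : HasDerivAt (fun r => (r - 1) / ε) (1 / ε) r := ((hasDerivAt_id r).sub_const 1).div_const ε
    have h2 := (st_diff ((r - 1) / ε)).hasDerivAt.comp r h1
    exact h2.const_sub 1
  have hgdiff : Differentiable ℝ g := fun r => (hgder r).differentiableAt
  have hgd' : deriv g = fun r => -(deriv Real.smoothTransition ((r - 1) / ε) * (1 / ε)) := 
    funext fun r => (hgder r).deriv
  have hgin : ∀ r, r ≤ 1 → g r = 1 := by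
    intro r hr
    simp only [hgd]
    rw [Real.smoothTransition.zero_of_nonpos (div_nonpos_of_nonpos_of_nonneg (by linarith) hε.le)]; simp
  have hgout : ∀ r, 1 + ε ≤ r → g r = 0 := by
    intro r hr
    simp only [hgd]
    rw [Real.smoothTransition.one_of_one_le (by rw [le_div_iff₀ hε]; linarith)]; simp
  have hdz : ∀ r, r ∉ Icc 1 (1 + ε) → deriv g r = 0 := by
    intro r hr
    rw [hgd']; simp only
    rw [st_deriv_zero]; · simp
    by_contra h; push Not at h
    rw [div_pos_iff_of_pos_right hε, div_lt_iff₀ hε] at h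
    exact hr ⟨by linarith, by linarith⟩
  have hmem : ∀ r, g r ∈ Icc (0:ℝ) 1 := fun r => by
    have h1 := Real.smoothTransition.nonneg ((r - 1) / ε)
    have h2 := Real.smoothTransition.le_one ((r - 1) / ε)
    simp only [hgd]; constructor <;> linarith
  have hdc : Continuous (deriv g) := by
    rw [hgd']
    exact ((st_deriv_cont.comp (by fun_prop : Continuous fun r : ℝ => (r - 1) / ε)).mul continuous_const).neg
  have hprof : Prof e g := by
    refine ⟨hgdiff, hdz 0 (by simp), hmem, ?_, ?_⟩
    · refine intOn_of_zero (a := 0) (b := 1 + ε) ?_ measurableSet_Ioi ?_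
      · have := hgdiff.continuous; fun_prop
      · intro r hr hr2
        have hr0 : (0:ℝ) < r := hr
        rw [hgout r]; · simp
        by_contra h; exact hr2 ⟨hr0.le, by linarith⟩
    · refine intOn_of_zero (a := 1) (b := 1 + ε) ?_ measurableSet_Ioi ?_
      · fun_prop
      · intro r hr hr2
        rw [hdz r hr2]; simp
  have h2e : (1 + ε) ^ (e + 1) ≤ 2 ^ (e + 1) := pow_le_pow_left₀ (by linarith) (by linarith) _
  have hG : GG e g ≤ 2 ^ (e + 1) * (B / ε) ^ 2 * ε := by
    have := int_pow_le (e := e) (F := fun r => (deriv g r) ^ 2) (a := 1) (b := 1 + ε) (B := (B / ε) ^ 2) 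
      (by norm_num) (by linarith) (by positivity) ?_ ?_
    · refine this.trans ?_
      rw [add_sub_cancel_left]; gcongr
    · intro r _ hr; rw [hdz r hr]; simp
    · intro r _
      simp only [hgd']
      rw [neg_sq, ← sq_abs]
      gcongr
      rw [abs_mul, abs_of_pos (by positivity : 0 < 1 / ε), ← div_eq_mul_one_div]
      exact div_le_div_of_nonneg_right (hst _) hε.le
  have hPb : PP e W g ≤ 2 ^ (e + 1) * K * ε := by
    have := int_pow_le (e := e) (F := fun r => W (g r)) (a := 1) (b := 1 + ε) (B := K) 
      (by norm_num) (by linarith) (by linarith) ?_ ?_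
    · refine this.trans ?_
      rw [add_sub_cancel_left]; gcongr
    · intro r _ hr
      by_cases h : r ≤ 1
      · rw [hgin r h, hP.W1]
      · rw [hgout r, hP.W0]
        by_contra h3; exact hr ⟨by linarith, by linarith⟩
    · intro r _
      have h1 := (le_abs_self _).trans (hP.qlW.sq (hmem r))
      have h2 := hmem r
      have : g r ^ 2 ≤ 1 := by nlinarith [h2.1, h2.2]
      nlinarith
  have hVnn : ∀ t ∈ Icc (0:ℝ) 1, 0 ≤ V t := fun t ht => by
    have := hP.Vmono (by simp) ht ht.1; rwa [hP.V0] at this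
  have hM : 1 / ((e:ℝ) + 2) ≤ PP e V g := by
    have h1 : ∫ r in Ioc (0:ℝ) 1, r ^ (e + 1) * V (g r) ≤ PP e V g := by
      refine setIntegral_mono_set (hprof.intU hP.qlV) ?_ (Ioc_subset_Ioi_self.eventuallyLE)
      filter_upwards [ae_restrict_mem measurableSet_Ioi] with r hr
      have hr : (0:ℝ) < r := hr
      have := hVnn _ (hmem r)
      simp only [Pi.zero_apply]; positivity
    have h2 : ∫ r in Ioc (0:ℝ) 1, r ^ (e + 1) * V (g r) = ∫ r in Ioc (0:ℝ) 1, r ^ (e + 1) := by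
      refine setIntegral_congr_fun measurableSet_Ioc fun r hr => ?_
      rw [hgin r hr.2, hP.V1, mul_one]
    rw [h2, int_pow 1 (by norm_num)] at h1
    simpa using h1
  set x := PP e V g / m with hxd
  have hxx : x0 ≤ x := by
    rw [hxd, hx0d, le_div_iff₀ hm]
    refine le_trans (le_of_eq ?_) hM
    field_simp
  have hx : 0 < x := by linarith
  have h5 := h0.scaled hε hm hprof hx (by rw [hxd]; field_simp)
  have hG0 : 0 ≤ GG e g := GG_nonneg
  have hP0 : 0 ≤ PP e W g := PP_nonneg hP.Wnn hmem
  have hix : 1 / x ≤ 1 / x0 := one_div_le_one_div_of_le hx0 hxx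
  have hix0 : 0 < 1 / x := by positivity
  have hb : 1 + (e:ℝ) / (e + 2) * (1 / x - 1) ≤ 1 + 1 / x0 := by
    have b0 : 0 ≤ (e:ℝ) / (e + 2) := by positivity
    have b1 : (e:ℝ) / (e + 2) ≤ 1 := by rw [div_le_one (by positivity)]; linarith
    nlinarith
  have hbb : (0:ℝ) ≤ 1 + 1 / x0 := by positivity
  calc EE e W ε f0 ≤ _ := h5
    _ ≤ ε * GG e g * (1 + 1 / x0) + PP e W g / (ε * x0) := by
      gcongr
    _ ≤ ε * (2 ^ (e + 1) * (B / ε) ^ 2 * ε) * (1 + 1 / x0) + (2 ^ (e + 1) * K * ε) / (ε * x0) := by gcongr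
    _ = _ := by field_simp

end S15

namespace S15

variable {W V : ℝ → ℝ} {τ c K : ℝ} {e : ℕ} {f g : ℝ → ℝ}

lemma Pot.Vnn (hP : Pot W V τ c K) : ∀ t ∈ Icc (0:ℝ) 1, 0 ≤ V t := fun t ht => by
  have := hP.Vmono (by simp) ht ht.1; rwa [hP.V0] at this

lemma Pot.Vle (hP : Pot W V τ c K) : ∀ t ∈ Icc (0:ℝ) 1, V t ≤ 1 := fun t ht => by
  have := hP.Vmono ht (by simp) ht.2; rwa [hP.V1] at this

lemma pow_sub_le (e : ℕ) {x R : ℝ} (hx : 0 ≤ x) (hR : 0 < R) : R ^ (e + 1) * |x - R| ≤ |x ^ (e + 2) - R ^ (e + 2)| := by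
  have h1 : x ^ (e + 2) - R ^ (e + 2) = (x - R) * R ^ (e + 1) + x * (x ^ (e + 1) - R ^ (e + 1)) := by ring
  rcases le_total R x with h | h
  · have h2 : R ^ (e + 1) ≤ x ^ (e + 1) := pow_le_pow_left₀ hR.le h _
    have h3 : 0 ≤ R ^ (e + 1) := by positivity
    have h4 := mul_nonneg hx (sub_nonneg.2 h2)
    have h5 := mul_nonneg (sub_nonneg.2 h) h3
    rw [abs_of_nonneg (by linarith), abs_of_nonneg] <;> linarith
  · have h2 : x ^ (e + 1) ≤ R ^ (e + 1) := pow_le_pow_left₀ hx h _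
    have h3 : 0 ≤ R ^ (e + 1) := by positivity
    rw [abs_of_nonpos (by linarith), abs_of_nonpos] <;> nlinarith

lemma Prof.tendsto_small (hf : Prof e f) {t : ℝ} (ht : 0 < t) : ∃ r > 0, f r < t := by
  by_contra h
  push Not at h
  have h1 : IntegrableOn (fun r : ℝ => r ^ (e + 1) * t ^ 2) (Ioi 0) := by
    refine Integrable.mono' hf.i0 (wt_meas _ aestronglyMeasurable_const) ?_
    filter_upwards [ae_restrict_mem measurableSet_Ioi] with r hr
    have hr0 : (0:ℝ) < r := hr
    rw [Real.norm_eq_abs, abs_of_nonneg (by positivity)]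
    have := h r hr
    gcongr
  have h2 : IntegrableOn (fun r : ℝ => t ^ 2) (Ioi 1) := by
    refine Integrable.mono' (h1.mono_set (Ioi_subset_Ioi zero_le_one)) aestronglyMeasurable_const ?_
    filter_upwards [ae_restrict_mem measurableSet_Ioi] with r hr
    have hr0 : (1:ℝ) < r := hr
    rw [Real.norm_eq_abs, abs_of_nonneg (by positivity)]
    have : 1 ≤ r ^ (e + 1) := one_le_pow₀ hr0.le
    nlinarith [sq_nonneg t]
  rw [integrableOn_const_iff] at h2
  simp [ht.ne'] at h2

set_option maxHeartbeats 800000 in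
lemma geom (hP : Pot W V τ c K) {m Λ : ℝ} (hm : 0 < m) (hΛ : 0 < Λ) :
    ∃ R > 0, ∃ C > 0, ∃ ε1 > 0, ∀ ε, 0 < ε → ε < ε1 → ∀ f, Prof e f → AntitoneOn f (Ici 0) → PP e V f = m → 
      EE e W ε f ≤ Λ → ∃ ρ1 ρ2, ρ1 < ρ2 ∧ f ρ1 = 1 - τ ∧ f ρ2 = τ ∧ |ρ1 - R| ≤ C * ε ∧ |ρ2 - R| ≤ C * ε ∧ 
        R / 2 ≤ ρ1 ∧ ρ2 ≤ 2 * R := by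
  have hK := hP.K1
  have hc := hP.c0
  have hτ := hP.τ0
  have hτ1 := hP.τ1
  set R : ℝ := ((e + 2) * m) ^ (1 / ((e:ℝ) + 2)) with hRd
  have hR : 0 < R := Real.rpow_pos_of_pos (by positivity) _
  have hRp : R ^ (e + 2) = (e + 2) * m := by
    rw [← Real.rpow_natCast, hRd, ← Real.rpow_mul (by positivity)]
    have : (1 / ((e:ℝ) + 2)) * ((e + 2 : ℕ) : ℝ) = 1 := by
      push_cast
      have : (e:ℝ) + 2 ≠ 0 := by positivity
      field_simp
    rw [this, Real.rpow_one]
  set C : ℝ := (e + 2) * (K + 1 / c) * Λ / R ^ (e + 1) with hCd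
  have hC : 0 < C := by positivity
  refine ⟨R, hR, C, hC, min (m / (2 * K * Λ)) (R / (2 * C)), by positivity, ?_⟩
  intro ε hε hε1 f hf ha hM hE
  have hε2 : K * Λ * ε < m := by
    have := lt_of_lt_of_le hε1 (min_le_left _ _)
    rw [lt_div_iff₀ (by positivity)] at this
    nlinarith [mul_pos (mul_pos (by linarith : 0 < K) hΛ) hε]
  have hε3 : C * ε ≤ R / 2 := by
    have := lt_of_lt_of_le hε1 (min_le_right _ _)
    rw [lt_div_iff₀ (by positivity)] at this
    nlinarith
  have hPW : PP e W f ≤ Λ * ε := by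
    have : PP e W f / ε ≤ Λ := by
      have : 0 ≤ ε * GG e f := mul_nonneg hε.le GG_nonneg
      unfold EE at hE; linarith
    rwa [div_le_iff₀ hε] at this
  have hiW := hf.intU hP.qlW
  have hiV := hf.intU hP.qlV
  have hWn : ∀ r, 0 ≤ W (f r) := fun r => hP.Wnn _ (hf.mem r)
  -- f 0 > 1 - τ
  have hf0 : 1 - τ < f 0 := by
    by_contra hcon
    push Not at hcon
    have h1 : PP e V f ≤ K * PP e W f := by
      unfold PP
      rw [← integral_const_mul]
      refine setIntegral_mono_on hiV (hiW.const_mul K) measurableSet_Ioi fun r hr => ?_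
      have hr0 : (0:ℝ) < r := hr
      have h2 : f r ≤ 1 - τ := (ha (by simp) (by simpa using hr0.le) hr0.le).trans hcon
      have h3 := hP.VW (f r) ⟨(hf.mem r).1, h2⟩
      have h4 : 0 < r ^ (e + 1) := by positivity
      nlinarith
    nlinarith
  obtain ⟨r0, hr0, hfr0⟩ := hf.tendsto_small hτ
  have hcf := hf.diff.continuous
  obtain ⟨ρ1, hρ1, hfρ1⟩ : ∃ ρ1 ∈ Icc 0 r0, f ρ1 = 1 - τ := by
    have := intermediate_value_Icc' hr0.le hcf.continuousOn
    exact this ⟨by linarith, hf0.le⟩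
  obtain ⟨ρ2, hρ2, hfρ2⟩ : ∃ ρ2 ∈ Icc 0 r0, f ρ2 = τ := by
    have := intermediate_value_Icc' hr0.le hcf.continuousOn
    exact this ⟨by linarith, by linarith⟩
  have hρ12 : ρ1 < ρ2 := by
    by_contra h; push Not at h
    have := ha (by simpa using hρ2.1) (by simpa using hρ1.1) h
    linarith
  have hρ10 : 0 < ρ1 := lt_of_le_of_ne hρ1.1 (by rintro rfl; linarith)
  -- estimate 1
  have hsplit : Ioi (0:ℝ) = Ioc 0 ρ1 ∪ Ioi ρ1 := (Ioc_union_Ioi_eq_Ioi hρ10.le).symm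
  have hdisj : Disjoint (Ioc 0 ρ1) (Ioi ρ1) := Ioc_disjoint_Ioi le_rfl
  have hsub : Ioi ρ1 ⊆ Ioi (0:ℝ) := Ioi_subset_Ioi hρ10.le
  have hMs : m = (∫ r in Ioc 0 ρ1, r ^ (e + 1) * V (f r)) + ∫ r in Ioi ρ1, r ^ (e + 1) * V (f r) := by
    rw [← hM, PP, hsplit]
    exact setIntegral_union hdisj measurableSet_Ioi (hiV.mono_set Ioc_subset_Ioi_self) (hiV.mono_set hsub)
  have hWs : PP e W f = (∫ r in Ioc 0 ρ1, r ^ (e + 1) * W (f r)) + ∫ r in Ioi ρ1, r ^ (e + 1) * W (f r) := by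
    rw [PP, hsplit]
    exact setIntegral_union hdisj measurableSet_Ioi (hiW.mono_set Ioc_subset_Ioi_self) (hiW.mono_set hsub)
  have hipow : ∀ x : ℝ, IntegrableOn (fun r : ℝ => r ^ (e + 1)) (Ioc 0 x) := fun x =>
    ((by fun_prop : Continuous fun r : ℝ => r ^ (e + 1)).integrableOn_Icc).mono_set Ioc_subset_Icc_self
  have hin : (∫ r in Ioc 0 ρ1, r ^ (e + 1)) - (∫ r in Ioc 0 ρ1, r ^ (e + 1) * V (f r)) ≤ K * ∫ r in Ioc 0 ρ1, r ^ (e + 1) * W (f r) := by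
    rw [← integral_sub (hipow _) (hiV.mono_set Ioc_subset_Ioi_self), ← integral_const_mul]
    refine setIntegral_mono_on ((hipow _).sub (hiV.mono_set Ioc_subset_Ioi_self)) ((hiW.mono_set Ioc_subset_Ioi_self).const_mul K) measurableSet_Ioc fun r hr => ?_
    have h2 : 1 - τ ≤ f r := by
      rw [← hfρ1]; exact ha (by simpa using hr.1.le) (by simpa using hρ10.le) hr.2
    have h3 := hP.VW1 (f r) ⟨h2, (hf.mem r).2⟩
    have hr1 := hr.1
    have h4 : 0 < r ^ (e + 1) := by positivity
    nlinarith
  have hin0 : 0 ≤ (∫ r in Ioc 0 ρ1, r ^ (e + 1)) - (∫ r in Ioc 0 ρ1, r ^ (e + 1) * V (f r)) := by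
    rw [sub_nonneg]
    refine setIntegral_mono_on (hiV.mono_set Ioc_subset_Ioi_self) (hipow _) measurableSet_Ioc fun r hr => ?_
    have h3 := hP.Vle _ (hf.mem r)
    have hr1 := hr.1
    have h4 : 0 < r ^ (e + 1) := by positivity
    nlinarith
  have hout : (∫ r in Ioi ρ1, r ^ (e + 1) * V (f r)) ≤ K * ∫ r in Ioi ρ1, r ^ (e + 1) * W (f r) := by
    rw [← integral_const_mul]
    refine setIntegral_mono_on (hiV.mono_set hsub) ((hiW.mono_set hsub).const_mul K) measurableSet_Ioi fun r hr => ?_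
    have hr1 : ρ1 < r := hr
    have hr0 : 0 < r := hρ10.trans hr1
    have h2 : f r ≤ 1 - τ := by
      rw [← hfρ1]; exact ha (by simpa using hρ10.le) (by simpa using hr0.le) hr1.le
    have h3 := hP.VW (f r) ⟨(hf.mem r).1, h2⟩
    have h4 : 0 < r ^ (e + 1) := by positivity
    nlinarith
  have hout0 : 0 ≤ (∫ r in Ioi ρ1, r ^ (e + 1) * V (f r)) := by
    refine setIntegral_nonneg measurableSet_Ioi fun r hr => ?_
    have hr1 : ρ1 < r := hr
    have hr0 : 0 < r := hρ10.trans hr1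
    have := hP.Vnn _ (hf.mem r)
    positivity
  have hWin0 : 0 ≤ (∫ r in Ioc 0 ρ1, r ^ (e + 1) * W (f r)) := by
    refine setIntegral_nonneg measurableSet_Ioc fun r hr => ?_
    have := hWn r
    have := hr.1
    positivity
  have hWout0 : 0 ≤ (∫ r in Ioi ρ1, r ^ (e + 1) * W (f r)) := by
    refine setIntegral_nonneg measurableSet_Ioi fun r hr => ?_
    have hr1 : ρ1 < r := hr
    have hr0 : 0 < r := hρ10.trans hr1
    have := hWn r
    positivity
  have hI1 := int_pow (e := e) ρ1 hρ10.le
  have he1 : |ρ1 ^ (e + 2) / (e + 2) - m| ≤ K * (Λ * ε) := by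
    have hkw : K * PP e W f ≤ K * (Λ * ε) := mul_le_mul_of_nonneg_left hPW (by linarith)
    rw [hWs, mul_add] at hkw
    have hk1 := mul_nonneg (by linarith : 0 ≤ K) hWin0
    have hk2 := mul_nonneg (by linarith : 0 ≤ K) hWout0
    rw [← hI1, abs_le]; constructor <;> linarith
  have he2 : 0 ≤ ρ2 ^ (e + 2) / (e + 2) - ρ1 ^ (e + 2) / (e + 2) ∧ 
      ρ2 ^ (e + 2) / (e + 2) - ρ1 ^ (e + 2) / (e + 2) ≤ (1 / c) * (Λ * ε) := by
    have hI2 := int_pow (e := e) ρ2 (hρ10.le.trans hρ12.le)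
    rw [← hI2, ← hI1]
    have : ∫ r in Ioc 0 ρ2, r ^ (e + 1) = (∫ r in Ioc 0 ρ1, r ^ (e + 1)) + ∫ r in Ioc ρ1 ρ2, r ^ (e + 1) := by
      rw [← Ioc_union_Ioc_eq_Ioc hρ10.le hρ12.le]
      exact setIntegral_union (Ioc_disjoint_Ioc_of_le le_rfl) measurableSet_Ioc (hipow _) 
        ((hipow ρ2).mono_set (Ioc_subset_Ioc_left hρ10.le))
    rw [this, add_sub_cancel_left]
    constructor
    · refine setIntegral_nonneg measurableSet_Ioc fun r hr => ?_
      have := hρ10.trans hr.1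
      positivity
    · have h1 : ∫ r in Ioc ρ1 ρ2, r ^ (e + 1) ≤ (1 / c) * ∫ r in Ioc ρ1 ρ2, r ^ (e + 1) * W (f r) := by
        rw [← integral_const_mul]
        refine setIntegral_mono_on ((hipow ρ2).mono_set (Ioc_subset_Ioc_left hρ10.le)) 
          ((hiW.mono_set (Ioc_subset_Ioi_self.trans hsub)).const_mul _) measurableSet_Ioc fun r hr => ?_
        have hr0 : 0 < r := hρ10.trans hr.1
        have h2 : f r ≤ 1 - τ := by
          rw [← hfρ1]; exact ha (by simpa using hρ10.le) (by simpa using hr0.le) hr.1.le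
        have h3 : τ ≤ f r := by
          rw [← hfρ2]; exact ha (by simpa using hr0.le) (by simpa using (hr0.le.trans hr.2)) hr.2
        have h4 := hP.Wmid _ ⟨h3, h2⟩
        have h5 : 1 ≤ 1 / c * W (f r) := by rw [one_div, ← div_eq_inv_mul, le_div_iff₀ hc]; linarith
        have h6 : 0 < r ^ (e + 1) := by positivity
        nlinarith
      refine h1.trans ?_
      gcongr
      refine le_trans ?_ hPW
      refine setIntegral_mono_set hiW ?_ ((Ioc_subset_Ioi_self.trans hsub).eventuallyLE)
      filter_upwards [ae_restrict_mem measurableSet_Ioi] with r hr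
      have hr : (0:ℝ) < r := hr
      have := hWn r
      simp only [Pi.zero_apply]; positivity
  have hfin : ∀ ρ, 0 ≤ ρ → |ρ ^ (e + 2) / (e + 2) - m| ≤ (K + 1 / c) * (Λ * ε) → |ρ - R| ≤ C * ε := by
    intro ρ hρ h
    have h1 := pow_sub_le e hρ hR
    rw [hRp] at h1
    have h2 : ρ ^ (e + 2) - (e + 2) * m = (e + 2) * (ρ ^ (e + 2) / (e + 2) - m) := by field_simp
    rw [h2, abs_mul, abs_of_pos (by positivity : (0:ℝ) < e + 2)] at h1
    have h3 : (0:ℝ) < e + 2 := by positivity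
    have h4 : R ^ (e + 1) * |ρ - R| ≤ (e + 2) * ((K + 1 / c) * (Λ * ε)) := h1.trans (by gcongr)
    rw [hCd, div_mul_eq_mul_div, le_div_iff₀ (by positivity)]
    linarith
  have hcp : 0 ≤ 1 / c * (Λ * ε) := by positivity
  have hk0 : 0 ≤ K * (Λ * ε) := by positivity
  have h1 : |ρ1 - R| ≤ C * ε := by
    apply hfin _ hρ10.le
    refine he1.trans ?_
    rw [add_mul]; linarith
  have h2 : |ρ2 - R| ≤ C * ε := by
    apply hfin _ (hρ10.le.trans hρ12.le)
    rw [abs_le] at he1 ⊢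
    rw [add_mul]
    constructor <;> linarith [he1.1, he1.2, he2.1, he2.2]
  refine ⟨ρ1, ρ2, hρ12, hfρ1, hfρ2, h1, h2, ?_, ?_⟩
  · have := (abs_le.1 h1).1; linarith
  · have := (abs_le.1 h2).2; linarith

end S15

namespace S15

variable {W V : ℝ → ℝ} {τ c K : ℝ} {e : ℕ} {f g : ℝ → ℝ}

lemma inverse_exists {k k' : ℝ → ℝ} {c : ℝ} (hc : 0 < c) (hk : ∀ t, HasDerivAt k (k' t) t) (hkc : ∀ t, c ≤ k' t) :
    ∃ j : ℝ → ℝ, (∀ t, j (k t) = t) ∧ (∀ s, k (j s) = s) ∧ (∀ s, HasDerivAt j (k' (j s))⁻¹ s) ∧ StrictMono k := by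
  have hd : Differentiable ℝ k := fun t => (hk t).differentiableAt
  have hmono : StrictMono k := strictMono_of_deriv_pos fun t => by rw [(hk t).deriv]; linarith [hkc t]
  have hgrow : ∀ x y, x ≤ y → c * (y - x) ≤ k y - k x := fun x y hxy =>
    mul_sub_le_image_sub_of_le_deriv hd (fun t => by rw [(hk t).deriv]; exact hkc t) hxy
  have hsurj : Function.Surjective k := by
    apply hd.continuous.surjective
    · refine tendsto_atTop_mono' atTop (f₁ := fun t => k 0 + c * t) ?_ ?_
      · filter_upwards [eventually_ge_atTop 0] with t ht
        have := hgrow 0 t ht; linarith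
      · exact tendsto_atTop_add_const_left _ _ (tendsto_id.const_mul_atTop hc)
    · refine tendsto_atBot_mono' atBot (f₁ := fun t => k 0 + c * t) ?_ ?_
      · filter_upwards [eventually_le_atBot 0] with t ht
        have := hgrow t 0 ht; linarith
      · exact tendsto_atBot_add_const_left _ _ (tendsto_id.const_mul_atBot hc)
  let o := hmono.orderIsoOfSurjective k hsurj
  have ho : ∀ t, o t = k t := fun t => rfl
  refine ⟨o.symm, fun t => ?_, fun s => ?_, fun s => ?_, hmono⟩
  · rw [← ho, o.symm_apply_apply]
  · rw [← ho, o.apply_symm_apply]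
  · refine HasDerivAt.of_local_left_inverse o.symm.continuous.continuousAt (hk (o.symm s)) (by linarith [hkc (o.symm s)]) ?_
    exact Eventually.of_forall fun s => by rw [← ho, o.apply_symm_apply]

/-- first-order expansion of an integral with varying weight -/
lemma expI {S : Set ℝ} (hS : MeasurableSet S) {h a A : ℝ → ℝ} {θ D B : ℝ} (hh : IntegrableOn h S) 
    (ha : Measurable a) (hA : Measurable A) (haB : ∀ t ∈ S, |a t| ≤ B)
    (hAa : ∀ t ∈ S, |A t - 1 - θ * a t| ≤ D * θ ^ 2) :
    IntegrableOn (fun t => h t * A t) S ∧ IntegrableOn (fun t => h t * a t) S ∧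
    |(∫ t in S, h t * A t) - (∫ t in S, h t) - θ * ∫ t in S, h t * a t| ≤ D * θ ^ 2 * ∫ t in S, |h t| := by
  have i1 : IntegrableOn (fun t => h t * a t) S := by
    refine Integrable.mul_bdd (c := B) hh ha.aestronglyMeasurable ?_
    filter_upwards [ae_restrict_mem hS] with t ht using haB t ht
  have i2 : IntegrableOn (fun t => h t * A t) S := by
    refine Integrable.mul_bdd (c := 1 + |θ| * B + D * θ ^ 2) hh hA.aestronglyMeasurable ?_
    filter_upwards [ae_restrict_mem hS] with t ht
    have h1 := hAa t ht
    have h2 := haB t ht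
    rw [Real.norm_eq_abs]
    have h3 : A t = 1 + θ * a t + (A t - 1 - θ * a t) := by ring
    have h4 : |θ * a t| ≤ |θ| * B := by rw [abs_mul]; gcongr
    calc |A t| = |1 + θ * a t + (A t - 1 - θ * a t)| := by rw [← h3]
      _ ≤ |1 + θ * a t| + |A t - 1 - θ * a t| := abs_add_le _ _
      _ ≤ |1| + |θ * a t| + |A t - 1 - θ * a t| := by gcongr; exact abs_add_le _ _
      _ ≤ _ := by rw [abs_one]; gcongr
  refine ⟨i2, i1, ?_⟩
  have e1 : (∫ t in S, h t * A t) - (∫ t in S, h t) - θ * ∫ t in S, h t * a t = ∫ t in S, h t * (A t - 1 - θ * a t) := by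
    rw [← integral_const_mul, ← integral_sub i2 hh, ← integral_sub (f := fun t => h t * A t - h t) (i2.sub hh) (i1.const_mul θ)]
    congr 1; ext t; ring
  rw [e1, ← Real.norm_eq_abs, ← integral_const_mul]
  refine norm_integral_le_of_norm_le (hh.abs.const_mul _) ?_
  filter_upwards [ae_restrict_mem hS] with t ht
  rw [Real.norm_eq_abs, abs_mul, mul_comm]
  exact mul_le_mul_of_nonneg_right (hAa t ht) (abs_nonneg _)

lemma pow_expand (m : ℕ) : ∃ C ≥ 0, ∀ x : ℝ, |x| ≤ 1 → |(1 + x) ^ m - 1 - m * x| ≤ C * x ^ 2 := by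
  induction m with
  | zero => exact ⟨0, le_rfl, fun x _ => by simp⟩
  | succ m ih =>
    obtain ⟨C, hC, h⟩ := ih
    refine ⟨2 * C + m, by positivity, fun x hx => ?_⟩
    have e1 : (1 + x) ^ (m + 1) - 1 - ((m + 1 : ℕ) : ℝ) * x = (1 + x) * ((1 + x) ^ m - 1 - m * x) + m * x ^ 2 := by
      push_cast; ring
    rw [e1]
    refine (abs_add_le _ _).trans ?_
    rw [abs_mul, abs_of_nonneg (by positivity : 0 ≤ (m:ℝ) * x ^ 2)]
    have h1 : |1 + x| ≤ 2 := by rw [abs_le] at *; constructor <;> linarith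
    have h2 := h x hx
    have h3 : |1 + x| * |(1 + x) ^ m - 1 - m * x| ≤ 2 * (C * x ^ 2) := by gcongr
    nlinarith

lemma wt_expand (m : ℕ) (B : ℝ) (hB : 0 < B) : ∃ D ≥ 0, ∀ θ y z : ℝ, |θ| * B ≤ 1 / 2 → |y| ≤ B → |z| ≤ B →
    |(1 + θ * y) ^ m * (1 + θ * z) - 1 - θ * (m * y + z)| ≤ D * θ ^ 2 ∧ 
    |(1 + θ * y) ^ m / (1 + θ * z) - 1 - θ * (m * y - z)| ≤ D * θ ^ 2 := by
  obtain ⟨C, hC, h⟩ := pow_expand m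
  refine ⟨2 * (C * B ^ 2 + m * B ^ 2 + B ^ 2), by positivity, fun θ y z hθ hy hz => ?_⟩
  have hty : |θ * y| ≤ 1 / 2 := by rw [abs_mul]; exact (mul_le_mul_of_nonneg_left hy (abs_nonneg _)).trans hθ
  have htz : |θ * z| ≤ 1 / 2 := by rw [abs_mul]; exact (mul_le_mul_of_nonneg_left hz (abs_nonneg _)).trans hθ
  have h1 := h (θ * y) (by linarith)
  have hy2 : y ^ 2 ≤ B ^ 2 := sq_le_sq' (by linarith [neg_abs_le y]) ((le_abs_self _).trans hy)
  have hyz : |y * z| ≤ B ^ 2 := by rw [abs_mul, sq]; gcongr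
  have hz2 : z ^ 2 ≤ B ^ 2 := sq_le_sq' (by linarith [neg_abs_le z]) ((le_abs_self _).trans hz)
  have h1' : |(1 + θ * y) ^ m - 1 - m * (θ * y)| ≤ C * B ^ 2 * θ ^ 2 := by
    refine h1.trans ?_
    rw [mul_pow]
    have : C * (θ ^ 2 * y ^ 2) ≤ C * (θ ^ 2 * B ^ 2) := by gcongr
    linarith
  set E := (1 + θ * y) ^ m - 1 - m * (θ * y) with hE
  have hm : (1 + θ * y) ^ m = 1 + m * (θ * y) + E := by rw [hE]; ring
  rw [hm]
  have hz1 : 1 / 2 ≤ 1 + θ * z := by have := neg_abs_le (θ * z); linarith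
  have hz3 : |1 + θ * z| ≤ 2 := by rw [abs_le] at *; constructor <;> linarith
  have hmyz : |(m:ℝ) * (y * z)| ≤ m * B ^ 2 := by
    rw [abs_mul, abs_of_nonneg (by positivity : (0:ℝ) ≤ m)]; gcongr
  constructor
  · have e1 : (1 + m * (θ * y) + E) * (1 + θ * z) - 1 - θ * (m * y + z) = E * (1 + θ * z) + θ ^ 2 * (m * (y * z)) := by ring
    rw [e1]
    refine (abs_add_le _ _).trans ?_
    have a1 : |E * (1 + θ * z)| ≤ C * B ^ 2 * θ ^ 2 * 2 := by rw [abs_mul]; gcongr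
    have a2 : |θ ^ 2 * (m * (y * z))| ≤ θ ^ 2 * (m * B ^ 2) := by
      rw [abs_mul, abs_of_nonneg (sq_nonneg θ)]; gcongr
    have a3 : 0 ≤ (m:ℝ) * B ^ 2 * θ ^ 2 := by positivity
    have a4 : 0 ≤ B ^ 2 * θ ^ 2 := by positivity
    linarith
  · have e1 : (1 + m * (θ * y) + E) / (1 + θ * z) - 1 - θ * (m * y - z) = (E - θ ^ 2 * (m * (y * z)) + θ ^ 2 * z ^ 2) / (1 + θ * z) := by
      have : 1 + θ * z ≠ 0 := by linarith
      field_simp; ring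
    rw [e1, abs_div, div_le_iff₀ (by rw [abs_pos]; linarith), abs_of_pos (by linarith : 0 < 1 + θ * z)]
    have a2 : |θ ^ 2 * (m * (y * z))| ≤ θ ^ 2 * (m * B ^ 2) := by
      rw [abs_mul, abs_of_nonneg (sq_nonneg θ)]; gcongr
    have a3 : |E - θ ^ 2 * (m * (y * z)) + θ ^ 2 * z ^ 2| ≤ C * B ^ 2 * θ ^ 2 + θ ^ 2 * (m * B ^ 2) + θ ^ 2 * B ^ 2 := by
      refine (abs_add_le _ _).trans ?_
      rw [abs_of_nonneg (by positivity : 0 ≤ θ ^ 2 * z ^ 2)]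
      have := abs_sub E (θ ^ 2 * (m * (y * z)))
      have : θ ^ 2 * z ^ 2 ≤ θ ^ 2 * B ^ 2 := by gcongr
      linarith
    have a5 : 0 ≤ 2 * (C * B ^ 2 + m * B ^ 2 + B ^ 2) * θ ^ 2 := by positivity
    nlinarith

end S15

namespace S15

variable {W V : ℝ → ℝ} {τ c K : ℝ} {e : ℕ} {f g : ℝ → ℝ}

/-- the Lagrangian potential -/
def FF (W V : ℝ → ℝ) (ε l t : ℝ) : ℝ := W t / ε - l * V t

lemma PP_FF (hP : Pot W V τ c K) {ε l : ℝ} (hf : Prof e f) :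
    PP e (FF W V ε l) f = PP e W f / ε - l * PP e V f := by
  unfold PP FF
  have h1 := hf.intU hP.qlW
  have h2 := hf.intU hP.qlV
  rw [← integral_div, ← integral_const_mul, ← integral_sub (h1.div_const ε) (h2.const_mul l)]
  congr 1; ext r; ring

lemma LL_eq (hP : Pot W V τ c K) {ε l : ℝ} (hf : Prof e f) : 
    LL e W V ε l f = ε * GG e f + PP e (FF W V ε l) f := by
  rw [PP_FF hP hf, LL, EE]; ring

/-- change of variables on the half-line -/
lemma cov {k k' : ℝ → ℝ} (hk : ∀ t, HasDerivAt k (k' t) t) (hpos : ∀ t, 0 < k' t) (him : k '' Ioi 0 = Ioi 0)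
    (H : ℝ → ℝ) : (∫ s in Ioi (0:ℝ), H s) = ∫ t in Ioi (0:ℝ), k' t * H (k t) ∧ 
    (IntegrableOn H (Ioi 0) ↔ IntegrableOn (fun t => k' t * H (k t)) (Ioi 0)) := by
  have hinj : InjOn k (Ioi 0) := by
    have : StrictMono k := strictMono_of_deriv_pos fun t => by rw [(hk t).deriv]; exact hpos t
    exact this.injective.injOn
  have h1 := integral_image_eq_integral_abs_deriv_smul measurableSet_Ioi (fun t _ => (hk t).hasDerivWithinAt) hinj H
  have h2 := integrableOn_image_iff_integrableOn_abs_deriv_smul measurableSet_Ioi (fun t _ => (hk t).hasDerivWithinAt) hinj H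
  rw [him] at h1 h2
  have h3 : ∀ t, |k' t| = k' t := fun t => abs_of_pos (hpos t)
  simp only [h3, smul_eq_mul] at h1 h2
  exact ⟨h1, h2⟩

/-- test fields for inner variations -/
structure Fld (χ X : ℝ → ℝ) (a B : ℝ) : Prop where
  a0 : 0 < a
  B0 : 0 < B
  cont : Continuous χ
  bd : ∀ t, |χ t| ≤ B
  der : ∀ t, HasDerivAt X (χ t) t
  zero : ∀ t, t ≤ a → X t = 0
  zero' : ∀ t, t ≤ a → χ t = 0
  Xbd : ∀ t, |X t| ≤ B * |t|

lemma Fld.neg {χ X : ℝ → ℝ} {a B : ℝ} (h : Fld χ X a B) : Fld (fun t => - χ t) (fun t => - X t) a B :=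
  ⟨h.a0, h.B0, h.cont.neg, fun t => by rw [abs_neg]; exact h.bd t, fun t => (h.der t).neg, 
    fun t ht => by rw [h.zero t ht, neg_zero], fun t ht => by rw [h.zero' t ht, neg_zero], 
    fun t => by rw [abs_neg]; exact h.Xbd t⟩

lemma Fld.Ybd {χ X : ℝ → ℝ} {a B : ℝ} (h : Fld χ X a B) (t : ℝ) : |X t / t| ≤ B := by
  rcases eq_or_ne t 0 with rfl | ht
  · simp [h.B0.le]
  · rw [abs_div, div_le_iff₀ (abs_pos.2 ht)]; exact h.Xbd t

/-- the perturbed profile -/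
lemma Fld.perturb (hP : Pot W V τ c K) {χ X : ℝ → ℝ} {a B : ℝ} (h : Fld χ X a B) (hf : Prof e f) {θ : ℝ} (hθ : |θ| * B ≤ 1 / 2) :
    ∃ g, (∀ {D}, (∀ y z, |y| ≤ B → |z| ≤ B → |(1 + θ * y) ^ (e + 1) * (1 + θ * z) - 1 - θ * (((e + 1 : ℕ) : ℝ) * y + z)| ≤ D * θ ^ 2 ∧ 
    |(1 + θ * y) ^ (e + 1) / (1 + θ * z) - 1 - θ * (((e + 1 : ℕ) : ℝ) * y - z)| ≤ D * θ ^ 2) → Prof e g) ∧ 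
      GG e g = (∫ t in Ioi (0:ℝ), (t ^ (e + 1) * (deriv f t) ^ 2) * ((1 + θ * (X t / t)) ^ (e + 1) / (1 + θ * χ t))) ∧ 
      (∀ U : ℝ → ℝ, PP e U g = ∫ t in Ioi (0:ℝ), (t ^ (e + 1) * U (f t)) * ((1 + θ * (X t / t)) ^ (e + 1) * (1 + θ * χ t))) := by
  have hB := h.B0
  have hχ : ∀ t, |θ * χ t| ≤ 1 / 2 := fun t => by
    rw [abs_mul]; exact (mul_le_mul_of_nonneg_left (h.bd t) (abs_nonneg _)).trans hθ
  have hk' : ∀ t, 1 / 2 ≤ 1 + θ * χ t := fun t => by have := neg_abs_le (θ * χ t); linarith [hχ t]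
  have hk : ∀ t, HasDerivAt (fun t => t + θ * X t) (1 + θ * χ t) t := fun t => 
    (hasDerivAt_id t).add ((h.der t).const_mul θ)
  obtain ⟨j, j1, j2, j3, kmono⟩ := inverse_exists (by norm_num) hk hk'
  have k0 : (0:ℝ) + θ * X 0 = 0 := by rw [h.zero 0 h.a0.le]; simp
  have him : (fun t => t + θ * X t) '' Ioi 0 = Ioi 0 := by
    ext s; constructor
    · rintro ⟨t, ht, rfl⟩
      have := kmono ht
      simp only [k0] at this; exact this
    · intro hs
      refine ⟨j s, ?_, j2 s⟩
      have hs : (0:ℝ) < s := hs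
      rw [← j2 s, ← k0] at hs
      exact kmono.lt_iff_lt.1 hs
  have hkpos : ∀ t, 0 < 1 + θ * χ t := fun t => by linarith [hk' t]
  have hder : ∀ s, HasDerivAt (fun s => f (j s)) (deriv f (j s) * (1 + θ * χ (j s))⁻¹) s := fun s =>
    (hf.diff (j s)).hasDerivAt.comp s (j3 s)
  have hder' : deriv (fun s => f (j s)) = fun s => deriv f (j s) * (1 + θ * χ (j s))⁻¹ := funext fun s => (hder s).deriv
  have hkt : ∀ t : ℝ, 0 < t → t + θ * X t = t * (1 + θ * (X t / t)) := fun t ht => by field_simp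
  have cU : ∀ U : ℝ → ℝ, ∀ t ∈ Ioi (0:ℝ), (1 + θ * χ t) * ((t + θ * X t) ^ (e + 1) * U (f (j (t + θ * X t)))) = 
      (t ^ (e + 1) * U (f t)) * ((1 + θ * (X t / t)) ^ (e + 1) * (1 + θ * χ t)) := by
    intro U t ht
    have := j1 t
    rw [this, hkt t ht, mul_pow]; ring
  have cG : ∀ t ∈ Ioi (0:ℝ), (1 + θ * χ t) * ((t + θ * X t) ^ (e + 1) * (deriv (fun s => f (j s)) (t + θ * X t)) ^ 2) = 
      (t ^ (e + 1) * (deriv f t) ^ 2) * ((1 + θ * (X t / t)) ^ (e + 1) / (1 + θ * χ t)) := by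
    intro t ht
    have := j1 t
    rw [hder']
    simp only
    rw [this, hkt t ht, mul_pow]
    have := (hkpos t).ne'
    field_simp
  have hXc : Measurable X := (show Continuous X from continuous_iff_continuousAt.2 fun t => (h.der t).continuousAt).measurable
  have hχm := h.cont.measurable
  refine ⟨fun s => f (j s), ?_, ?_, ?_⟩
  · intro D hD
    have hab : ∀ t : ℝ, |((e + 1 : ℕ) : ℝ) * (X t / t) - χ t| ≤ ((e + 1 : ℕ) : ℝ) * B + B := fun t => by
      refine (abs_sub _ _).trans ?_
      rw [abs_mul, abs_of_nonneg (by positivity : (0:ℝ) ≤ ((e + 1 : ℕ) : ℝ))]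
      have := h.Ybd t; have := h.bd t
      gcongr
    have hab' : ∀ t : ℝ, |((e + 1 : ℕ) : ℝ) * (X t / t) + χ t| ≤ ((e + 1 : ℕ) : ℝ) * B + B := fun t => by
      refine (abs_add_le _ _).trans ?_
      rw [abs_mul, abs_of_nonneg (by positivity : (0:ℝ) ≤ ((e + 1 : ℕ) : ℝ))]
      have := h.Ybd t; have := h.bd t
      gcongr
    refine ⟨fun s => (hder s).differentiableAt, ?_, fun s => hf.mem _, ?_, ?_⟩
    · rw [hder']; simp only
      have : j 0 = 0 := by have := j1 0; simp only [k0] at this; exact this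
      rw [this, hf.d0, zero_mul]
    · rw [(cov hk hkpos him _).2]
      refine IntegrableOn.congr_fun ?_ (fun t ht => (cU (fun x => x ^ 2) t ht).symm) measurableSet_Ioi
      exact (expI measurableSet_Ioi hf.i0 (by fun_prop) (by fun_prop) (fun t _ => hab' t) 
        (fun t _ => (hD _ _ (h.Ybd t) (h.bd t)).1)).1
    · rw [(cov hk hkpos him _).2]
      refine IntegrableOn.congr_fun ?_ (fun t ht => (cG t ht).symm) measurableSet_Ioi
      exact (expI measurableSet_Ioi hf.i1 (by fun_prop) (by fun_prop) (fun t _ => hab t) 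
        (fun t _ => (hD _ _ (h.Ybd t) (h.bd t)).2)).1
  · unfold GG
    rw [(cov hk hkpos him _).1]
    exact setIntegral_congr_fun measurableSet_Ioi cG
  · intro U
    unfold PP
    rw [(cov hk hkpos him _).1]
    exact setIntegral_congr_fun measurableSet_Ioi (cU U)

/-- one-sided inner variation -/
lemma inner_var_ge (hP : Pot W V τ c K) {m ε : ℝ} (hε : 0 < ε) (hm : 0 < m) {f0 : ℝ → ℝ} (h0 : Mini e W V m ε f0)
    {χ X : ℝ → ℝ} {a B : ℝ} (h : Fld χ X a B) :
    0 ≤ ε * (∫ t in Ioi (0:ℝ), (t ^ (e + 1) * (deriv f0 t) ^ 2) * (((e + 1 : ℕ) : ℝ) * (X t / t) - χ t)) + 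
      ((∫ t in Ioi (0:ℝ), (t ^ (e + 1) * W (f0 t)) * (((e + 1 : ℕ) : ℝ) * (X t / t) + χ t)) / ε - 
       lam e W m ε f0 * (∫ t in Ioi (0:ℝ), (t ^ (e + 1) * V (f0 t)) * (((e + 1 : ℕ) : ℝ) * (X t / t) + χ t))) := by
  have hB := h.B0
  obtain ⟨D, hD, hexp⟩ := wt_expand (e + 1) B hB
  have hf := h0.prof
  have hXc : Measurable X := (show Continuous X from continuous_iff_continuousAt.2 fun t => (h.der t).continuousAt).measurable
  have hχm := h.cont.measurable
  have hab : ∀ t : ℝ, |((e + 1 : ℕ) : ℝ) * (X t / t) - χ t| ≤ ((e + 1 : ℕ) : ℝ) * B + B := fun t => by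
    refine (abs_sub _ _).trans ?_
    rw [abs_mul, abs_of_nonneg (by positivity : (0:ℝ) ≤ ((e + 1 : ℕ) : ℝ))]
    have := h.Ybd t; have := h.bd t
    gcongr
  have hab' : ∀ t : ℝ, |((e + 1 : ℕ) : ℝ) * (X t / t) + χ t| ≤ ((e + 1 : ℕ) : ℝ) * B + B := fun t => by
    refine (abs_add_le _ _).trans ?_
    rw [abs_mul, abs_of_nonneg (by positivity : (0:ℝ) ≤ ((e + 1 : ℕ) : ℝ))]
    have := h.Ybd t; have := h.bd t
    gcongr
  set dG := ∫ t in Ioi (0:ℝ), (t ^ (e + 1) * (deriv f0 t) ^ 2) * (((e + 1 : ℕ) : ℝ) * (X t / t) - χ t) with hdG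
  set dW := ∫ t in Ioi (0:ℝ), (t ^ (e + 1) * W (f0 t)) * (((e + 1 : ℕ) : ℝ) * (X t / t) + χ t) with hdW
  set dV := ∫ t in Ioi (0:ℝ), (t ^ (e + 1) * V (f0 t)) * (((e + 1 : ℕ) : ℝ) * (X t / t) + χ t) with hdV
  set NG := ∫ t in Ioi (0:ℝ), |t ^ (e + 1) * (deriv f0 t) ^ 2|
  set NW := ∫ t in Ioi (0:ℝ), |t ^ (e + 1) * W (f0 t)|
  set NV := ∫ t in Ioi (0:ℝ), |t ^ (e + 1) * V (f0 t)|
  have NG0 : 0 ≤ NG := integral_nonneg fun _ => abs_nonneg _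
  have NW0 : 0 ≤ NW := integral_nonneg fun _ => abs_nonneg _
  have NV0 : 0 ≤ NV := integral_nonneg fun _ => abs_nonneg _
  set A := |dG| + |dW| + |dV| + D * (NG + NW + NV) with hAd
  have hA : 0 ≤ A := by positivity
  obtain ⟨Bq, hq⟩ := h0.quasi hε hm hA
  set l := lam e W m ε f0 with hl
  set N := D * (ε * NG + NW / ε + |l| * NV) with hN
  set θ0 := min (1 / (2 * B)) (min 1 (m / (2 * (A + 1)))) with hθ0
  have hθ0p : 0 < θ0 := by positivity
  have main : ∀ θ, 0 < θ → θ ≤ θ0 → 0 ≤ ε * dG + (dW / ε - l * dV) + (Bq + N) * θ := by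
    intro θ hθ hθ1
    have t1 : |θ| * B ≤ 1 / 2 := by
      have := hθ1.trans (min_le_left _ _)
      rw [le_div_iff₀ (by positivity)] at this
      rw [abs_of_pos hθ]; linarith
    have t2 : θ ≤ 1 := hθ1.trans ((min_le_right _ _).trans (min_le_left _ _))
    have t3 : A * θ ≤ m / 2 := by
      have := hθ1.trans ((min_le_right _ _).trans (min_le_right _ _))
      rw [le_div_iff₀ (by positivity)] at this
      nlinarith
    obtain ⟨g, g1, g2, g3⟩ := h.perturb hP hf t1
    have hex := fun y z hy hz => hexp θ y z t1 hy hz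
    have gP := g1 hex
    have eG := (expI measurableSet_Ioi hf.i1 (a := fun t => ((e + 1 : ℕ) : ℝ) * (X t / t) - χ t) (A := fun t => (1 + θ * (X t / t)) ^ (e + 1) / (1 + θ * χ t)) (by fun_prop) (by fun_prop) (fun t _ => hab t) 
        (fun t _ => (hex _ _ (h.Ybd t) (h.bd t)).2)).2.2
    have eW := (expI measurableSet_Ioi (hf.intU hP.qlW) (a := fun t => ((e + 1 : ℕ) : ℝ) * (X t / t) + χ t) (A := fun t => (1 + θ * (X t / t)) ^ (e + 1) * (1 + θ * χ t)) (by fun_prop) (by fun_prop) (fun t _ => hab' t) 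
        (fun t _ => (hex _ _ (h.Ybd t) (h.bd t)).1)).2.2
    have eV := (expI measurableSet_Ioi (hf.intU hP.qlV) (a := fun t => ((e + 1 : ℕ) : ℝ) * (X t / t) + χ t) (A := fun t => (1 + θ * (X t / t)) ^ (e + 1) * (1 + θ * χ t)) (by fun_prop) (by fun_prop) (fun t _ => hab' t) 
        (fun t _ => (hex _ _ (h.Ybd t) (h.bd t)).1)).2.2
    rw [← g2] at eG
    rw [← g3 W] at eW
    rw [← g3 V] at eV
    change |GG e g - GG e f0 - θ * dG| ≤ D * θ ^ 2 * NG at eG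
    change |PP e W g - PP e W f0 - θ * dW| ≤ D * θ ^ 2 * NW at eW
    change |PP e V g - PP e V f0 - θ * dV| ≤ D * θ ^ 2 * NV at eV
    rw [h0.mass] at eV
    have hθ2 : θ ^ 2 ≤ θ := by nlinarith
    have lin : ∀ {x d n : ℝ}, 0 ≤ n → |x - θ * d| ≤ D * θ ^ 2 * n → |d| + D * n ≤ A → |x| ≤ A * θ := by
      intro x d n hn hx hA2
      have e1 : x = (x - θ * d) + θ * d := by ring
      have e2 : |x| ≤ |x - θ * d| + |θ * d| := by
        conv_lhs => rw [e1]
        exact abs_add_le _ _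
      rw [abs_mul, abs_of_pos hθ] at e2
      have e3 : D * θ ^ 2 * n ≤ D * θ * n := by gcongr
      nlinarith
    have hDG : 0 ≤ D * NG := by positivity
    have hDW : 0 ≤ D * NW := by positivity
    have hDV : 0 ≤ D * NV := by positivity
    have q1 := lin NG0 eG (by rw [hAd]; linarith [abs_nonneg dW, abs_nonneg dV])
    have q2 := lin NW0 eW (by rw [hAd]; linarith [abs_nonneg dG, abs_nonneg dV])
    have q3 := lin NV0 eV (by rw [hAd]; linarith [abs_nonneg dG, abs_nonneg dW])
    have q4 : m / 2 ≤ PP e V g := by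
      have := (abs_le.1 q3).1; linarith
    have q := hq θ g hθ.le t2 gP q1 q2 q3 q4
    unfold LL EE at q
    rw [h0.mass] at q
    have r1 : ε * (GG e g - GG e f0) ≤ ε * (θ * dG + D * θ ^ 2 * NG) := by
      have := (abs_le.1 eG).2; gcongr; linarith
    have r2 : (PP e W g - PP e W f0) / ε ≤ (θ * dW + D * θ ^ 2 * NW) / ε := by
      have := (abs_le.1 eW).2; gcongr; linarith
    have r3 : - l * (PP e V g - m) ≤ - l * (θ * dV) + |l| * (D * θ ^ 2 * NV) := by
      have s1 : -l * (PP e V g - m - θ * dV) ≤ |l| * (D * θ ^ 2 * NV) := by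
        refine (le_abs_self _).trans ?_
        rw [abs_mul, abs_neg]; gcongr
      linarith
    have r4 : 0 ≤ θ * (ε * dG + (dW / ε - l * dV) + (Bq + N) * θ) := by
      have : θ * (ε * dG + (dW / ε - l * dV) + (Bq + N) * θ) = ε * (θ * dG + D * θ ^ 2 * NG) + (θ * dW + D * θ ^ 2 * NW) / ε + (- l * (θ * dV) + |l| * (D * θ ^ 2 * NV)) + Bq * θ ^ 2 := by
        rw [hN]; ring
      rw [this]
      rw [sub_div] at r2
      linarith
    exact nonneg_of_mul_nonneg_right r4 hθ
  refine ge_of_tendsto (f := fun θ => ε * dG + (dW / ε - l * dV) + (Bq + N) * θ) (x := nhdsWithin (0:ℝ) (Ioi 0)) ?_ ?_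
  · have : Continuous fun θ : ℝ => ε * dG + (dW / ε - l * dV) + (Bq + N) * θ := by fun_prop
    have h2 := (this.tendsto 0).mono_left (nhdsWithin_le_nhds (s := Ioi 0))
    simpa using h2
  · filter_upwards [Ioc_mem_nhdsGT hθ0p] with θ hθ using main θ hθ.1 hθ.2

end S15

namespace S15

variable {W V : ℝ → ℝ} {τ c K : ℝ} {e : ℕ} {f g : ℝ → ℝ}

lemma fub {b χ : ℝ → ℝ} {a : ℝ} (ha : 0 < a) (hb : IntegrableOn b (Ioi a)) (hχ : Continuous χ) (hχi : Integrable χ)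
    (hz : ∀ t ≤ a, χ t = 0) : ∫ s in Ioi (0:ℝ), b s * (∫ t in (0:ℝ)..s, χ t) = ∫ t in Ioi (0:ℝ), χ t * ∫ s in Ioi t, b s := by
  have hX0 : ∀ s, 0 ≤ s → (∫ t in (0:ℝ)..s, χ t) = ∫ t in Ioi a, (Iio s).indicator χ t := by
    intro s hs
    rw [setIntegral_indicator measurableSet_Iio, intervalIntegral.integral_of_le hs, integral_Ioc_eq_integral_Ioo]
    refine setIntegral_eq_of_subset_of_forall_sdiff_eq_zero measurableSet_Ioo ?_ ?_
    · intro t ht; exact ⟨ha.trans ht.1, ht.2⟩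
    · intro t ht
      apply hz
      by_contra h
      exact ht.2 ⟨by simpa using h, ht.1.2⟩
  have hsub : Ioi a ⊆ Ioi (0:ℝ) := Ioi_subset_Ioi ha.le
  have e1 : ∫ s in Ioi (0:ℝ), b s * (∫ t in (0:ℝ)..s, χ t) = ∫ s in Ioi a, ∫ t in Ioi a, {p : ℝ × ℝ | p.2 < p.1}.indicator (fun p => b p.1 * χ p.2) (s, t) := by
    rw [setIntegral_eq_of_subset_of_forall_sdiff_eq_zero measurableSet_Ioi hsub]
    · refine setIntegral_congr_fun measurableSet_Ioi fun s hs => ?_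
      have hs0 : 0 < s := ha.trans hs
      rw [hX0 s hs0.le, ← integral_const_mul]
      congr 1; ext t
      by_cases h : t < s
      · rw [indicator_of_mem (show t ∈ Iio s from h), indicator_of_mem (show (s, t) ∈ {p : ℝ × ℝ | p.2 < p.1} from h)]
      · rw [indicator_of_notMem (show t ∉ Iio s from h), indicator_of_notMem (show (s, t) ∉ {p : ℝ × ℝ | p.2 < p.1} from h), mul_zero]
    · intro s hs
      have hsa : s ≤ a := by simpa using hs.2
      have hs0 : (0:ℝ) < s := hs.1
      rw [hX0 s hs0.le]
      have : ∫ t in Ioi a, (Iio s).indicator χ t = 0 := by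
        refine setIntegral_eq_zero_of_forall_eq_zero fun t ht => ?_
        have ht : a < t := ht
        rw [indicator_of_notMem]; simp; linarith
      rw [this, mul_zero]
  have hmeas : MeasurableSet {p : ℝ × ℝ | p.2 < p.1} := measurableSet_lt measurable_snd measurable_fst
  rw [e1, integral_integral_swap]
  · rw [setIntegral_eq_of_subset_of_forall_sdiff_eq_zero measurableSet_Ioi hsub]
    · refine setIntegral_congr_fun measurableSet_Ioi fun t ht => ?_
      have ht : a < t := ht
      rw [← integral_const_mul]
      have : Ioi t = Ioi a ∩ Ioi t := by
        ext s; simp only [mem_inter_iff, mem_Ioi]; constructor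
        · intro h; exact ⟨ht.trans h, h⟩
        · exact fun h => h.2
      rw [this, ← setIntegral_indicator measurableSet_Ioi]
      congr 1; ext s
      by_cases h : t < s
      · rw [indicator_of_mem (show s ∈ Ioi t from h), indicator_of_mem (show (s, t) ∈ {p : ℝ × ℝ | p.2 < p.1} from h), mul_comm]
      · rw [indicator_of_notMem (show s ∉ Ioi t from h), indicator_of_notMem (show (s, t) ∉ {p : ℝ × ℝ | p.2 < p.1} from h)]
    · intro t ht
      rw [hz t (by simpa using ht.2), zero_mul]
  · have := Integrable.mul_prod hb (hχi.integrableOn (s := Ioi a))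
    exact this.indicator hmeas

lemma fld_of_test {χ : ℝ → ℝ} (hχ : Continuous χ) (hc : HasCompactSupport χ) (hs : tsupport χ ⊆ Ioi 0) :
    ∃ a B, Fld χ (fun t => ∫ s in (0:ℝ)..t, χ s) a B := by
  obtain ⟨a, ha, hza⟩ : ∃ a > 0, ∀ t ≤ a, χ t = 0 := by
    by_cases hne : (tsupport χ).Nonempty
    · obtain ⟨p, hp, hl⟩ := hc.isCompact.exists_isLeast hne
      have hp0 : 0 < p := hs hp
      refine ⟨p / 2, by positivity, fun t ht => ?_⟩
      apply image_eq_zero_of_notMem_tsupport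
      intro h
      have := hl h; linarith
    · refine ⟨1, one_pos, fun t _ => ?_⟩
      apply image_eq_zero_of_notMem_tsupport
      exact fun h => hne ⟨t, h⟩
  obtain ⟨B, hB⟩ := hc.exists_bound_of_continuous hχ
  have hB' : ∀ t, |χ t| ≤ |B| + 1 := fun t => by
    have := hB t; rw [Real.norm_eq_abs] at this; linarith [le_abs_self B]
  refine ⟨a, |B| + 1, ha, by positivity, hχ, hB', ?_, ?_, hza, ?_⟩
  · intro t
    exact (hχ.integral_hasStrictDerivAt 0 t).hasDerivAt
  · intro t ht
    refine intervalIntegral.integral_zero_ae (Eventually.of_forall fun s hs => ?_)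
    apply hza
    rcases mem_uIoc.1 hs with h | h
    · exact h.2.trans ht
    · exact h.2.trans ha.le
  · intro t
    have := intervalIntegral.norm_integral_le_of_norm_le_const (a := 0) (b := t) (f := χ) (C := |B| + 1) (fun s _ => hB' s)
    simpa using this

/-- a.e. first integral -/
lemma first_integral_ae (hP : Pot W V τ c K) {m ε : ℝ} (hε : 0 < ε) (hm : 0 < m) {f0 : ℝ → ℝ} (h0 : Mini e W V m ε f0) :
    (∀ a > 0, IntegrableOn (fun s : ℝ => ((e:ℝ) + 1) * s ^ e * (FF W V ε (lam e W m ε f0) (f0 s) + ε * (deriv f0 s) ^ 2)) (Ioi a)) ∧ 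
    ContinuousOn (fun t => ∫ s in Ioi t, ((e:ℝ) + 1) * s ^ e * (FF W V ε (lam e W m ε f0) (f0 s) + ε * (deriv f0 s) ^ 2)) (Ioi 0) ∧ 
    IntegrableOn (fun t => t ^ (e + 1) * (FF W V ε (lam e W m ε f0) (f0 t) + ε * (deriv f0 t) ^ 2)) (Ioi 0) ∧ 
    ∀ᵐ t, t ∈ Ioi (0:ℝ) → t ^ (e + 1) * (FF W V ε (lam e W m ε f0) (f0 t) - ε * (deriv f0 t) ^ 2)
      + ∫ s in Ioi t, ((e:ℝ) + 1) * s ^ e * (FF W V ε (lam e W m ε f0) (f0 s) + ε * (deriv f0 s) ^ 2) = 0 := by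
  set l := lam e W m ε f0 with hl
  set F := fun t => FF W V ε l (f0 t) with hF
  set q := deriv f0 with hq
  set b := fun s : ℝ => ((e:ℝ) + 1) * s ^ e * (F s + ε * (q s) ^ 2) with hb
  have hf := h0.prof
  have iW := hf.intU hP.qlW
  have iV := hf.intU hP.qlV
  have iF : IntegrableOn (fun t => t ^ (e + 1) * F t) (Ioi 0) := by
    refine IntegrableOn.congr_fun ((iW.div_const ε).sub (iV.const_mul l)) (fun t _ => ?_) measurableSet_Ioi
    simp only [hF, FF, Pi.sub_apply]; ring
  have iq : IntegrableOn (fun t => t ^ (e + 1) * (ε * (q t) ^ 2)) (Ioi 0) := by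
    refine IntegrableOn.congr_fun (hf.i1.const_mul ε) (fun t _ => ?_) measurableSet_Ioi
    simp only [hq]; ring
  have iplus : IntegrableOn (fun t => t ^ (e + 1) * (F t + ε * (q t) ^ 2)) (Ioi 0) := by
    refine IntegrableOn.congr_fun (iF.add iq) (fun t _ => ?_) measurableSet_Ioi
    simp only [Pi.add_apply]; ring
  have iminus : IntegrableOn (fun t => t ^ (e + 1) * (F t - ε * (q t) ^ 2)) (Ioi 0) := by
    refine IntegrableOn.congr_fun (iF.sub iq) (fun t _ => ?_) measurableSet_Ioi
    simp only [Pi.sub_apply]; ring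
  have ib : ∀ a > 0, IntegrableOn b (Ioi a) := by
    intro a ha
    have h1 := iplus.mono_set (Ioi_subset_Ioi ha.le)
    have h2 : IntegrableOn (fun t => (t ^ (e + 1) * (F t + ε * (q t) ^ 2)) * (((e:ℝ) + 1) / t)) (Ioi a) := by
      refine Integrable.mul_bdd (c := ((e:ℝ) + 1) / a) h1 (by fun_prop) ?_
      filter_upwards [ae_restrict_mem measurableSet_Ioi] with t ht
      have ht : a < t := ht
      rw [Real.norm_eq_abs, abs_of_nonneg (by have := ha.trans ht; positivity)]
      gcongr
    refine IntegrableOn.congr_fun h2 (fun t ht => ?_) measurableSet_Ioi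
    have ht : 0 < t := ha.trans ht
    simp only [hb]; field_simp; ring
  have hHc : ContinuousOn (fun t => ∫ s in Ioi t, b s) (Ioi 0) := by
    intro t0 ht0
    have ht0 : (0:ℝ) < t0 := ht0
    have hc1 : Continuous fun t => ∫ s in (t0 / 2)..t, (Ioi (t0 / 2)).indicator b s :=
      intervalIntegral.continuous_primitive (fun x y => ((integrable_indicator_iff measurableSet_Ioi).2 (ib (t0/2) (by positivity))).intervalIntegrable) _
    have hc2 : ContinuousAt (fun t => (∫ s in Ioi (t0 / 2), b s) - ∫ s in (t0 / 2)..t, (Ioi (t0 / 2)).indicator b s) t0 := by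
      fun_prop
    refine (hc2.congr ?_).continuousWithinAt
    filter_upwards [lt_mem_nhds (half_lt_self ht0)] with t ht
    rw [intervalIntegral.integral_of_le ht.le, setIntegral_indicator measurableSet_Ioi, sub_eq_iff_eq_add]
    have e1 : Ioc (t0 / 2) t ∩ Ioi (t0 / 2) = Ioc (t0 / 2) t := by
      apply inter_eq_left.2; exact Ioc_subset_Ioi_self
    rw [e1, ← Ioc_union_Ioi_eq_Ioi ht.le, setIntegral_union (Ioc_disjoint_Ioi le_rfl) measurableSet_Ioi, add_comm]
    · exact (ib _ (half_pos ht0)).mono_set Ioc_subset_Ioi_self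
    · exact ib _ ((half_pos ht0).trans ht)
  refine ⟨ib, hHc, iplus, ?_⟩
  refine IsOpen.ae_eq_zero_of_integral_contDiff_smul_eq_zero isOpen_Ioi ?_ ?_
  · exact iminus.locallyIntegrableOn.add (hHc.locallyIntegrableOn measurableSet_Ioi)
  intro χ hχs hχc hχt
  have hχ : Continuous χ := hχs.continuous
  obtain ⟨a, B, hfld⟩ := fld_of_test hχ hχc hχt
  set X := fun t => ∫ s in (0:ℝ)..t, χ s with hX
  have v1 := inner_var_ge hP hε hm h0 hfld
  have v2 := inner_var_ge hP hε hm h0 hfld.neg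
  rw [← hl] at v1 v2
  have hXm : Measurable X := (show Continuous X from continuous_iff_continuousAt.2 fun t => (hfld.der t).continuousAt).measurable
  have hχm := hχ.measurable
  have bdd : ∀ {h : ℝ → ℝ}, IntegrableOn h (Ioi 0) → IntegrableOn (fun t => h t * χ t) (Ioi 0) ∧ 
      IntegrableOn (fun t => h t * (((e + 1 : ℕ) : ℝ) * (X t / t))) (Ioi 0) := by
    intro h hh
    constructor
    · exact Integrable.mul_bdd (c := B) hh hχm.aestronglyMeasurable (Eventually.of_forall fun t => hfld.bd t)
    · refine Integrable.mul_bdd (c := ((e + 1 : ℕ) : ℝ) * B) hh (measurable_const.mul (hXm.div measurable_id)).aestronglyMeasurable (Eventually.of_forall fun t => ?_)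
      rw [Real.norm_eq_abs, abs_mul, abs_of_nonneg (by positivity : (0:ℝ) ≤ ((e + 1 : ℕ) : ℝ))]
      have := hfld.Ybd t
      gcongr
  -- the combined identity
  have comb : ∀ σ : ℝ, ε * (∫ t in Ioi (0:ℝ), (t ^ (e + 1) * (q t) ^ 2) * (((e + 1 : ℕ) : ℝ) * ((σ * X t) / t) - σ * χ t)) + 
      ((∫ t in Ioi (0:ℝ), (t ^ (e + 1) * W (f0 t)) * (((e + 1 : ℕ) : ℝ) * ((σ * X t) / t) + σ * χ t)) / ε - 
       l * (∫ t in Ioi (0:ℝ), (t ^ (e + 1) * V (f0 t)) * (((e + 1 : ℕ) : ℝ) * ((σ * X t) / t) + σ * χ t))) = 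
      σ * ((∫ t in Ioi (0:ℝ), (t ^ (e + 1) * (F t - ε * (q t) ^ 2)) * χ t) + ∫ t in Ioi (0:ℝ), b t * X t) := by
    intro σ
    have eb : ∫ t in Ioi (0:ℝ), b t * X t = ∫ t in Ioi (0:ℝ), (t ^ (e + 1) * (F t + ε * (q t) ^ 2)) * (((e + 1 : ℕ) : ℝ) * (X t / t)) := by
      refine setIntegral_congr_fun measurableSet_Ioi fun t ht => ?_
      have ht : (0:ℝ) < t := ht
      simp only [hb]; push_cast; field_simp; ring
    obtain ⟨a1, a2⟩ := bdd hf.i1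
    obtain ⟨a3, a4⟩ := bdd iW
    obtain ⟨a5, a6⟩ := bdd iV
    obtain ⟨a7, _⟩ := bdd iminus
    obtain ⟨_, a8⟩ := bdd iplus
    have p1 : IntegrableOn (fun t => (t ^ (e + 1) * (q t) ^ 2) * (((e + 1 : ℕ) : ℝ) * ((σ * X t) / t) - σ * χ t)) (Ioi 0) := by
      refine IntegrableOn.congr_fun ((a2.const_mul σ).sub (a1.const_mul σ)) (fun t _ => ?_) measurableSet_Ioi
      simp only [Pi.sub_apply]; ring
    have p2 : IntegrableOn (fun t => (t ^ (e + 1) * W (f0 t)) * (((e + 1 : ℕ) : ℝ) * ((σ * X t) / t) + σ * χ t)) (Ioi 0) := by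
      refine IntegrableOn.congr_fun ((a4.const_mul σ).add (a3.const_mul σ)) (fun t _ => ?_) measurableSet_Ioi
      simp only [Pi.add_apply]; ring
    have p3 : IntegrableOn (fun t => (t ^ (e + 1) * V (f0 t)) * (((e + 1 : ℕ) : ℝ) * ((σ * X t) / t) + σ * χ t)) (Ioi 0) := by
      refine IntegrableOn.congr_fun ((a6.const_mul σ).add (a5.const_mul σ)) (fun t _ => ?_) measurableSet_Ioi
      simp only [Pi.add_apply]; ring
    rw [eb, ← integral_add a7 a8, ← integral_const_mul, ← integral_const_mul, ← integral_const_mul, ← integral_div, 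
      ← integral_sub (p2.div_const ε) (p3.const_mul l)]
    rw [← integral_add (p1.const_mul ε)]
    · congr 1; ext t; simp only [hF, FF]; ring
    · exact (p2.div_const ε).sub (p3.const_mul l)
  have c1 := comb 1
  have c2 := comb (-1)
  simp only [one_mul] at c1
  simp only [neg_one_mul] at c2
  rw [c1] at v1
  rw [c2] at v2
  have z : (∫ t in Ioi (0:ℝ), (t ^ (e + 1) * (F t - ε * (q t) ^ 2)) * χ t) + ∫ t in Ioi (0:ℝ), b t * X t = 0 := by linarith
  rw [fub hfld.a0 (ib a hfld.a0) hχ (hχ.integrable_of_hasCompactSupport hχc) hfld.zero'] at z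
  have hzero : ∀ t, t ∉ Ioi (0:ℝ) → χ t = 0 := fun t ht => 
    image_eq_zero_of_notMem_tsupport fun h => ht (hχt h)
  have e3 : ∫ x, χ x • (x ^ (e + 1) * (F x - ε * (q x) ^ 2) + ∫ s in Ioi x, b s) = 
      ∫ x in Ioi (0:ℝ), χ x • (x ^ (e + 1) * (F x - ε * (q x) ^ 2) + ∫ s in Ioi x, b s) := by
    refine (setIntegral_eq_integral_of_forall_compl_eq_zero fun t ht => ?_).symm
    rw [hzero t ht, zero_smul]
  refine e3.trans (Eq.trans ?_ z)
  rw [← integral_add (bdd iminus).1]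
  · refine setIntegral_congr_fun measurableSet_Ioi fun t _ => ?_
    simp only [smul_eq_mul]; ring
  · refine IntegrableOn.congr_fun (f := fun t => χ t * (fun t => ∫ s in Ioi t, b s) t) ?_ (fun t _ => rfl) measurableSet_Ioi
    have : LocallyIntegrableOn (fun t => ∫ s in Ioi t, b s) (Ioi 0) := hHc.locallyIntegrableOn measurableSet_Ioi
    have hsm : ContinuousOn (fun t => χ t * (fun t => ∫ s in Ioi t, b s) t) (tsupport χ) := hχ.continuousOn.mul (hHc.mono hχt)
    have h4 := hsm.integrableOn_compact (μ := volume) hχc.isCompact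
    refine h4.of_forall_sdiff_eq_zero measurableSet_Ioi fun t ht => ?_
    rw [image_eq_zero_of_notMem_tsupport ht.2, zero_mul]

end S15

namespace S15
open Topology
variable {W V : ℝ → ℝ} {τ c K : ℝ} {e : ℕ} {f g : ℝ → ℝ}

/-- discrepancy -/
def xi (W V : ℝ → ℝ) (ε l : ℝ) (f0 : ℝ → ℝ) (r : ℝ) : ℝ := FF W V ε l (f0 r) - ε * (deriv f0 r) ^ 2

structure Reg (e : ℕ) (W V : ℝ → ℝ) (ε l : ℝ) (f0 : ℝ → ℝ) : Prop where
  qc : ContinuousOn (deriv f0) (Ioi 0)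
  q0 : ∀ r > 0, deriv f0 r ≤ 0
  der : ∀ r > 0, HasDerivAt (xi W V ε l f0) (2 * ε * (e + 1) / r * (deriv f0 r) ^ 2) r
  lim : Tendsto (fun r => r ^ (e + 2) * xi W V ε l f0 r) atTop (𝓝 0)

lemma FF_cont (hP : Pot W V τ c K) {ε l : ℝ} (hf : Prof e f) : Continuous fun r => FF W V ε l (f r) := by
  unfold FF
  have h1 := hP.qlW.comp hf.diff.continuous hf.mem
  have h2 := hP.qlV.comp hf.diff.continuous hf.mem
  exact (h1.div_const ε).sub (h2.const_mul l)

lemma anti_deriv (ha : AntitoneOn f (Ici 0)) {r : ℝ} (hr : 0 < r) : deriv f r ≤ 0 := by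
  rw [← derivWithin_of_mem_nhds (Ici_mem_nhds hr)]
  exact ha.derivWithin_nonpos

lemma Mini.reg (hP : Pot W V τ c K) {m ε : ℝ} (hε : 0 < ε) (hm : 0 < m) {f0 : ℝ → ℝ} (h0 : Mini e W V m ε f0) :
    Reg e W V ε (lam e W m ε f0) f0 := by
  obtain ⟨ib, hHc, ip, hae⟩ := first_integral_ae hP hε hm h0
  set l := lam e W m ε f0
  have hf := h0.prof
  have hFc := FF_cont (ε := ε) (l := l) hP hf
  set F := fun r => FF W V ε l (f0 r) with hF
  set q := deriv f0 with hq
  set H := fun t => ∫ s in Ioi t, ((e:ℝ) + 1) * s ^ e * (F s + ε * (q s) ^ 2) with hH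
  have q0 : ∀ r > 0, q r ≤ 0 := fun r hr => anti_deriv h0.anti hr
  set Z := fun t => (F t + H t / t ^ (e + 1)) / ε with hZ
  have hZc : ContinuousOn Z (Ioi 0) := by
    refine ContinuousOn.div_const (hFc.continuousOn.add (hHc.div (by fun_prop) fun t ht => ?_)) ε
    have ht : (0:ℝ) < t := ht
    positivity
  have hqZ : ∀ᵐ t, t ∈ Ioi (0:ℝ) → (q t) ^ 2 = Z t := by
    filter_upwards [hae] with t ht ht0
    have h1 := ht ht0
    have ht0 : (0:ℝ) < t := ht0
    change t ^ (e + 1) * (F t - ε * q t ^ 2) + H t = 0 at h1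
    simp only [hZ]
    have : 0 < t ^ (e + 1) := by positivity
    field_simp
    linarith
  have hq1 : ∀ᵐ t, t ∈ Ioi (0:ℝ) → q t = - √(Z t) := by
    filter_upwards [hqZ] with t ht ht0
    rw [← ht ht0, Real.sqrt_sq_eq_abs, abs_of_nonpos (q0 t ht0), neg_neg]
  have hsc : ContinuousOn (fun t => - √(Z t)) (Ioi 0) := (Real.continuous_sqrt.comp_continuousOn hZc).neg
  have hqe : ∀ t > 0, q t = - √(Z t) := by
    intro t ht
    have hsub : ∀ {b}, 0 < b → uIcc t b ⊆ Ioi 0 := fun {b} hb s hs => by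
      rcases mem_uIcc.1 hs with h | h
      · exact ht.trans_le h.1
      · exact hb.trans_le h.1
    have key : ∀ b > 0, f0 b = f0 t + ∫ s in t..b, - √(Z s) := by
      intro b hb
      have hi : IntervalIntegrable (fun t => - √(Z t)) volume t b := (hsc.mono (hsub hb)).intervalIntegrable
      have hcg : ∀ᵐ s, s ∈ uIoc t b → - √(Z s) = q s := by
        filter_upwards [hq1] with s hs hs1
        exact (hs (hsub hb (uIoc_subset_uIcc hs1))).symm
      have hi2 : IntervalIntegrable q volume t b := hi.congr_ae ((ae_restrict_iff' measurableSet_uIoc).2 hcg)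
      rw [intervalIntegral.integral_congr_ae hcg, intervalIntegral.integral_eq_sub_of_hasDerivAt (fun s _ => (hf.diff s).hasDerivAt) hi2]
      ring
    have hd : HasDerivAt (fun b => f0 t + ∫ s in t..b, - √(Z s)) (- √(Z t)) t := by
      have := intervalIntegral.integral_hasDerivAt_right (f := fun s => - √(Z s)) (a := t) (b := t) (by simp)
        (hsc.stronglyMeasurableAtFilter isOpen_Ioi t ht) (hsc.continuousAt (Ioi_mem_nhds ht))
      exact this.const_add _
    refine (hd.congr_of_eventuallyEq ?_).deriv
    filter_upwards [Ioi_mem_nhds ht] with b hb using key b hb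
  have hqc : ContinuousOn q (Ioi 0) := hsc.congr fun t ht => hqe t ht
  have hq2 : ∀ t > 0, (q t) ^ 2 = Z t := by
    have := Measure.eqOn_open_of_ae_eq (μ := volume) ((ae_restrict_iff' measurableSet_Ioi).2 hqZ) isOpen_Ioi (hqc.pow 2) hZc
    exact fun t ht => this ht
  have hxi : ∀ t > 0, xi W V ε l f0 t = - (H t / t ^ (e + 1)) := by
    intro t ht
    change F t - ε * q t ^ 2 = _
    rw [hq2 t ht]; simp only [hZ]; field_simp; ring
  have hbc : ContinuousOn (fun s => ((e:ℝ) + 1) * s ^ e * (F s + ε * (q s) ^ 2)) (Ioi 0) := by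
    refine ContinuousOn.mul (by fun_prop) (hFc.continuousOn.add ((hqc.pow 2).const_mul ε))
  refine ⟨hqc, q0, ?_, ?_⟩
  · intro t ht
    have hHd : HasDerivAt H (-(((e:ℝ) + 1) * t ^ e * (F t + ε * (q t) ^ 2))) t := by
      have h1 := intervalIntegral.integral_hasDerivAt_right (f := fun s => ((e:ℝ) + 1) * s ^ e * (F s + ε * (q s) ^ 2)) (a := t) (b := t) (by simp)
        (hbc.stronglyMeasurableAtFilter isOpen_Ioi t ht) (hbc.continuousAt (Ioi_mem_nhds ht))
      refine ((h1.const_sub (H t))).congr_of_eventuallyEq ?_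
      filter_upwards [Ioi_mem_nhds ht] with b hb
      have := intervalIntegral.integral_Ioi_sub_Ioi' (ib t ht) (ib b hb)
      simp only [hH]; linarith
    have hd2 : HasDerivAt (fun t => - (H t / t ^ (e + 1))) _ t := (hHd.div (hasDerivAt_pow (e + 1) t) (by positivity)).neg
    have hd3 := hd2.congr_of_eventuallyEq (f₁ := xi W V ε l f0) (by
      filter_upwards [Ioi_mem_nhds ht] with b hb using hxi b hb)
    refine hd3.congr_deriv ?_
    have h4 := hq2 t ht
    simp only [hZ] at h4
    have hF4 : F t = ε * q t ^ 2 - H t / t ^ (e + 1) := by rw [h4]; field_simp; ring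
    rw [hF4]
    push_cast
    rw [← hq]
    generalize q t = x
    generalize H t = y
    field_simp
    ring
  · have hb : IntegrableOn (fun t => ((e:ℝ) + 1) * ‖t ^ (e + 1) * (F t + ε * (q t) ^ 2)‖) (Ioi 0) := ip.norm.const_mul ((e:ℝ) + 1)
    have h1 := intervalIntegral_tendsto_integral_Ioi 0 hb tendsto_id
    have h2 := h1.const_sub (∫ t in Ioi (0:ℝ), ((e:ℝ) + 1) * ‖t ^ (e + 1) * (F t + ε * (q t) ^ 2)‖)
    rw [sub_self] at h2
    refine squeeze_zero_norm' ?_ h2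
    filter_upwards [Ioi_mem_atTop (0:ℝ)] with r hr
    have hr : (0:ℝ) < r := hr
    have e1 : r ^ (e + 2) * xi W V ε l f0 r = - (r * H r) := by
      rw [hxi r hr]; field_simp; ring
    rw [e1, norm_neg]
    have h3 := intervalIntegral.integral_Ioi_sub_Ioi' (a := 0) (b := r) hb (hb.mono_set (Ioi_subset_Ioi hr.le))
    have h4 : r * H r = ∫ s in Ioi r, r * (((e:ℝ) + 1) * s ^ e * (F s + ε * (q s) ^ 2)) := by
      rw [integral_const_mul]
    have h5 : ‖r * H r‖ ≤ ∫ t in Ioi r, ((e:ℝ) + 1) * ‖t ^ (e + 1) * (F t + ε * (q t) ^ 2)‖ := by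
      rw [h4]
      refine norm_integral_le_of_norm_le (hb.mono_set (Ioi_subset_Ioi hr.le)) ?_
      filter_upwards [ae_restrict_mem measurableSet_Ioi] with s hs
      have hs : r < s := hs
      have hs0 := hr.trans hs
      rw [norm_mul, norm_mul, norm_mul, norm_mul, norm_pow, norm_pow]
      simp only [Real.norm_eq_abs, abs_of_pos hr, abs_of_pos hs0]
      rw [abs_of_nonneg (by positivity : (0:ℝ) ≤ (e:ℝ) + 1)]
      have : r * s ^ e ≤ s ^ (e + 1) := by rw [pow_succ, mul_comm]; gcongr
      calc r * (((e:ℝ) + 1) * s ^ e * |F s + ε * q s ^ 2|) = ((e:ℝ) + 1) * ((r * s ^ e) * |F s + ε * q s ^ 2|) := by ring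
        _ ≤ _ := by gcongr
    simp only [id]
    linarith

end S15

namespace S15
open Topology
variable {W V : ℝ → ℝ} {τ c K : ℝ} {e : ℕ} {f g : ℝ → ℝ}

def SG (e : ℕ) (f : ℝ → ℝ) (S : Set ℝ) : ℝ := ∫ r in S, r ^ (e + 1) * (deriv f r) ^ 2
def SP (e : ℕ) (U : ℝ → ℝ) (f : ℝ → ℝ) (S : Set ℝ) : ℝ := ∫ r in S, r ^ (e + 1) * U (f r)

lemma Prof.intF (hP : Pot W V τ c K) {ε l : ℝ} (hf : Prof e f) : 
    IntegrableOn (fun r => r ^ (e + 1) * FF W V ε l (f r)) (Ioi 0) := by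
  refine IntegrableOn.congr_fun (((hf.intU hP.qlW).div_const ε).sub ((hf.intU hP.qlV).const_mul l)) (fun t _ => ?_) measurableSet_Ioi
  simp only [FF, Pi.sub_apply]; ring

lemma lam_nonneg (hP : Pot W V τ c K) {m ε : ℝ} (hε : 0 < ε) (hm : 0 < m) (hf : Prof e f) : 0 ≤ lam e W m ε f := by
  unfold lam
  have h1 := GG_nonneg (e := e) (f := f)
  have h2 : 0 ≤ PP e W f := PP_nonneg hP.Wnn hf.mem
  positivity

lemma pohozaev (hP : Pot W V τ c K) {m ε : ℝ} (hε : 0 < ε) (hm : 0 < m) {f0 : ℝ → ℝ} (h0 : Mini e W V m ε f0) {r : ℝ} (hr : 0 < r) :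
    ((e:ℝ) + 2) * SP e (FF W V ε (lam e W m ε f0)) f0 (Ioi r) + e * (ε * SG e f0 (Ioi r)) = - (r ^ (e + 2) * xi W V ε (lam e W m ε f0) f0 r) ∧ 
    ((e:ℝ) + 2) * SP e (FF W V ε (lam e W m ε f0)) f0 (Ioc 0 r) + e * (ε * SG e f0 (Ioc 0 r)) = r ^ (e + 2) * xi W V ε (lam e W m ε f0) f0 r := by
  have hreg := h0.reg hP hε hm
  have hf := h0.prof
  set l := lam e W m ε f0 with hl
  have iF := hf.intF (ε := ε) (l := l) hP
  have iG := hf.i1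
  have hsub : Ioi r ⊆ Ioi (0:ℝ) := Ioi_subset_Ioi hr.le
  have hd : ∀ t > 0, HasDerivAt (fun t => t ^ (e + 2) * xi W V ε l f0 t) 
      (((e:ℝ) + 2) * (t ^ (e + 1) * FF W V ε l (f0 t)) + e * (ε * (t ^ (e + 1) * (deriv f0 t) ^ 2))) t := by
    intro t ht
    have h1 := (hasDerivAt_pow (e + 2) t).mul (hreg.der t ht)
    refine h1.congr_deriv ?_
    unfold xi
    push_cast
    field_simp
    ring
  have hFint : IntegrableOn (fun t => ((e:ℝ) + 2) * (t ^ (e + 1) * FF W V ε l (f0 t)) + e * (ε * (t ^ (e + 1) * (deriv f0 t) ^ 2))) (Ioi 0) := 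
    (iF.const_mul _).add ((iG.const_mul ε).const_mul _)
  have h1 := integral_Ioi_of_hasDerivAt_of_tendsto (hd r hr).continuousAt.continuousWithinAt
    (fun t ht => hd t (hr.trans ht)) (hFint.mono_set hsub) hreg.lim
  have h2 : ((e:ℝ) + 2) * SP e (FF W V ε l) f0 (Ioi r) + e * (ε * SG e f0 (Ioi r)) = - (r ^ (e + 2) * xi W V ε l f0 r) := by
    rw [← zero_sub, ← h1, integral_add ((iF.mono_set hsub).const_mul _) (((iG.mono_set hsub).const_mul ε).const_mul _),
      integral_const_mul, integral_const_mul, integral_const_mul]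
    rfl
  refine ⟨h2, ?_⟩
  have s1 : PP e (FF W V ε l) f0 = SP e (FF W V ε l) f0 (Ioc 0 r) + SP e (FF W V ε l) f0 (Ioi r) := by
    unfold PP SP
    rw [← setIntegral_union (Ioc_disjoint_Ioi le_rfl) measurableSet_Ioi (iF.mono_set Ioc_subset_Ioi_self) (iF.mono_set hsub), Ioc_union_Ioi_eq_Ioi hr.le]
  have s2 : GG e f0 = SG e f0 (Ioc 0 r) + SG e f0 (Ioi r) := by
    unfold GG SG
    rw [← setIntegral_union (Ioc_disjoint_Ioi le_rfl) measurableSet_Ioi (iG.mono_set Ioc_subset_Ioi_self) (iG.mono_set hsub), Ioc_union_Ioi_eq_Ioi hr.le]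
  have tot : ((e:ℝ) + 2) * PP e (FF W V ε l) f0 + e * (ε * GG e f0) = 0 := by
    rw [PP_FF hP hf, h0.mass, hl, lam]; field_simp; ring
  rw [s1, s2] at tot
  linarith

structure Dat (e : ℕ) (W V : ℝ → ℝ) (τ c K m R C ε l : ℝ) (f0 f : ℝ → ℝ) (a b α β : ℝ) : Prop where
  hP : Pot W V τ c K
  hm : 0 < m
  R0 : 0 < R
  C1 : 1 ≤ C
  ε0 : 0 < ε
  ε1 : ε ≤ 1
  h0 : Mini e W V m ε f0
  hf : Prof e f
  anti : AntitoneOn f (Ici 0)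
  mass : PP e V f = m
  ab : a < b
  fa : f0 a = 1 - τ
  fb : f0 b = τ
  αβ : α < β
  fα : f α = 1 - τ
  fβ : f β = τ
  aR : R / 2 ≤ a
  bR : b ≤ 2 * R
  αR : R / 2 ≤ α
  βR : β ≤ 2 * R
  aC : |a - R| ≤ C * ε
  bC : |b - R| ≤ C * ε
  αC : |α - R| ≤ C * ε
  βC : |β - R| ≤ C * ε
  hl : l = lam e W m ε f0
  l0 : 0 ≤ l
  lC : l ≤ C
  lK : ε * l * K ≤ c / 2
  reg : Reg e W V ε l f0
  xiC : ∀ r ≥ R / 2, |xi W V ε l f0 r| ≤ C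
  qlo : ∀ r ∈ Icc a b, c / 2 ≤ (ε * deriv f0 r) ^ 2
  qhi : ∀ r ∈ Icc a b, (ε * deriv f0 r) ^ 2 ≤ C
  eG : ε * GG e f0 ≤ C
  eP : PP e W f0 ≤ C * ε

lemma aux_ineq {d x y z Λ : ℝ} (hd : 0 ≤ d) (hx : 0 ≤ x) (hy : 0 ≤ y) (hz : 0 ≤ z) (h1 : x + z ≤ Λ) (h2 : y ≤ Λ) : 
    -(2 * (d + 2) * Λ) ≤ (d + 2) * (x - y) + d * z ∧ (d + 2) * (x - y) + d * z ≤ 2 * (d + 2) * Λ := by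
  have a1 : d * y ≤ d * Λ := by gcongr
  have a2 : d * (x + z) ≤ d * Λ := by gcongr
  have a3 : 0 ≤ d * x := by positivity
  have a4 : 0 ≤ d * y := by positivity
  have a5 : 0 ≤ d * z := by positivity
  constructor <;> nlinarith

set_option maxHeartbeats 1000000 in
lemma setup (hP : Pot W V τ c K) {m : ℝ} (hm : 0 < m) : ∃ R C ε1 : ℝ, 0 < ε1 ∧ ∀ ε f0 f, 0 < ε → ε < ε1 → Mini e W V m ε f0 → 
    Prof e f → AntitoneOn f (Ici 0) → PP e V f = m → EE e W ε f ≤ EE e W ε f0 + 1 → 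
    ∃ a b α β, Dat e W V τ c K m R C ε (lam e W m ε f0) f0 f a b α β := by
  obtain ⟨Λ, hΛ, hE⟩ := energy_bound (e := e) hP hm
  obtain ⟨R, hR, C1, hC1, ε1, hε1, hgeo⟩ := geom (e := e) hP hm (show 0 < Λ + 1 by linarith)
  have hc := hP.c0
  have hK := hP.K1
  set X := 2 * (e + 2) * Λ / (R / 2) ^ (e + 2) with hX
  have hX0 : 0 < X := by positivity
  set C := 1 + C1 + Λ / m + X + Λ + 2 * K with hCdef
  have hLm : 0 < Λ / m := by positivity
  have hCp : 0 < C := by positivity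
  refine ⟨R, C, min (min ε1 1) (min (c / (2 * C * K)) (c / (4 * C))), by positivity, ?_⟩
  intro ε f0 f hε hlt h0 hf han hmass hEE
  obtain ⟨⟨l1, l2⟩, l3, l4⟩ : (ε < ε1 ∧ ε < 1) ∧ ε < c / (2 * C * K) ∧ ε < c / (4 * C) := by
    simpa only [lt_min_iff] using hlt
  have hE0 := hE ε hε l2.le f0 h0
  have hf0 := h0.prof
  obtain ⟨a, b, hab, fa, fb, aC, bC, aR, bR⟩ := hgeo ε hε l1 f0 hf0 h0.anti h0.mass (by linarith)
  obtain ⟨α, β, hαβ, fα, fβ, αC, βC, αR, βR⟩ := hgeo ε hε l1 f hf han hmass (by linarith)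
  have g0 := GG_nonneg (e := e) (f := f0)
  have p0 : 0 ≤ PP e W f0 := PP_nonneg hP.Wnn hf0.mem
  have p0' : 0 ≤ PP e W f0 / ε := by positivity
  have hεg : 0 ≤ ε * GG e f0 := by positivity
  have hE1 : ε * GG e f0 + PP e W f0 / ε ≤ Λ := hE0
  have hl0 := lam_nonneg hP hε hm hf0
  set l := lam e W m ε f0 with hldef
  have hlΛ : l * m ≤ Λ := by
    rw [hldef, lam, div_mul_cancel₀ _ hm.ne']
    have : (e:ℝ) / (e + 2) ≤ 1 := by rw [div_le_one (by positivity)]; linarith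
    have h5 : (e:ℝ) / (e + 2) * ε * GG e f0 ≤ ε * GG e f0 := by
      rw [mul_assoc]; exact mul_le_of_le_one_left hεg this
    linarith
  have hlC0 : l ≤ Λ / m := by rwa [le_div_iff₀ hm]
  have hlC : l ≤ C := by rw [hCdef]; linarith
  have hC1C : C1 * ε ≤ C * ε := by gcongr; rw [hCdef]; linarith
  have hreg := h0.reg hP hε hm
  rw [← hldef] at hreg
  have hxi : ∀ r ≥ R / 2, |xi W V ε l f0 r| ≤ X := by
    intro r hr
    have hr0 : 0 < r := by linarith
    have hp := (pohozaev hP hε hm h0 hr0).1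
    rw [← hldef] at hp
    have iF := hf0.intF (ε := ε) (l := l) hP
    have iW := hf0.intU hP.qlW
    have iV := hf0.intU hP.qlV
    have hsub : Ioi r ⊆ Ioi (0:ℝ) := Ioi_subset_Ioi hr0.le
    have wn : ∀ᵐ t ∂volume.restrict (Ioi (0:ℝ)), 0 ≤ t ^ (e + 1) * W (f0 t) := by
      filter_upwards [ae_restrict_mem measurableSet_Ioi] with t ht
      have ht : (0:ℝ) < t := ht
      exact mul_nonneg (by positivity) (hP.Wnn _ (hf0.mem t))
    have vn : ∀ᵐ t ∂volume.restrict (Ioi (0:ℝ)), 0 ≤ t ^ (e + 1) * V (f0 t) := by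
      filter_upwards [ae_restrict_mem measurableSet_Ioi] with t ht
      have ht : (0:ℝ) < t := ht
      exact mul_nonneg (by positivity) (hP.Vnn _ (hf0.mem t))
    have qn : ∀ᵐ t ∂volume.restrict (Ioi (0:ℝ)), 0 ≤ t ^ (e + 1) * (deriv f0 t) ^ 2 := by
      filter_upwards [ae_restrict_mem measurableSet_Ioi] with t ht
      have ht : (0:ℝ) < t := ht
      positivity
    have b1 : SP e W f0 (Ioi r) ≤ PP e W f0 := setIntegral_mono_set iW wn hsub.eventuallyLE
    have b2 : SP e V f0 (Ioi r) ≤ PP e V f0 := setIntegral_mono_set iV vn hsub.eventuallyLE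
    have b3 : SG e f0 (Ioi r) ≤ GG e f0 := setIntegral_mono_set hf0.i1 qn hsub.eventuallyLE
    have n1 : 0 ≤ SP e W f0 (Ioi r) := integral_nonneg_of_ae (ae_restrict_of_ae_restrict_of_subset hsub wn)
    have n2 : 0 ≤ SP e V f0 (Ioi r) := integral_nonneg_of_ae (ae_restrict_of_ae_restrict_of_subset hsub vn)
    have n3 : 0 ≤ SG e f0 (Ioi r) := integral_nonneg_of_ae (ae_restrict_of_ae_restrict_of_subset hsub qn)
    have hs : SP e (FF W V ε l) f0 (Ioi r) = SP e W f0 (Ioi r) / ε - l * SP e V f0 (Ioi r) := by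
      unfold SP FF
      rw [← integral_div, ← integral_const_mul, ← integral_sub ((iW.mono_set hsub).div_const ε) ((iV.mono_set hsub).const_mul l)]
      congr 1; ext r; ring
    rw [h0.mass] at b2
    have b1' : SP e W f0 (Ioi r) / ε ≤ PP e W f0 / ε := by gcongr
    have n1' : 0 ≤ SP e W f0 (Ioi r) / ε := by positivity
    have b2' : l * SP e V f0 (Ioi r) ≤ l * m := by gcongr
    have n2' : 0 ≤ l * SP e V f0 (Ioi r) := by positivity
    have b3' : ε * SG e f0 (Ioi r) ≤ ε * GG e f0 := by gcongr
    have n3' : 0 ≤ ε * SG e f0 (Ioi r) := by positivity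
    have he : (0:ℝ) ≤ e := by positivity
    have key : r ^ (e + 2) * |xi W V ε l f0 r| ≤ 2 * (e + 2) * Λ := by
      rw [← abs_of_nonneg (by positivity : 0 ≤ r ^ (e + 2)), ← abs_mul, ← abs_neg, ← hp, hs, abs_le]
      exact aux_ineq he n1' n2' n3' (by linarith) (by linarith)
    have h6 : (R / 2) ^ (e + 2) ≤ r ^ (e + 2) := by gcongr
    rw [hX, le_div_iff₀ (by positivity), mul_comm]
    exact (mul_le_mul_of_nonneg_right h6 (abs_nonneg _)).trans key
  have hxiC : ∀ r ≥ R / 2, |xi W V ε l f0 r| ≤ C := fun r hr => (hxi r hr).trans (by rw [hCdef]; linarith)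
  have hq : ∀ r ∈ Icc a b, (ε * deriv f0 r) ^ 2 = W (f0 r) - ε * l * V (f0 r) - ε * xi W V ε l f0 r := by
    intro r _
    unfold xi FF; field_simp; ring
  have hfr : ∀ r ∈ Icc a b, f0 r ∈ Icc τ (1 - τ) := by
    intro r hr
    have ha0 : 0 ≤ a := by linarith
    rw [← fa, ← fb]
    exact ⟨h0.anti (show 0 ≤ r from ha0.trans hr.1) (show 0 ≤ b by linarith) hr.2, h0.anti ha0 (show 0 ≤ r from ha0.trans hr.1) hr.1⟩
  have hεC4 : ε * C ≤ c / 4 := by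
    rw [lt_div_iff₀ (by positivity)] at l4; linarith
  have hεlC : ε * l ≤ ε * C := by gcongr
  have he0 : 0 ≤ ε * l := by positivity
  refine ⟨a, b, α, β, ⟨hP, hm, hR, by rw [hCdef]; linarith, hε, l2.le, h0, hf, han, hmass, hab, fa, fb, hαβ, fα, fβ, aR, bR, αR, βR,
    aC.trans hC1C, bC.trans hC1C, αC.trans hC1C, βC.trans hC1C, hldef, hl0, hlC, ?_, hreg, hxiC, ?_, ?_, ?_, ?_⟩⟩
  · rw [lt_div_iff₀ (by positivity)] at l3
    have : ε * l * K ≤ ε * C * K := by gcongr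
    linarith
  · intro r hr
    rw [hq r hr]
    have h1 := hP.Wmid _ (hfr r hr)
    have h2 := hP.Vle _ (hf0.mem r)
    have h3 := hP.Vnn _ (hf0.mem r)
    have h4 := le_abs_self (xi W V ε l f0 r)
    have h5 := hxiC r (by linarith [hr.1])
    have h6 : ε * l * V (f0 r) ≤ ε * l := mul_le_of_le_one_right he0 h2
    have h7 : ε * xi W V ε l f0 r ≤ ε * C := by gcongr; linarith
    linarith
  · intro r hr
    rw [hq r hr]
    have h1 := hP.qlW.sq (hf0.mem r)
    have h2 := le_abs_self (W (f0 r))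
    have h3 := hP.Vnn _ (hf0.mem r)
    have h4 := neg_abs_le (xi W V ε l f0 r)
    have h5 := hxi r (by linarith [hr.1])
    have h6 : 0 ≤ ε * l * V (f0 r) := by positivity
    have h7 : ε * (- xi W V ε l f0 r) ≤ 1 * X := 
      (mul_le_mul_of_nonneg_left (by linarith : - xi W V ε l f0 r ≤ X) hε.le).trans (by gcongr)
    have h8 := (hf0.mem r)
    have h9 : (f0 r) ^ 2 ≤ 1 := pow_le_one₀ h8.1 h8.2
    have h10 : K * (f0 r) ^ 2 ≤ K := mul_le_of_le_one_right (by linarith) h9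
    rw [hCdef]
    linarith
  · rw [hCdef]; linarith
  · have : PP e W f0 / ε ≤ C := by rw [hCdef]; linarith
    rwa [div_le_iff₀ hε] at this

end S15

namespace S15
open Topology
variable {W V : ℝ → ℝ} {τ c K : ℝ} {e : ℕ} {f g : ℝ → ℝ}

lemma lin4 {S : Set ℝ} {p q r s : ℝ → ℝ} (hp : IntegrableOn p S) (hq : IntegrableOn q S) (hr : IntegrableOn r S) (hs : IntegrableOn s S)
    (x y z w : ℝ) : IntegrableOn (fun t => x * p t + y * q t + z * r t + w * s t) S ∧ 
    ∫ t in S, (x * p t + y * q t + z * r t + w * s t) = x * (∫ t in S, p t) + y * (∫ t in S, q t) + z * (∫ t in S, r t) + w * ∫ t in S, s t := by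
  have h1 := hp.const_mul x
  have h2 := hq.const_mul y
  have h3 := hr.const_mul z
  have h4 := hs.const_mul w
  have h12 : Integrable (fun t => x * p t + y * q t) (volume.restrict S) := h1.add h2
  have h123 : Integrable (fun t => x * p t + y * q t + z * r t) (volume.restrict S) := h12.add h3
  have h1234 : Integrable (fun t => x * p t + y * q t + z * r t + w * s t) (volume.restrict S) := h123.add h4
  refine ⟨h1234, ?_⟩
  rw [integral_add h123 h4, integral_add h12 h3, integral_add h1 h2]
  simp only [integral_const_mul]

lemma int_prod {S : Set ℝ} (hS : MeasurableSet S) (hS0 : S ⊆ Ici 0) {u v : ℝ → ℝ} (hu : Measurable u) (hv : Measurable v)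
    (iu : IntegrableOn (fun r => r ^ (e + 1) * (u r) ^ 2) S) (iv : IntegrableOn (fun r => r ^ (e + 1) * (v r) ^ 2) S) : 
    IntegrableOn (fun r => r ^ (e + 1) * (u r * v r)) S := by
  refine Integrable.mono' (iu.add iv) (by fun_prop) ?_
  filter_upwards [ae_restrict_mem hS] with r hr
  have hr : (0:ℝ) ≤ r := hS0 hr
  rw [Real.norm_eq_abs, abs_mul, abs_of_nonneg (by positivity), Pi.add_apply, ← mul_add]
  gcongr
  rw [abs_mul]
  nlinarith [sq_nonneg (|u r| - |v r|), sq_abs (u r), sq_abs (v r), abs_nonneg (u r), abs_nonneg (v r), mul_nonneg (abs_nonneg (u r)) (abs_nonneg (v r))]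

lemma int_sub_sq {S : Set ℝ} (hS : MeasurableSet S) (hS0 : S ⊆ Ici 0) {u v : ℝ → ℝ} (hu : Measurable u) (hv : Measurable v)
    (iu : IntegrableOn (fun r => r ^ (e + 1) * (u r) ^ 2) S) (iv : IntegrableOn (fun r => r ^ (e + 1) * (v r) ^ 2) S) : 
    IntegrableOn (fun r => r ^ (e + 1) * (u r - v r) ^ 2) S := by
  refine IntegrableOn.congr_fun ((iu.add iv).sub ((int_prod hS hS0 hu hv iu iv).const_mul 2)) (fun r _ => ?_) hS
  simp only [Pi.add_apply, Pi.sub_apply]; ring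

lemma seg_mem {x y θ : ℝ} {a b : ℝ} (hx : x ∈ Icc a b) (hy : y ∈ Icc a b) (h0 : 0 ≤ θ) (h1 : θ ≤ 1) : (1 - θ) * x + θ * y ∈ Icc a b := 
  (convex_Icc a b) hx hy (by linarith) h0 (by ring)

lemma seg_deriv {f0 f1 : ℝ → ℝ} (h0 : Prof e f0) (h1 : Prof e f1) (θ : ℝ) : 
    deriv (fun r => (1 - θ) * f0 r + θ * f1 r) = fun r => (1 - θ) * deriv f0 r + θ * deriv f1 r := by
  ext r
  exact (((h0.diff r).hasDerivAt.const_mul _).add ((h1.diff r).hasDerivAt.const_mul _)).deriv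

lemma Prof.seg {f0 f1 : ℝ → ℝ} (h0 : Prof e f0) (h1 : Prof e f1) {θ : ℝ} (t0 : 0 ≤ θ) (t1 : θ ≤ 1) : 
    Prof e (fun r => (1 - θ) * f0 r + θ * f1 r) := by
  refine ⟨?_, ?_, fun r => seg_mem (h0.mem r) (h1.mem r) t0 t1, ?_, ?_⟩
  · exact (h0.diff.const_mul _).add (h1.diff.const_mul _)
  · rw [seg_deriv h0 h1]; simp only [h0.d0, h1.d0]; ring
  · have i := int_prod measurableSet_Ioi Ioi_subset_Ici_self h0.diff.continuous.measurable h1.diff.continuous.measurable h0.i0 h1.i0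
    refine IntegrableOn.congr_fun (((h0.i0.const_mul ((1 - θ) ^ 2)).add (h1.i0.const_mul (θ ^ 2))).add (i.const_mul (2 * (1 - θ) * θ))) 
      (fun r _ => ?_) measurableSet_Ioi
    simp only [Pi.add_apply]; ring
  · have i := int_prod measurableSet_Ioi Ioi_subset_Ici_self (measurable_deriv f0) (measurable_deriv f1) h0.i1 h1.i1
    rw [seg_deriv h0 h1]
    refine IntegrableOn.congr_fun (((h0.i1.const_mul ((1 - θ) ^ 2)).add (h1.i1.const_mul (θ ^ 2))).add (i.const_mul (2 * (1 - θ) * θ))) 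
      (fun r _ => ?_) measurableSet_Ioi
    simp only [Pi.add_apply]; ring

lemma QL.seg {U : ℝ → ℝ} (hU : QL U K) (hK : 0 ≤ K) {f0 f1 : ℝ → ℝ} (h0 : Prof e f0) (h1 : Prof e f1) {θ : ℝ} (t0 : 0 ≤ θ) (t1 : θ ≤ 1) : 
    |PP e U (fun r => (1 - θ) * f0 r + θ * f1 r) - PP e U f0| ≤ 
      (4 * K * ((∫ r in Ioi (0:ℝ), r ^ (e + 1) * (f0 r) ^ 2) + ∫ r in Ioi (0:ℝ), r ^ (e + 1) * (f1 r) ^ 2)) * θ := by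
  have hs := h0.seg h1 t0 t1
  unfold PP
  rw [← integral_sub (hs.intU hU) (h0.intU hU), ← integral_add h0.i0 h1.i0, ← Real.norm_eq_abs, mul_comm, ← integral_const_mul, ← integral_const_mul]
  refine norm_integral_le_of_norm_le (((h0.i0.add h1.i0).const_mul _).const_mul _) ?_
  filter_upwards [ae_restrict_mem measurableSet_Ioi] with r hr
  have hr : (0:ℝ) < r := hr
  rw [← mul_sub, Real.norm_eq_abs, abs_mul, abs_of_nonneg (by positivity : 0 ≤ r ^ (e + 1))]
  have hq := hU.2 _ (hs.mem r) _ (h0.mem r)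
  have e1 : (1 - θ) * f0 r + θ * f1 r - f0 r = θ * (f1 r - f0 r) := by ring
  rw [e1, abs_mul, abs_of_nonneg t0] at hq
  have a0 := (h0.mem r).1
  have a1 := (h1.mem r).1
  set x := f0 r
  set y := f1 r
  have d1 : |y - x| ≤ x + y := by rw [abs_le]; constructor <;> linarith
  have d2 : (1 - θ) * x + θ * y + x ≤ 2 * (x + y) := by nlinarith
  have d3 : 0 ≤ (1 - θ) * x + θ * y + x := by nlinarith
  have d4 : K * (θ * |y - x|) * ((1 - θ) * x + θ * y + x) ≤ K * (θ * (x + y)) * (2 * (x + y)) := by gcongr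
  have d5 : K * (θ * (x + y)) * (2 * (x + y)) ≤ K * θ * (4 * (x ^ 2 + y ^ 2)) := by
    have : 0 ≤ K * θ := by positivity
    nlinarith [mul_nonneg this (sq_nonneg (x - y))]
  calc _ ≤ r ^ (e + 1) * (K * θ * (4 * (x ^ 2 + y ^ 2))) := by gcongr; linarith
    _ = _ := by ring

lemma lemA (hP : Pot W V τ c K) {m ε : ℝ} (hε : 0 < ε) (hm : 0 < m) {f0 f1 : ℝ → ℝ} (h0 : Mini e W V m ε f0)
    (hlK : ε * lam e W m ε f0 * K ≤ c / 2) (h1 : Prof e f1) 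
    (hz : ∀ r > 0, f1 r = f0 r ∨ ((f0 r ∈ Icc 0 τ ∧ f1 r ∈ Icc 0 τ) ∨ (f0 r ∈ Icc (1 - τ) 1 ∧ f1 r ∈ Icc (1 - τ) 1))) : 
    0 ≤ ∫ r in Ioi (0:ℝ), r ^ (e + 1) * (2 * ε * (deriv f0 r * (deriv f1 r - deriv f0 r)) + 
      (FF W V ε (lam e W m ε f0) (f1 r) - FF W V ε (lam e W m ε f0) (f0 r)) - c / (2 * ε) * (f1 r - f0 r) ^ 2) := by
  have hf := h0.prof
  have hl0 := lam_nonneg hP hε hm hf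
  set l := lam e W m ε f0 with hl
  have hK : 0 ≤ K := by linarith [hP.K1]
  have hc := hP.c0
  have m0 := measurable_deriv f0
  have m1 := measurable_deriv f1
  have c0 := hf.diff.continuous.measurable
  have c1 := h1.diff.continuous.measurable
  have iψ' := int_sub_sq measurableSet_Ioi Ioi_subset_Ici_self m1 m0 h1.i1 hf.i1
  have iψ := int_sub_sq measurableSet_Ioi Ioi_subset_Ici_self c1 c0 h1.i0 hf.i0
  have ix := int_prod (v := fun r => deriv f1 r - deriv f0 r) measurableSet_Ioi Ioi_subset_Ici_self m0 (m1.sub m0) hf.i1 iψ'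
  have iF0 := hf.intF (ε := ε) (l := l) hP
  have iF1 := h1.intF (ε := ε) (l := l) hP
  set I1 := ∫ r in Ioi (0:ℝ), r ^ (e + 1) * (deriv f0 r * (deriv f1 r - deriv f0 r)) with hI1
  set I2 := ∫ r in Ioi (0:ℝ), r ^ (e + 1) * (deriv f1 r - deriv f0 r) ^ 2 with hI2
  set I3 := ∫ r in Ioi (0:ℝ), r ^ (e + 1) * (f1 r - f0 r) ^ 2 with hI3
  set T := ∫ r in Ioi (0:ℝ), r ^ (e + 1) * (2 * ε * (deriv f0 r * (deriv f1 r - deriv f0 r)) + 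
      (FF W V ε l (f1 r) - FF W V ε l (f0 r)) - c / (2 * ε) * (f1 r - f0 r) ^ 2) with hT
  have eT : T = 2 * ε * I1 + (PP e (FF W V ε l) f1 - PP e (FF W V ε l) f0) - c / (2 * ε) * I3 := by
    have := (lin4 ix iF1 iF0 iψ (2 * ε) 1 (-1) (- (c / (2 * ε)))).2
    rw [hT, hI1, hI3, PP, PP]
    refine Eq.trans ?_ (this.trans (by ring))
    congr 1; ext r; ring
  have I2n : 0 ≤ I2 := setIntegral_nonneg measurableSet_Ioi fun r hr => by
    have : (0:ℝ) < r := hr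
    positivity
  have I3n : 0 ≤ I3 := setIntegral_nonneg measurableSet_Ioi fun r hr => by
    have : (0:ℝ) < r := hr
    positivity
  have gθ : ∀ θ, GG e (fun r => (1 - θ) * f0 r + θ * f1 r) = GG e f0 + 2 * θ * I1 + θ ^ 2 * I2 := by
    intro θ
    unfold GG
    have := (lin4 hf.i1 ix iψ' iψ' 1 (2 * θ) (θ ^ 2) 0).2
    rw [seg_deriv hf h1, hI1, hI2]
    refine Eq.trans ?_ (this.trans (by ring))
    congr 1; ext r; ring
  set A2 := 4 * K * ((∫ r in Ioi (0:ℝ), r ^ (e + 1) * (f0 r) ^ 2) + ∫ r in Ioi (0:ℝ), r ^ (e + 1) * (f1 r) ^ 2) with hA2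
  have A2n : 0 ≤ A2 := by
    have n1 : 0 ≤ ∫ r in Ioi (0:ℝ), r ^ (e + 1) * (f0 r) ^ 2 := setIntegral_nonneg measurableSet_Ioi fun r hr => by
      have : (0:ℝ) < r := hr
      positivity
    have n2 : 0 ≤ ∫ r in Ioi (0:ℝ), r ^ (e + 1) * (f1 r) ^ 2 := setIntegral_nonneg measurableSet_Ioi fun r hr => by
      have : (0:ℝ) < r := hr
      positivity
    positivity
  set A := 2 * |I1| + I2 + A2 + 1 with hA
  have hAp : 0 < A := by positivity
  obtain ⟨B, hB⟩ := h0.quasi hε hm hAp.le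
  -- convexity
  have conv : ∀ θ, 0 ≤ θ → θ ≤ 1 → PP e (FF W V ε l) (fun r => (1 - θ) * f0 r + θ * f1 r) ≤ 
      (1 - θ) * PP e (FF W V ε l) f0 + θ * PP e (FF W V ε l) f1 - θ * (1 - θ) * (c / (2 * ε)) * I3 := by
    intro θ t0 t1
    rw [hI3, PP, PP, PP, ← integral_const_mul, ← integral_const_mul, ← integral_const_mul, ← integral_add (iF0.const_mul _) (iF1.const_mul _), 
      ← integral_sub (f := fun r => (1 - θ) * (r ^ (e + 1) * FF W V ε l (f0 r)) + θ * (r ^ (e + 1) * FF W V ε l (f1 r))) ((iF0.const_mul _).add (iF1.const_mul _)) (iψ.const_mul _)]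
    refine setIntegral_mono_on ((hf.seg h1 t0 t1).intF hP) (((iF0.const_mul _).add (iF1.const_mul _)).sub (iψ.const_mul _)) measurableSet_Ioi fun r hr => ?_
    have hr0 : (0:ℝ) < r := hr
    have key : FF W V ε l ((1 - θ) * f0 r + θ * f1 r) ≤ (1 - θ) * FF W V ε l (f0 r) + θ * FF W V ε l (f1 r) - θ * (1 - θ) * (c / (2 * ε)) * (f1 r - f0 r) ^ 2 := by
      rcases hz r hr0 with h | h
      · rw [h]
        have : (1 - θ) * f0 r + θ * f0 r = f0 r := by ring
        rw [this]; ring_nf; exact le_rfl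
      · have w1 := hP.Wconv _ _ θ h ⟨t0, t1⟩
        have v1 := hP.Vconc _ _ θ h ⟨t0, t1⟩
        unfold FF
        have w2 : W ((1 - θ) * f0 r + θ * f1 r) / ε ≤ ((1 - θ) * W (f0 r) + θ * W (f1 r) - c * θ * (1 - θ) * (f0 r - f1 r) ^ 2) / ε := by gcongr
        have v2 : l * ((1 - θ) * V (f0 r) + θ * V (f1 r) - K * θ * (1 - θ) * (f0 r - f1 r) ^ 2) ≤ l * V ((1 - θ) * f0 r + θ * f1 r) := by gcongr
        have h3 : l * K ≤ c / (2 * ε) := by rw [le_div_iff₀ (by positivity)]; linarith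
        have h4 : 0 ≤ θ * (1 - θ) * (f1 r - f0 r) ^ 2 := mul_nonneg (mul_nonneg t0 (by linarith)) (sq_nonneg _)
        have h5 := mul_le_mul_of_nonneg_right h3 h4
        have h6 : c / ε = 2 * (c / (2 * ε)) := by field_simp
        have h7 : ((1 - θ) * W (f0 r) + θ * W (f1 r) - c * θ * (1 - θ) * (f0 r - f1 r) ^ 2) / ε = (1 - θ) * (W (f0 r) / ε) + θ * (W (f1 r) / ε) - (c / ε) * (θ * (1 - θ) * (f1 r - f0 r) ^ 2) := by
          field_simp; ring
        rw [h7, h6] at w2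
        linarith
    calc _ ≤ r ^ (e + 1) * ((1 - θ) * FF W V ε l (f0 r) + θ * FF W V ε l (f1 r) - θ * (1 - θ) * (c / (2 * ε)) * (f1 r - f0 r) ^ 2) := by gcongr
      _ = _ := by ring
  have fin : ∀ θ, 0 < θ → θ ≤ 1 → θ ≤ m / (2 * A) → - (θ * (ε * I2 + c / (2 * ε) * I3 + B)) ≤ T := by
    intro θ t0 t1 t2
    have hs := hf.seg h1 t0.le t1
    have w := hP.qlW.seg hK hf h1 t0.le t1
    have v := hP.qlV.seg hK hf h1 t0.le t1
    rw [← hA2] at w v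
    rw [h0.mass] at v
    have hA2A : A2 * θ ≤ A * θ := by gcongr; rw [hA]; linarith [abs_nonneg I1]
    have hAθ : A * θ ≤ m / 2 := by
      rw [le_div_iff₀ (by positivity)] at t2; linarith
    have hq := hB θ _ t0.le t1 hs (by
      rw [gθ]
      have : GG e f0 + 2 * θ * I1 + θ ^ 2 * I2 - GG e f0 = θ * (2 * I1 + θ * I2) := by ring
      rw [this, abs_mul, abs_of_pos t0, mul_comm]
      gcongr
      refine (abs_add_le _ _).trans ?_
      rw [abs_mul, abs_of_pos (by norm_num : (0:ℝ) < 2), abs_of_nonneg (by positivity : 0 ≤ θ * I2)]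
      have : θ * I2 ≤ I2 := mul_le_of_le_one_left I2n t1
      rw [hA]; linarith) (w.trans hA2A) (v.trans hA2A) (by
      have := (abs_le.1 v).1; linarith)
    rw [LL_eq hP hf, LL_eq hP hs, gθ] at hq
    have cv := conv θ t0.le t1
    rw [← hl] at hq
    have : 0 ≤ θ * (T + θ * (ε * I2 + c / (2 * ε) * I3 + B)) := by
      rw [eT]
      linarith
    have := nonneg_of_mul_nonneg_right this t0
    linarith
  set Z := ε * I2 + c / (2 * ε) * I3 + B
  by_contra hneg
  push Not at hneg
  have hθ := fin (min 1 (min (m / (2 * A)) (- T / (2 * (|Z| + 1))))) (by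
    have : 0 < -T := by linarith
    positivity) (min_le_left _ _) ((min_le_right _ _).trans (min_le_left _ _))
  set θ := min 1 (min (m / (2 * A)) (- T / (2 * (|Z| + 1))))
  have hθ0 : 0 < θ := by 
    have : 0 < -T := by linarith
    positivity
  have t3 : θ ≤ - T / (2 * (|Z| + 1)) := (min_le_right _ _).trans (min_le_right _ _)
  rw [le_div_iff₀ (by positivity)] at t3
  have : θ * Z ≤ θ * (|Z| + 1) := by gcongr; linarith [le_abs_self Z]
  linarith

end S15

namespace S15
open Topology
variable {W V : ℝ → ℝ} {τ c K : ℝ} {e : ℕ} {f g : ℝ → ℝ}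

lemma lip_at {φ : ℝ → ℝ} {p : ℝ} (hd : DifferentiableAt ℝ φ p) (h0 : φ p = 0) (hb : ∀ r, |φ r| ≤ 1) : 
    ∃ C > 0, ∀ r, |φ r| ≤ C * |r - p| := by
  obtain ⟨C, hC⟩ := hd.isBigO_sub.bound
  obtain ⟨δ, hδ, hball⟩ := Metric.eventually_nhds_iff.1 hC
  refine ⟨|C| + 1 / δ, by positivity, fun r => ?_⟩
  by_cases h : dist r p < δ
  · have := hball h
    rw [h0, sub_zero, Real.norm_eq_abs, Real.norm_eq_abs] at this
    refine this.trans ?_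
    gcongr
    have : 0 < 1 / δ := by positivity
    linarith [le_abs_self C]
  · push Not at h
    rw [Real.dist_eq] at h
    refine (hb r).trans ?_
    have h2 : 1 ≤ 1 / δ * |r - p| := by
      rw [one_div, ← div_eq_inv_mul, le_div_iff₀ hδ]; linarith
    have h3 : 0 ≤ |C| * |r - p| := by positivity
    linarith

lemma cut_props {k : ℕ} (hk : 1 ≤ k) {σ p r Bst C0 : ℝ} (hσ : σ = 1 ∨ σ = -1) (hB : ∀ s, |deriv Real.smoothTransition s| ≤ Bst) (hC0 : 0 ≤ C0) {y : ℝ}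
    (hy : |y| ≤ C0 * |r - p|) : 
    |(deriv Real.smoothTransition (k * (σ * (p - r))) * (k * (-σ))) * y| ≤ (Icc (p - 1) (p + 1)).indicator (fun _ => Bst * C0) r := by
  have hB0 : 0 ≤ Bst := (abs_nonneg _).trans (hB 0)
  have hk0 : (0:ℝ) < k := by exact_mod_cast hk
  have hk1 : (1:ℝ) ≤ k := by exact_mod_cast hk
  have hσ1 : |σ| = 1 := by rcases hσ with h | h <;> simp [h]
  by_cases h : k * (σ * (p - r)) ≤ 0 ∨ 1 ≤ k * (σ * (p - r))
  · rw [st_deriv_zero h]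
    simp only [zero_mul, abs_zero]
    exact indicator_nonneg (fun _ _ => by positivity) _
  · push Not at h
    have h1 : k * |r - p| ≤ 1 := by
      have : |k * (σ * (p - r))| = k * |r - p| := by
        rw [abs_mul, abs_mul, hσ1, one_mul, abs_of_pos hk0, abs_sub_comm]
      rw [← this, abs_of_pos h.1]; exact h.2.le
    have h2 : |r - p| ≤ 1 := by nlinarith [abs_nonneg (r - p)]
    rw [indicator_of_mem (by have := abs_le.1 h2; constructor <;> linarith)]
    rw [abs_mul, abs_mul, abs_mul, abs_neg, hσ1, mul_one, abs_of_pos hk0]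
    calc _ ≤ Bst * k * (C0 * |r - p|) := by gcongr; exact hB _
      _ = (Bst * C0) * (k * |r - p|) := by ring
      _ ≤ (Bst * C0) * 1 := by gcongr
      _ = _ := mul_one _

set_option maxHeartbeats 1000000 in
lemma lemB (hP : Pot W V τ c K) {m ε : ℝ} (hε : 0 < ε) (hm : 0 < m) {f0 g : ℝ → ℝ} (h0 : Mini e W V m ε f0)
    (hlK : ε * lam e W m ε f0 * K ≤ c / 2) (hg : Prof e g) {p σ : ℝ} (hp : 0 < p) (hgp : g p = f0 p) (hσ : σ = 1 ∨ σ = -1)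
    (hz : ∀ r > 0, 0 < σ * (p - r) → ((f0 r ∈ Icc 0 τ ∧ g r ∈ Icc 0 τ) ∨ (f0 r ∈ Icc (1 - τ) 1 ∧ g r ∈ Icc (1 - τ) 1))) : 
    0 ≤ ∫ r in Ioi (0:ℝ) ∩ {r | 0 < σ * (p - r)}, r ^ (e + 1) * (2 * ε * (deriv f0 r * (deriv g r - deriv f0 r)) + 
      (FF W V ε (lam e W m ε f0) (g r) - FF W V ε (lam e W m ε f0) (f0 r)) - c / (2 * ε) * (g r - f0 r) ^ 2) := by
  have hf := h0.prof
  have hl0 := lam_nonneg hP hε hm hf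
  set l := lam e W m ε f0 with hl
  have hK : 0 ≤ K := by linarith [hP.K1]
  have hc := hP.c0
  have m0 := measurable_deriv f0
  have m1 := measurable_deriv g
  have c0 := hf.diff.continuous.measurable
  have c1 := hg.diff.continuous.measurable
  have hS : MeasurableSet {r | 0 < σ * (p - r)} := measurableSet_lt measurable_const (by fun_prop)
  obtain ⟨Bst, hBst, hB⟩ := st_deriv_bdd
  obtain ⟨C0, hC0, hφ⟩ := lip_at (φ := fun r => g r - f0 r) (p := p) ((hg.diff p).sub (hf.diff p)) (by simp [hgp]) (fun r => by
    have a := hg.mem r; have b := hf.mem r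
    rw [abs_le]; constructor <;> linarith [a.1, a.2, b.1, b.2])
  set ω := (Icc (p - 1) (p + 1)).indicator (fun _ => Bst * C0) with hω
  have hωm : Measurable ω := measurable_const.indicator measurableSet_Icc
  have iω : IntegrableOn (fun r => r ^ (e + 1) * (ω r) ^ 2) (Ioi 0) := by
    have h1 : IntegrableOn (fun r : ℝ => r ^ (e + 1) * (Bst * C0) ^ 2) (Icc (p - 1) (p + 1)) := 
      (by fun_prop : ContinuousOn (fun r : ℝ => r ^ (e + 1) * (Bst * C0) ^ 2) _).integrableOn_compact isCompact_Icc
    have h2 := (integrable_indicator_iff measurableSet_Icc).2 h1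
    refine IntegrableOn.congr_fun h2.integrableOn (fun r _ => ?_) measurableSet_Ioi
    by_cases hr : r ∈ Icc (p - 1) (p + 1)
    · simp only [hω, indicator_of_mem hr]
    · simp only [hω, indicator_of_notMem hr]; ring
  set η : ℕ → ℝ → ℝ := fun k r => Real.smoothTransition (k * (σ * (p - r))) with hη
  have hη01 : ∀ k r, 0 ≤ η k r ∧ η k r ≤ 1 := fun k r => ⟨Real.smoothTransition.nonneg _, Real.smoothTransition.le_one _⟩
  set η' : ℕ → ℝ → ℝ := fun k r => deriv Real.smoothTransition (k * (σ * (p - r))) * (k * (-σ)) with hη'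
  have hηd : ∀ k r, HasDerivAt (η k) (η' k r) r := by
    intro k r
    have h1 : HasDerivAt (fun r : ℝ => (k:ℝ) * (σ * (p - r))) (k * (-σ)) r := by
      have := (((hasDerivAt_id r).const_sub p).const_mul σ).const_mul (k:ℝ)
      refine this.congr_deriv (by ring)
    exact (st_diff _).hasDerivAt.comp r h1
  set F1 : ℕ → ℝ → ℝ := fun k r => f0 r + η k r * (g r - f0 r) with hF1
  have hd1 : ∀ k r, HasDerivAt (F1 k) (deriv f0 r + (η' k r * (g r - f0 r) + η k r * (deriv g r - deriv f0 r))) r := fun k r => 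
    (hf.diff r).hasDerivAt.add ((hηd k r).mul ((hg.diff r).hasDerivAt.sub (hf.diff r).hasDerivAt))
  have hdF : ∀ k r, deriv (F1 k) r = deriv f0 r + (η' k r * (g r - f0 r) + η k r * (deriv g r - deriv f0 r)) := fun k r => (hd1 k r).deriv
  have hcut : ∀ k, 1 ≤ k → ∀ r, |η' k r * (g r - f0 r)| ≤ ω r := fun k hk r => cut_props hk hσ hB hC0.le (hφ r)
  have hseg : ∀ k r, F1 k r = (1 - η k r) * f0 r + η k r * g r := fun k r => by simp only [hF1]; ring
  have hmem : ∀ k r, F1 k r ∈ Icc (0:ℝ) 1 := fun k r => by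
    rw [hseg]; exact seg_mem (hf.mem r) (hg.mem r) (hη01 k r).1 (hη01 k r).2
  have iψ' := int_sub_sq measurableSet_Ioi Ioi_subset_Ici_self m1 m0 hg.i1 hf.i1
  have iψ := int_sub_sq measurableSet_Ioi Ioi_subset_Ici_self c1 c0 hg.i0 hf.i0
  have hle : ∀ k r, F1 k r ≤ f0 r + g r := fun k r => by
    rw [hseg]
    have h1 := hη01 k r
    have h2 := (hf.mem r).1
    have h3 := (hg.mem r).1
    have h4 : (1 - η k r) * f0 r ≤ f0 r := mul_le_of_le_one_left h2 (by linarith)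
    have h5 : η k r * g r ≤ g r := mul_le_of_le_one_left h3 (by linarith)
    linarith
  have hdiff : ∀ k, Differentiable ℝ (F1 k) := fun k r => (hd1 k r).differentiableAt
  have hprof : ∀ k : ℕ, 1 ≤ k → 1 ≤ k * p → Prof e (F1 k) := by
    intro k hk hkp
    refine ⟨hdiff k, ?_, hmem k, ?_, ?_⟩
    · rw [hdF, hf.d0, hg.d0]
      have : η' k 0 = 0 := by
        simp only [hη']
        rw [st_deriv_zero, zero_mul]
        rcases hσ with h | h
        · right; rw [h]; linarith
        · left; rw [h]; linarith
      rw [this]; ring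
    · refine Integrable.mono' ((hf.i0.add hg.i0).const_mul 2) ?_ ?_
      · have := (hdiff k).continuous
        exact (by fun_prop : Continuous fun r => r ^ (e + 1) * F1 k r ^ 2).aestronglyMeasurable
      filter_upwards [ae_restrict_mem measurableSet_Ioi] with r hr
      have hr : (0:ℝ) < r := hr
      rw [Real.norm_eq_abs, abs_of_nonneg (by positivity), Pi.add_apply]
      have h1 := hle k r
      have h2 := (hmem k r).1
      have h3 : F1 k r ^ 2 ≤ 2 * (f0 r ^ 2 + g r ^ 2) := by nlinarith [sq_nonneg (f0 r - g r)]
      calc _ ≤ r ^ (e + 1) * (2 * (f0 r ^ 2 + g r ^ 2)) := by gcongr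
        _ = _ := by ring
    · refine Integrable.mono' (((hf.i1.add iψ').add iω).const_mul 3) ?_ ?_
      · exact ((measurable_id.pow_const _).mul ((measurable_deriv _).pow_const 2)).aestronglyMeasurable
      filter_upwards [ae_restrict_mem measurableSet_Ioi] with r hr
      have hr : (0:ℝ) < r := hr
      rw [Real.norm_eq_abs, abs_of_nonneg (by positivity), Pi.add_apply, Pi.add_apply, hdF]
      have h1 := hcut k hk r
      have h2 := hη01 k r
      have h3 : (η' k r * (g r - f0 r)) ^ 2 ≤ ω r ^ 2 := sq_le_sq' (by linarith [neg_abs_le (η' k r * (g r - f0 r))]) ((le_abs_self _).trans h1)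
      have h4 : (η k r * (deriv g r - deriv f0 r)) ^ 2 ≤ (deriv g r - deriv f0 r) ^ 2 := by
        rw [mul_pow]; exact mul_le_of_le_one_left (sq_nonneg _) (pow_le_one₀ h2.1 h2.2)
      have h5 : ∀ x y z : ℝ, (x + (y + z)) ^ 2 ≤ 3 * (x ^ 2 + z ^ 2 + y ^ 2) := fun x y z => by
        nlinarith [sq_nonneg (x - y), sq_nonneg (y - z), sq_nonneg (x - z)]
      have h6 := h5 (deriv f0 r) (η' k r * (g r - f0 r)) (η k r * (deriv g r - deriv f0 r))
      calc _ ≤ r ^ (e + 1) * (3 * (deriv f0 r ^ 2 + (deriv g r - deriv f0 r) ^ 2 + ω r ^ 2)) := by gcongr; linarith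
        _ = _ := by ring
  set T : ℝ → ℝ → ℝ → ℝ := fun r x y => r ^ (e + 1) * (2 * ε * (deriv f0 r * (y - deriv f0 r)) + 
      (FF W V ε l x - FF W V ε l (f0 r)) - c / (2 * ε) * (x - f0 r) ^ 2) with hT
  have hA : ∀ k : ℕ, 1 ≤ k → 1 ≤ k * p → 0 ≤ ∫ r in Ioi (0:ℝ), T r (F1 k r) (deriv (F1 k) r) := by
    intro k hk hkp
    refine lemA hP hε hm h0 hlK (hprof k hk hkp) fun r hr => ?_
    by_cases h : 0 < σ * (p - r)
    · right
      have h1 := hη01 k r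
      rcases hz r hr h with h2 | h2
      · exact Or.inl ⟨h2.1, by rw [hseg]; exact seg_mem h2.1 h2.2 h1.1 h1.2⟩
      · exact Or.inr ⟨h2.1, by rw [hseg]; exact seg_mem h2.1 h2.2 h1.1 h1.2⟩
    · left
      have : η k r = 0 := by
        simp only [hη]
        apply Real.smoothTransition.zero_of_nonpos
        push Not at h
        exact mul_nonpos_of_nonneg_of_nonpos (by positivity) h
      simp only [hF1, this]; ring
  have hlim : Tendsto (fun k : ℕ => ∫ r in Ioi (0:ℝ), T r (F1 k r) (deriv (F1 k) r)) atTop 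
      (𝓝 (∫ r in Ioi (0:ℝ), {r | 0 < σ * (p - r)}.indicator (fun r => T r (g r) (deriv g r)) r)) := by
    refine tendsto_integral_filter_of_dominated_convergence (fun r => 2 * ε * (r ^ (e + 1) * deriv f0 r ^ 2 + r ^ (e + 1) * (deriv g r - deriv f0 r) ^ 2 + r ^ (e + 1) * ω r ^ 2) + 
      4 * (K / ε + l * K) * (r ^ (e + 1) * f0 r ^ 2 + r ^ (e + 1) * g r ^ 2) + c / (2 * ε) * (r ^ (e + 1) * (g r - f0 r) ^ 2)) ?_ ?_ ?_ ?_
    · refine Eventually.of_forall fun k => Measurable.aestronglyMeasurable ?_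
      have a1 : Measurable fun r => FF W V ε l (F1 k r) := by
        have h1 := (hP.qlW.comp (hdiff k).continuous (hmem k)).measurable
        have h2 := (hP.qlV.comp (hdiff k).continuous (hmem k)).measurable
        exact (h1.div_const ε).sub (h2.const_mul l)
      have a2 : Measurable fun r => FF W V ε l (f0 r) := (FF_cont hP hf).measurable
      have a3 := measurable_deriv (F1 k)
      have a4 := (hdiff k).continuous.measurable
      simp only [hT]
      fun_prop
    · filter_upwards [eventually_ge_atTop 1] with k hk
      filter_upwards [ae_restrict_mem measurableSet_Ioi] with r hr
      have hr : (0:ℝ) < r := hr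
      have h1 := hcut k hk r
      have h2 := hη01 k r
      simp only [hT]
      rw [Real.norm_eq_abs, abs_mul, abs_of_nonneg (by positivity : 0 ≤ r ^ (e + 1))]
      have b1 : |deriv f0 r * (deriv (F1 k) r - deriv f0 r)| ≤ deriv f0 r ^ 2 + (deriv g r - deriv f0 r) ^ 2 + ω r ^ 2 := by
        rw [hdF, add_sub_cancel_left]
        set x := deriv f0 r
        set y := η' k r * (g r - f0 r)
        set z := deriv g r - deriv f0 r
        have y2 : y ^ 2 ≤ ω r ^ 2 := sq_le_sq' (by linarith [neg_abs_le y]) ((le_abs_self _).trans h1)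
        have z2 : (η k r * z) ^ 2 ≤ z ^ 2 := by
          rw [mul_pow]; exact mul_le_of_le_one_left (sq_nonneg _) (pow_le_one₀ h2.1 h2.2)
        rw [abs_le]; constructor <;> nlinarith [sq_nonneg (x + (y + η k r * z)), sq_nonneg (x - (y + η k r * z)), sq_nonneg (y - η k r * z), sq_nonneg x]
      have b2 : ∀ U, QL U K → |U (F1 k r) - U (f0 r)| ≤ K * (4 * (f0 r ^ 2 + g r ^ 2)) := by
        intro U hU
        refine (hU.2 _ (hmem k r) _ (hf.mem r)).trans ?_
        rw [mul_assoc]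
        refine mul_le_mul_of_nonneg_left ?_ hK
        have h3 := hle k r
        have h4 := (hmem k r).1
        have h5 := (hf.mem r).1
        have h6 := (hg.mem r).1
        have h7 : |F1 k r - f0 r| ≤ f0 r + g r := by rw [abs_le]; constructor <;> linarith
        calc _ ≤ (f0 r + g r) * (2 * (f0 r + g r)) := mul_le_mul h7 (by linarith) (by linarith) (by linarith)
          _ ≤ _ := by nlinarith [sq_nonneg (f0 r - g r)]
      have b3 : |FF W V ε l (F1 k r) - FF W V ε l (f0 r)| ≤ (K / ε + l * K) * (4 * (f0 r ^ 2 + g r ^ 2)) := by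
        have : FF W V ε l (F1 k r) - FF W V ε l (f0 r) = (W (F1 k r) - W (f0 r)) / ε - l * (V (F1 k r) - V (f0 r)) := by unfold FF; ring
        rw [this]
        refine (abs_sub _ _).trans ?_
        rw [abs_div, abs_mul, abs_of_pos hε, abs_of_nonneg hl0]
        have w := b2 W hP.qlW
        have v := b2 V hP.qlV
        calc _ ≤ K * (4 * (f0 r ^ 2 + g r ^ 2)) / ε + l * (K * (4 * (f0 r ^ 2 + g r ^ 2))) := by gcongr
          _ = _ := by ring
      have b4 : (F1 k r - f0 r) ^ 2 ≤ (g r - f0 r) ^ 2 := by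
        have : F1 k r - f0 r = η k r * (g r - f0 r) := by simp only [hF1]; ring
        rw [this, mul_pow]; exact mul_le_of_le_one_left (sq_nonneg _) (pow_le_one₀ h2.1 h2.2)
      have b5 : |2 * ε * (deriv f0 r * (deriv (F1 k) r - deriv f0 r)) + (FF W V ε l (F1 k r) - FF W V ε l (f0 r)) - c / (2 * ε) * (F1 k r - f0 r) ^ 2| ≤ 
          2 * ε * (deriv f0 r ^ 2 + (deriv g r - deriv f0 r) ^ 2 + ω r ^ 2) + (K / ε + l * K) * (4 * (f0 r ^ 2 + g r ^ 2)) + c / (2 * ε) * (g r - f0 r) ^ 2 := by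
        refine (abs_sub _ _).trans (add_le_add ((abs_add_le _ _).trans (add_le_add ?_ b3)) ?_)
        · rw [abs_mul, abs_of_pos (by positivity : 0 < 2 * ε)]; gcongr
        · rw [abs_of_nonneg (by positivity)]; gcongr
      calc _ ≤ _ := mul_le_mul_of_nonneg_left b5 (by positivity)
        _ = _ := by ring
    · exact (((((hf.i1.add iψ').add iω).const_mul _)).add ((hf.i0.add hg.i0).const_mul _)).add (iψ.const_mul _)
    · filter_upwards [ae_restrict_mem measurableSet_Ioi] with r hr
      have hr : (0:ℝ) < r := hr
      by_cases h : 0 < σ * (p - r)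
      · rw [indicator_of_mem (by exact h)]
        refine tendsto_const_nhds.congr' ?_
        obtain ⟨N, hN⟩ := exists_nat_gt (1 / (σ * (p - r)))
        filter_upwards [eventually_ge_atTop N] with k hk
        have hk1 : 1 ≤ (k:ℝ) * (σ * (p - r)) := by
          rw [div_lt_iff₀ h] at hN
          have : (N:ℝ) ≤ k := by exact_mod_cast hk
          nlinarith
        have e1 : η k r = 1 := by
          simp only [hη]; exact Real.smoothTransition.one_of_one_le hk1
        have e2 : η' k r = 0 := by
          simp only [hη']; rw [st_deriv_zero (Or.inr hk1), zero_mul]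
        have e3 : F1 k r = g r := by simp only [hF1, e1]; ring
        have e4 : deriv (F1 k) r = deriv g r := by rw [hdF, e1, e2]; ring
        rw [e3, e4]
      · rw [indicator_of_notMem (by exact h)]
        refine tendsto_const_nhds.congr fun k => ?_
        have hk1 : (k:ℝ) * (σ * (p - r)) ≤ 0 := by
          push Not at h
          exact mul_nonpos_of_nonneg_of_nonpos (by positivity) h
        have e1 : η k r = 0 := by
          simp only [hη]; exact Real.smoothTransition.zero_of_nonpos hk1
        have e2 : η' k r = 0 := by
          simp only [hη']; rw [st_deriv_zero (Or.inl hk1), zero_mul]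
        have e3 : F1 k r = f0 r := by simp only [hF1, e1]; ring
        have e4 : deriv (F1 k) r = deriv f0 r := by rw [hdF, e1, e2]; ring
        rw [e3, e4]; simp only [hT]; ring
  rw [setIntegral_indicator hS] at hlim
  refine ge_of_tendsto hlim ?_
  obtain ⟨N, hN⟩ := exists_nat_gt (1 / p)
  filter_upwards [eventually_ge_atTop (N + 1)] with k hk
  refine hA k (by omega) ?_
  rw [div_lt_iff₀ hp] at hN
  have : (N:ℝ) + 1 ≤ k := by exact_mod_cast hk
  nlinarith

end S15

namespace S15
open Topology
variable {W V : ℝ → ℝ} {τ c K : ℝ} {e : ℕ} {f g : ℝ → ℝ}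

set_option maxHeartbeats 1000000 in
lemma side_alg (e : ℕ) : ∃ D : ℝ, 1 ≤ D ∧ ∀ κ G0 G1 P0 P1 Q X Y : ℝ, D * |κ - 1| ≤ 1 / 8 → 0 ≤ G0 → G0 ≤ Y → |X| ≤ Y → 0 ≤ Q → 
    G0 + P0 + Q ≤ G1 + P1 → (∀ s > 0, |G1 - G0| ≤ s * G0 + (1 / s + 1) * Q) → ((e:ℝ) + 2) * P0 + e * G0 = X → 
    G0 + P0 + X * (κ ^ (e + 2) - 1) / (e + 2) + Q / 2 - D * Y * (κ - 1) ^ 2 ≤ κ ^ e * G1 + κ ^ (e + 2) * P1 := by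
  obtain ⟨C1, hC1, h1⟩ := pow_expand e
  obtain ⟨C2, hC2, h2⟩ := pow_expand (e + 2)
  set D0 : ℝ := 2 * e + 2 + C1 + C2 with hD0
  have hD01 : 1 ≤ D0 := by have : (0:ℝ) ≤ e := by positivity
                           linarith
  refine ⟨4 * D0 ^ 2 + D0 + 2 * C2, by nlinarith, ?_⟩
  intro κ G0 G1 P0 P1 Q X Y hx g0 gY hX hQ hm hs hp
  set x := κ - 1 with hxd
  have hκ : κ = 1 + x := by rw [hxd]; ring
  have hx' : D0 * |x| ≤ 1 / 8 := by
    refine le_trans ?_ hx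
    gcongr
    nlinarith
  have ax := abs_nonneg x
  have hx1 : |x| ≤ 1 / 8 := by nlinarith
  have e1 := h1 x (by linarith)
  have e2 := h2 x (by linarith)
  rw [← hκ] at e1 e2
  set A := κ ^ e
  set B := κ ^ (e + 2)
  push_cast at e2
  have hY : 0 ≤ Y := g0.trans gY
  have x2 : x ^ 2 ≤ |x| := by rw [← sq_abs]; nlinarith
  have he : (0:ℝ) ≤ e := by positivity
  have hB : |B - 1| ≤ D0 * |x| := by
    have : B - 1 = (B - 1 - (e + 2) * x) + (e + 2) * x := by ring
    rw [this]
    refine (abs_add_le _ _).trans ?_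
    rw [abs_mul, abs_of_nonneg (by positivity : (0:ℝ) ≤ e + 2)]
    have : C2 * x ^ 2 ≤ C2 * |x| := by gcongr
    nlinarith
  have hAB : |A - B| ≤ D0 * |x| := by
    have : A - B = (A - 1 - e * x) - (B - 1 - (e + 2) * x) - 2 * x := by ring
    rw [this]
    refine (abs_sub _ _).trans ((add_le_add_left (abs_sub _ _) _).trans ?_)
    rw [abs_mul, abs_of_pos (by norm_num : (0:ℝ) < 2)]
    have : C2 * x ^ 2 ≤ C2 * |x| := by gcongr
    have : C1 * x ^ 2 ≤ C1 * |x| := by gcongr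
    nlinarith
  have hB78 : 7 / 8 ≤ B := by have := abs_le.1 (hB.trans hx'); linarith [this.1]
  have step1 : A * G0 + B * P0 + Q / 2 - 4 * D0 ^ 2 * Y * x ^ 2 ≤ A * G1 + B * P1 := by
    have k1 : A * G0 + B * P0 + B * Q + (A - B) * (G1 - G0) ≤ A * G1 + B * P1 := by nlinarith
    have k2 : |(A - B) * (G1 - G0)| ≤ 4 * D0 ^ 2 * Y * x ^ 2 + (3 / 8) * Q := by
      rw [abs_mul]
      rcases eq_or_ne (A - B) 0 with h | h
      · rw [h, abs_zero, zero_mul]; positivity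
      · have hp : 0 < |A - B| := abs_pos.2 h
        set d := |A - B|
        have k3 := hs (4 * d) (by positivity)
        have k4 : d * |G1 - G0| ≤ 4 * d ^ 2 * G0 + (1 / 4 + d) * Q := by
          calc _ ≤ d * (4 * d * G0 + (1 / (4 * d) + 1) * Q) := by gcongr
            _ = _ := by field_simp
        have k5 : d ^ 2 ≤ D0 ^ 2 * x ^ 2 := by rw [← sq_abs x, ← mul_pow]; gcongr
        have k6 : 4 * d ^ 2 * G0 ≤ 4 * (D0 ^ 2 * x ^ 2) * Y := by gcongr
        have k7 : d ≤ 1 / 8 := hAB.trans hx'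
        have k8 : d * Q ≤ 1 / 8 * Q := by gcongr
        linarith
    have := neg_abs_le ((A - B) * (G1 - G0))
    have k9 : 7 / 8 * Q ≤ B * Q := by gcongr
    linarith
  have he2 : (0:ℝ) < e + 2 := by positivity
  have step2 : |A * G0 + B * P0 - (G0 + P0 + X * (B - 1) / (e + 2))| ≤ (D0 + 2 * C2) * Y * x ^ 2 := by
    have k1 : A * G0 + B * P0 - (G0 + P0 + X * (B - 1) / (e + 2)) = (A - 1 - e * x) * G0 + (B - 1 - (e + 2) * x) * (P0 - X / (e + 2)) := by
      rw [← hp]; field_simp; ring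
    have k2 : P0 - X / (e + 2) = - (e * G0 / (e + 2)) := by rw [← hp]; field_simp; ring
    have k3 : e * G0 / (e + 2) ≤ Y := by
      rw [div_le_iff₀ he2]
      have : e * G0 ≤ e * Y := by gcongr
      linarith
    rw [k1, k2]
    refine (abs_add_le _ _).trans ?_
    rw [abs_mul, abs_mul, abs_neg, abs_of_nonneg g0, abs_of_nonneg (by positivity : 0 ≤ e * G0 / (e + 2))]
    calc _ ≤ C1 * x ^ 2 * Y + C2 * x ^ 2 * Y := by gcongr
      _ = (C1 + C2) * (Y * x ^ 2) := by ring
      _ ≤ (D0 + 2 * C2) * (Y * x ^ 2) := by refine mul_le_mul_of_nonneg_right (by linarith) (by positivity)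
      _ = _ := by ring
  have := neg_abs_le (A * G0 + B * P0 - (G0 + P0 + X * (B - 1) / (e + 2)))
  have k : (4 * D0 ^ 2 + D0 + 2 * C2) * Y * x ^ 2 = 4 * D0 ^ 2 * Y * x ^ 2 + (D0 + 2 * C2) * Y * x ^ 2 := by ring
  rw [k]
  linarith

def QQ (e : ℕ) (c ε : ℝ) (f0 g : ℝ → ℝ) (S : Set ℝ) : ℝ := 
  ε * (∫ r in S, r ^ (e + 1) * (deriv g r - deriv f0 r) ^ 2) + c / (2 * ε) * ∫ r in S, r ^ (e + 1) * (g r - f0 r) ^ 2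

lemma QQ_parts {ε : ℝ} (hε : 0 < ε) (hc : 0 < c) {f0 : ℝ → ℝ} {S : Set ℝ} (hS : MeasurableSet S) (hS0 : S ⊆ Ici 0) :
    0 ≤ QQ e c ε f0 g S ∧ ε * (∫ r in S, r ^ (e + 1) * (deriv g r - deriv f0 r) ^ 2) ≤ QQ e c ε f0 g S ∧ 
    (∫ r in S, r ^ (e + 1) * (g r - f0 r) ^ 2) ≤ 2 * ε / c * QQ e c ε f0 g S := by
  have h1 : 0 ≤ ∫ r in S, r ^ (e + 1) * (deriv g r - deriv f0 r) ^ 2 := setIntegral_nonneg hS fun r hr => by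
    have : (0:ℝ) ≤ r := hS0 hr
    positivity
  have h2 : 0 ≤ ∫ r in S, r ^ (e + 1) * (g r - f0 r) ^ 2 := setIntegral_nonneg hS fun r hr => by
    have : (0:ℝ) ≤ r := hS0 hr
    positivity
  unfold QQ
  set X := ∫ r in S, r ^ (e + 1) * (deriv g r - deriv f0 r) ^ 2
  set Y := ∫ r in S, r ^ (e + 1) * (g r - f0 r) ^ 2
  have h3 : 0 ≤ c / (2 * ε) * Y := by positivity
  have h4 : 0 ≤ ε * X := by positivity
  refine ⟨by linarith, by linarith, ?_⟩
  have : 2 * ε / c * (ε * X + c / (2 * ε) * Y) = 2 * ε / c * (ε * X) + Y := by field_simp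
  rw [this]
  have : 0 ≤ 2 * ε / c * (ε * X) := by positivity
  linarith

lemma side_lin (hP : Pot W V τ c K) {ε l : ℝ} (hε : 0 < ε) {f0 : ℝ → ℝ} (h0 : Prof e f0) (hg : Prof e g) {S : Set ℝ} (hS : MeasurableSet S) (hS0 : S ⊆ Ioi 0)
    (hI : 0 ≤ ∫ r in S, r ^ (e + 1) * (2 * ε * (deriv f0 r * (deriv g r - deriv f0 r)) + 
      (FF W V ε l (g r) - FF W V ε l (f0 r)) - c / (2 * ε) * (g r - f0 r) ^ 2)) : 
    ε * SG e f0 S + SP e (FF W V ε l) f0 S + QQ e c ε f0 g S ≤ ε * SG e g S + SP e (FF W V ε l) g S ∧ 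
    ∀ s > 0, |ε * SG e g S - ε * SG e f0 S| ≤ s * (ε * SG e f0 S) + (1 / s + 1) * QQ e c ε f0 g S := by
  have hS0' : S ⊆ Ici 0 := hS0.trans Ioi_subset_Ici_self
  have m0 := measurable_deriv f0
  have m1 := measurable_deriv g
  have c0 := h0.diff.continuous.measurable
  have c1 := hg.diff.continuous.measurable
  have i0 := h0.i1.mono_set hS0
  have i1 := hg.i1.mono_set hS0
  have j0 := h0.i0.mono_set hS0
  have j1 := hg.i0.mono_set hS0
  have iφ' := int_sub_sq hS hS0' m1 m0 i1 i0
  have iφ := int_sub_sq hS hS0' c1 c0 j1 j0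
  have iF0 := (h0.intF (ε := ε) (l := l) hP).mono_set hS0
  have iF1 := (hg.intF (ε := ε) (l := l) hP).mono_set hS0
  have ip := int_prod hS hS0' m0 (m1.sub m0) i0 iφ'
  simp only [Pi.sub_apply] at ip
  have hid : SG e g S = SG e f0 S + 2 * (∫ r in S, r ^ (e + 1) * (deriv f0 r * (deriv g r - deriv f0 r))) + ∫ r in S, r ^ (e + 1) * (deriv g r - deriv f0 r) ^ 2 := by
    have := (lin4 i0 ip iφ' iφ' 1 2 1 0).2
    unfold SG
    rw [show (∫ r in S, r ^ (e + 1) * (deriv g r) ^ 2) = ∫ r in S, (1 * (r ^ (e + 1) * deriv f0 r ^ 2) + 2 * (r ^ (e + 1) * (deriv f0 r * (deriv g r - deriv f0 r))) + 1 * (r ^ (e + 1) * (deriv g r - deriv f0 r) ^ 2) + 0 * (r ^ (e + 1) * (deriv g r - deriv f0 r) ^ 2)) from 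
      integral_congr_ae (Eventually.of_forall fun r => by ring), this]
    ring
  have q := QQ_parts (e := e) (c := c) (g := g) (f0 := f0) hε hP.c0 hS hS0'
  constructor
  · have := (lin4 ip iF1 iF0 iφ (2 * ε) 1 (-1) (- (c / (2 * ε)))).2
    rw [show (∫ r in S, r ^ (e + 1) * (2 * ε * (deriv f0 r * (deriv g r - deriv f0 r)) + (FF W V ε l (g r) - FF W V ε l (f0 r)) - c / (2 * ε) * (g r - f0 r) ^ 2)) = _ from 
      (integral_congr_ae (Eventually.of_forall fun r => by ring)).trans this] at hI
    unfold QQ SP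
    rw [hid]
    nlinarith
  · intro s hs
    have hb : |∫ r in S, r ^ (e + 1) * (deriv f0 r * (deriv g r - deriv f0 r))| * 2 ≤ s * SG e f0 S + 1 / s * ∫ r in S, r ^ (e + 1) * (deriv g r - deriv f0 r) ^ 2 := by
      have l4 := lin4 i0 iφ' iφ' iφ' (s / 2) (1 / (2 * s)) 0 0
      have key : ∀ᵐ r ∂(volume.restrict S), ‖r ^ (e + 1) * (deriv f0 r * (deriv g r - deriv f0 r))‖ ≤ s / 2 * (r ^ (e + 1) * deriv f0 r ^ 2) + 1 / (2 * s) * (r ^ (e + 1) * (deriv g r - deriv f0 r) ^ 2) + 0 * (r ^ (e + 1) * (deriv g r - deriv f0 r) ^ 2) + 0 * (r ^ (e + 1) * (deriv g r - deriv f0 r) ^ 2) := by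
        filter_upwards [ae_restrict_mem hS] with r hr
        have hr : (0:ℝ) < r := hS0 hr
        have hw : 0 ≤ r ^ (e + 1) := by positivity
        rw [Real.norm_eq_abs, abs_mul, abs_of_nonneg hw]
        have : |deriv f0 r * (deriv g r - deriv f0 r)| ≤ s / 2 * deriv f0 r ^ 2 + 1 / (2 * s) * (deriv g r - deriv f0 r) ^ 2 := by
          set x := deriv f0 r
          set y := deriv g r - x
          have k1 : 0 ≤ (s * x - y) ^ 2 / (2 * s) := by positivity
          have k2 : 0 ≤ (s * x + y) ^ 2 / (2 * s) := by positivity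
          have k3 : (s * x - y) ^ 2 / (2 * s) = s / 2 * x ^ 2 + 1 / (2 * s) * y ^ 2 - x * y := by field_simp; ring
          have k4 : (s * x + y) ^ 2 / (2 * s) = s / 2 * x ^ 2 + 1 / (2 * s) * y ^ 2 + x * y := by field_simp; ring
          rw [abs_le]; constructor <;> linarith
        have := mul_le_mul_of_nonneg_left this hw
        linarith
      have := norm_integral_le_of_norm_le l4.1 key
      rw [l4.2, Real.norm_eq_abs] at this
      unfold SG
      have k : 1 / (2 * s) * 2 = 1 / s := by field_simp
      rw [← k]; linarith
    rw [hid]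
    set X := ∫ r in S, r ^ (e + 1) * (deriv f0 r * (deriv g r - deriv f0 r))
    set Y := ∫ r in S, r ^ (e + 1) * (deriv g r - deriv f0 r) ^ 2
    have h1 : |ε * (SG e f0 S + 2 * X + Y) - ε * SG e f0 S| ≤ ε * (|X| * 2) + ε * Y := by
      have hY : 0 ≤ ε * Y := mul_nonneg hε.le (setIntegral_nonneg hS fun r hr => by
        have : (0:ℝ) ≤ r := hS0' hr
        positivity)
      have h3 : ε * (SG e f0 S + 2 * X + Y) - ε * SG e f0 S = ε * (X * 2) + ε * Y := by ring
      rw [h3]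
      refine (abs_add_le _ _).trans ?_
      rw [abs_of_nonneg hY, abs_mul, abs_of_pos hε, abs_mul, abs_of_pos (by norm_num : (0:ℝ) < 2)]
    have h2 : ε * (|X| * 2) ≤ s * (ε * SG e f0 S) + 1 / s * (ε * Y) := by
      calc _ ≤ ε * (s * SG e f0 S + 1 / s * Y) := by gcongr
        _ = _ := by ring
    have h3 : 1 / s * (ε * Y) ≤ 1 / s * QQ e c ε f0 g S := by gcongr; exact q.2.1
    linarith [q.2.1]

lemma set_scal (F : ℝ → ℝ) {κ : ℝ} (hκ : 0 < κ) {S T : Set ℝ} (hS : MeasurableSet S) (hT : MeasurableSet T) (hS0 : S ⊆ Ioi 0) (hT0 : T ⊆ Ioi 0)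
    (hST : ∀ r, κ * r ∈ T ↔ r ∈ S) : 
    ∫ r in T, r ^ (e + 1) * F r = κ ^ (e + 2) * ∫ r in S, r ^ (e + 1) * F (κ * r) := by
  have := scal (e := e) (T.indicator F) hκ
  have h1 : ∀ r, r ^ (e + 1) * T.indicator F (κ * r) = S.indicator (fun r => r ^ (e + 1) * F (κ * r)) r := by
    intro r
    by_cases h : r ∈ S
    · rw [indicator_of_mem h, indicator_of_mem ((hST r).2 h)]
    · rw [indicator_of_notMem h, indicator_of_notMem (fun h2 => h ((hST r).1 h2)), mul_zero]
  have h2 : ∀ r, r ^ (e + 1) * T.indicator F r = T.indicator (fun r => r ^ (e + 1) * F r) r := by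
    intro r
    by_cases h : r ∈ T
    · rw [indicator_of_mem h, indicator_of_mem h]
    · rw [indicator_of_notMem h, indicator_of_notMem h, mul_zero]
  simp only [h1, h2] at this
  rw [setIntegral_indicator hS, setIntegral_indicator hT, inter_eq_right.2 hS0, inter_eq_right.2 hT0] at this
  rw [this]
  field_simp

lemma SP_scal (U : ℝ → ℝ) {κ : ℝ} (hκ : 0 < κ) {S T : Set ℝ} (hS : MeasurableSet S) (hT : MeasurableSet T) (hS0 : S ⊆ Ioi 0) (hT0 : T ⊆ Ioi 0)
    (hST : ∀ r, κ * r ∈ T ↔ r ∈ S) : SP e U f T = κ ^ (e + 2) * SP e U (fun r => f (κ * r)) S :=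
  set_scal (fun r => U (f r)) hκ hS hT hS0 hT0 hST

lemma SG_scal (hf : Differentiable ℝ f) {κ : ℝ} (hκ : 0 < κ) {S T : Set ℝ} (hS : MeasurableSet S) (hT : MeasurableSet T) (hS0 : S ⊆ Ioi 0) (hT0 : T ⊆ Ioi 0)
    (hST : ∀ r, κ * r ∈ T ↔ r ∈ S) : SG e f T = κ ^ e * SG e (fun r => f (κ * r)) S := by
  have := set_scal (e := e) (fun r => (deriv f r) ^ 2) hκ hS hT hS0 hT0 hST
  unfold SG
  rw [this]
  simp only [deriv_scale hf, mul_pow]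
  rw [← integral_const_mul, ← integral_const_mul]
  congr 1; ext r; ring

lemma SG_le (hf : Prof e f) {S : Set ℝ} (hS0 : S ⊆ Ioi 0) : 0 ≤ SG e f S ∧ SG e f S ≤ GG e f := by
  have h : 0 ≤ᵐ[volume.restrict (Ioi (0:ℝ))] fun r => r ^ (e + 1) * (deriv f r) ^ 2 := by
    filter_upwards [ae_restrict_mem measurableSet_Ioi] with r hr
    have hr : (0:ℝ) < r := hr
    simp only [Pi.zero_apply]; positivity
  refine ⟨?_, setIntegral_mono_set hf.i1 h hS0.eventuallyLE⟩
  exact integral_nonneg_of_ae (ae_mono (Measure.restrict_mono hS0 le_rfl) h)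

lemma side (e : ℕ) {R C : ℝ} (hR : 0 < R) (hC : 1 ≤ C) : ∃ D ε2 : ℝ, 0 < D ∧ 0 < ε2 ∧ ∀ (W V : ℝ → ℝ) (τ c K m ε l : ℝ) (f0 f : ℝ → ℝ) (a b α β : ℝ), ε < ε2 → 
    Dat e W V τ c K m R C ε l f0 f a b α β → 
    (ε * SG e f0 (Ioc 0 a) + SP e (FF W V ε l) f0 (Ioc 0 a) + xi W V ε l f0 a * (α ^ (e + 2) - a ^ (e + 2)) / (e + 2) + 
      QQ e c ε f0 (fun r => f (α / a * r)) (Ioc 0 a) / 2 - D * (α - a) ^ 2 ≤ ε * SG e f (Ioc 0 α) + SP e (FF W V ε l) f (Ioc 0 α)) ∧ 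
    (ε * SG e f0 (Ioi b) + SP e (FF W V ε l) f0 (Ioi b) - xi W V ε l f0 b * (β ^ (e + 2) - b ^ (e + 2)) / (e + 2) + 
      QQ e c ε f0 (fun r => f (β / b * r)) (Ioi b) / 2 - D * (β - b) ^ 2 ≤ ε * SG e f (Ioi β) + SP e (FF W V ε l) f (Ioi β)) := by
  obtain ⟨D, hD, hal⟩ := side_alg e
  set Y := C + (2 * R) ^ (e + 2) * C with hY
  have hY0 : 0 < Y := by positivity
  refine ⟨D * Y * (2 / R) ^ 2, R / (32 * D * C + 1), by positivity, by positivity, ?_⟩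
  intro W V τ c K m ε l f0 f a b α β hε2 d
  have hε := d.ε0
  have hτ0 := d.hP.τ0
  have hτ1 := d.hP.τ1
  have a0 : 0 < a := by linarith [d.aR]
  have α0 : 0 < α := by linarith [d.αR]
  have b0 : 0 < b := a0.trans d.ab
  have β0 : 0 < β := α0.trans d.αβ
  have key : ∀ p ρ, R / 2 ≤ p → p ≤ 2 * R → |p - R| ≤ C * ε → |ρ - R| ≤ C * ε → D * |ρ / p - 1| ≤ 1 / 8 ∧ (ρ / p - 1) ^ 2 ≤ (2 / R) ^ 2 * (ρ - p) ^ 2 := by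
    intro p ρ hp1 hp2 h1 h2
    have p0 : 0 < p := by linarith
    have h3 : ρ / p - 1 = (ρ - p) / p := by field_simp
    have h4 : |ρ - p| ≤ 2 * C * ε := by rw [abs_le] at *; constructor <;> linarith [h1.1, h1.2, h2.1, h2.2]
    have h5 : |(ρ - p) / p| ≤ 2 / R * |ρ - p| := by
      rw [abs_div, abs_of_pos p0, div_le_iff₀ p0]
      have : 1 ≤ 2 / R * p := by rw [div_mul_eq_mul_div, le_div_iff₀ hR]; linarith
      nlinarith [abs_nonneg (ρ - p)]
    rw [h3]
    constructor
    · have h6 : ε * (32 * D * C + 1) < R := by rwa [lt_div_iff₀ (by positivity)] at hε2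
      calc _ ≤ D * (2 / R * (2 * C * ε)) := by gcongr; exact h5.trans (by gcongr)
        _ = (4 * D * C * ε) / R := by ring
        _ ≤ _ := by rw [div_le_iff₀ hR]; nlinarith
    · rw [← sq_abs, ← sq_abs (ρ - p), ← mul_pow]; gcongr
  have keyX : ∀ p, R / 2 ≤ p → p ≤ 2 * R → |p ^ (e + 2) * xi W V ε l f0 p| ≤ Y := by
    intro p h1 h2
    have p0 : 0 < p := by linarith
    rw [abs_mul, abs_of_pos (by positivity)]
    have := d.xiC p h1
    calc _ ≤ (2 * R) ^ (e + 2) * C := by gcongr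
      _ ≤ _ := by linarith
  have keyG : ∀ S : Set ℝ, S ⊆ Ioi 0 → 0 ≤ ε * SG e f0 S ∧ ε * SG e f0 S ≤ Y := by
    intro S hS
    have h := SG_le d.h0.prof hS
    refine ⟨mul_nonneg hε.le h.1, ?_⟩
    have : 0 ≤ (2 * R) ^ (e + 2) * C := by positivity
    calc _ ≤ ε * GG e f0 := by gcongr; exact h.2
      _ ≤ _ := by linarith [d.eG]
  have hgen : ∀ p ρ σ : ℝ, ∀ S T : Set ℝ, R / 2 ≤ p → p ≤ 2 * R → |p - R| ≤ C * ε → |ρ - R| ≤ C * ε → 0 < ρ → f0 p = f ρ → (σ = 1 ∨ σ = -1) → 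
      MeasurableSet S → MeasurableSet T → S ⊆ Ioi 0 → T ⊆ Ioi 0 → (∀ r, ρ / p * r ∈ T ↔ r ∈ S) → ((Ioi (0:ℝ) ∩ {r | 0 < σ * (p - r)} : Set ℝ) =ᵐ[volume] S) → 
      (∀ r > 0, 0 < σ * (p - r) → ((f0 r ∈ Icc 0 τ ∧ f (ρ / p * r) ∈ Icc 0 τ) ∨ (f0 r ∈ Icc (1 - τ) 1 ∧ f (ρ / p * r) ∈ Icc (1 - τ) 1))) →
      ((e:ℝ) + 2) * SP e (FF W V ε l) f0 S + e * (ε * SG e f0 S) = σ * (p ^ (e + 2) * xi W V ε l f0 p) → 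
      ε * SG e f0 S + SP e (FF W V ε l) f0 S + σ * (xi W V ε l f0 p * (ρ ^ (e + 2) - p ^ (e + 2)) / (e + 2)) + 
      QQ e c ε f0 (fun r => f (ρ / p * r)) S / 2 - D * Y * (2 / R) ^ 2 * (ρ - p) ^ 2 ≤ ε * SG e f T + SP e (FF W V ε l) f T := by
    intro p ρ σ S T hp1 hp2 hp3 hρ hρ0 hfp hσ hS hT hS0 hT0 hST hae hz hpo
    have p0 : 0 < p := by linarith
    have hκ : 0 < ρ / p := by positivity
    have hg := d.hf.scale hκ
    have hgp : f (ρ / p * p) = f0 p := by rw [hfp]; congr 1; field_simp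
    have hB := lemB d.hP hε d.hm d.h0 (by rw [← d.hl]; exact d.lK) hg p0 hgp hσ hz
    rw [← d.hl, setIntegral_congr_set hae] at hB
    have hL := side_lin d.hP hε d.h0.prof hg hS hS0 hB
    have k1 := key p ρ hp1 hp2 hp3 hρ
    have kG := keyG S hS0
    have kX : |σ * (p ^ (e + 2) * xi W V ε l f0 p)| ≤ Y := by
      rw [abs_mul]
      have : |σ| = 1 := by rcases hσ with h | h <;> simp [h]
      rw [this, one_mul]; exact keyX p hp1 hp2
    have q := QQ_parts (e := e) (c := c) (g := fun r => f (ρ / p * r)) (f0 := f0) hε d.hP.c0 hS (hS0.trans Ioi_subset_Ici_self)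
    have := hal _ _ _ _ _ _ _ Y k1.1 kG.1 kG.2 kX q.1 hL.1 hL.2 hpo
    rw [SP_scal _ hκ hS hT hS0 hT0 hST, SG_scal d.hf.diff hκ hS hT hS0 hT0 hST]
    have k2 : D * Y * (ρ / p - 1) ^ 2 ≤ D * Y * (2 / R) ^ 2 * (ρ - p) ^ 2 := by
      rw [mul_assoc (D * Y)]; gcongr; exact k1.2
    have k3 : σ * (p ^ (e + 2) * xi W V ε l f0 p) * ((ρ / p) ^ (e + 2) - 1) / (e + 2) = σ * (xi W V ε l f0 p * (ρ ^ (e + 2) - p ^ (e + 2)) / (e + 2)) := by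
      rw [div_pow]; field_simp
    rw [k3] at this
    linarith
  have poho := fun r hr => pohozaev (r := r) d.hP hε d.hm d.h0 hr
  rw [← d.hl] at poho
  constructor
  · have := hgen a α 1 (Ioc 0 a) (Ioc 0 α) d.aR (by linarith [d.ab, d.bR]) d.aC d.αC α0 (by rw [d.fa, d.fα]) (Or.inl rfl) measurableSet_Ioc measurableSet_Ioc
      Ioc_subset_Ioi_self Ioc_subset_Ioi_self ?_ ?_ ?_ (by rw [(poho a a0).2, one_mul])
    · rw [one_mul] at this; exact this
    · intro r
      simp only [mem_Ioc]
      rw [mul_pos_iff_of_pos_left (by positivity), div_mul_eq_mul_div, div_le_iff₀ a0, mul_le_mul_iff_right₀ α0]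
    · have : Ioi (0:ℝ) ∩ {r | 0 < 1 * (a - r)} = Ioo 0 a := by ext r; simp
      rw [this]; exact Ioo_ae_eq_Ioc
    · intro r hr hr2
      right
      have h1 : r ≤ a := by linarith
      have h2 : α / a * r ≤ α := by rw [div_mul_eq_mul_div, div_le_iff₀ a0]; gcongr
      have h3 := d.h0.anti (mem_Ici.2 hr.le) (mem_Ici.2 a0.le) h1
      have h4 := d.anti (mem_Ici.2 (by positivity)) (mem_Ici.2 α0.le) h2
      rw [d.fa] at h3
      rw [d.fα] at h4
      exact ⟨⟨h3, (d.h0.prof.mem r).2⟩, h4, (d.hf.mem _).2⟩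
  · have := hgen b β (-1) (Ioi b) (Ioi β) (by linarith [d.ab, d.aR]) d.bR d.bC d.βC β0 (by rw [d.fb, d.fβ]) (Or.inr rfl) measurableSet_Ioi measurableSet_Ioi
      (Ioi_subset_Ioi b0.le) (Ioi_subset_Ioi β0.le) ?_ ?_ ?_ (by rw [(poho b b0).1]; ring)
    · rw [neg_one_mul, ← sub_eq_add_neg] at this; exact this
    · intro r
      simp only [mem_Ioi]
      rw [div_mul_eq_mul_div, lt_div_iff₀ b0, mul_lt_mul_iff_right₀ β0]
    · have : Ioi (0:ℝ) ∩ {r | 0 < -1 * (b - r)} = Ioi b := by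
        ext r
        simp only [mem_inter_iff, mem_Ioi, mem_setOf_eq]
        constructor
        · rintro ⟨_, h⟩; linarith
        · intro h; exact ⟨by linarith, by linarith⟩
      rw [this]; exact EventuallyEq.refl _ _
    · intro r hr hr2
      left
      have h1 : b ≤ r := by linarith
      have h2 : β ≤ β / b * r := by rw [div_mul_eq_mul_div, le_div_iff₀ b0]; gcongr
      have h3 := d.h0.anti (mem_Ici.2 b0.le) (mem_Ici.2 hr.le) h1
      have h4 := d.anti (mem_Ici.2 β0.le) (mem_Ici.2 (by positivity)) h2
      rw [d.fb] at h3
      rw [d.fβ] at h4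
      exact ⟨⟨(d.h0.prof.mem r).1, h3⟩, (d.hf.mem _).1, h4⟩

end S15

namespace S15
open Topology
variable {W V : ℝ → ℝ} {τ c K : ℝ} {e : ℕ} {f g : ℝ → ℝ}

structure Mid (f0 f h h' : ℝ → ℝ) (a b α β : ℝ) : Prop where
  hd : ∀ r, HasDerivAt h (h' r) r
  hα : h α = a
  hβ : h β = b
  mem : ∀ r ∈ Icc α β, h r ∈ Icc a b
  feq : ∀ r ∈ Icc α β, f r = f0 (h r)
  deq : ∀ r ∈ Icc α β, deriv f r = deriv f0 (h r) * h' r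
  nn : ∀ r ∈ Icc α β, 0 ≤ h' r
  meas : Measurable h'
  i2 : IntervalIntegrable (fun r => (h' r) ^ 2) volume α β

lemma mid_exists {m R C ε l a b α β : ℝ} {f0 : ℝ → ℝ} (d : Dat e W V τ c K m R C ε l f0 f a b α β) : ∃ h h', Mid f0 f h h' a b α β := by
  have hε := d.ε0
  have hc := d.hP.c0
  have a0 : 0 < a := by linarith [d.aR, d.R0]
  have α0 : 0 < α := by linarith [d.αR, d.R0]
  have hab := d.ab
  set s := √(c / 2) / ε with hs
  have s0 : 0 < s := by positivity
  have hq : ∀ r ∈ Icc a b, s ≤ - deriv f0 r := by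
    intro r hr
    have h1 := d.qlo r hr
    have h2 := d.reg.q0 r (by linarith [hr.1])
    rw [hs, div_le_iff₀ hε]
    apply Real.sqrt_le_iff.2 ⟨by nlinarith, by nlinarith⟩
  set k' : ℝ → ℝ := fun t => - deriv f0 (projIcc a b hab.le t) with hk'
  have k'c : Continuous k' := by
    have h1 : ContinuousOn (deriv f0) (Icc a b) := d.reg.qc.mono fun r hr => lt_of_lt_of_le a0 hr.1
    have h2 := continuousOn_iff_continuous_restrict.1 h1
    have := (h2.comp (continuous_projIcc (h := hab.le))).neg
    exact this
  have hk's : ∀ t, s ≤ k' t := fun t => hq _ (projIcc a b hab.le t).2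
  set k : ℝ → ℝ := fun t => - f0 a + ∫ x in a..t, k' x with hk
  have hkd : ∀ t, HasDerivAt k (k' t) t := fun t => (k'c.integral_hasStrictDerivAt a t).hasDerivAt.const_add _
  obtain ⟨j, j1, j2, j3, kmono⟩ := inverse_exists s0 hkd hk's
  have keq : ∀ t ∈ Icc a b, k t = - f0 t := by
    intro t ht
    have h1 : ∫ x in a..t, k' x = ∫ x in a..t, - deriv f0 x := by
      apply intervalIntegral.integral_congr
      intro x hx
      rw [uIcc_of_le ht.1] at hx
      simp only [hk', projIcc_of_mem hab.le (show x ∈ Icc a b from ⟨hx.1, hx.2.trans ht.2⟩)]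
    have h2 : ∫ x in a..t, - deriv f0 x = - f0 t - (- f0 a) := by
      refine intervalIntegral.integral_eq_sub_of_hasDerivAt (f := fun x => - f0 x) (fun x _ => (d.h0.prof.diff x).hasDerivAt.neg) ?_
      apply ContinuousOn.intervalIntegrable
      rw [uIcc_of_le ht.1]
      exact (d.reg.qc.mono fun r hr => lt_of_lt_of_le a0 hr.1).neg
    simp only [hk, h1, h2]; ring
  have jmono : StrictMono j := by
    intro x y hxy
    by_contra hcon
    push Not at hcon
    have := kmono.monotone hcon
    rw [j2, j2] at this; linarith
  set h : ℝ → ℝ := fun r => j (- f r) with hh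
  have hhd : ∀ r, HasDerivAt h ((k' (h r))⁻¹ * (- deriv f r)) r := fun r => (j3 _).comp r (d.hf.diff r).hasDerivAt.neg
  have hα : h α = a := by
    simp only [hh]; rw [d.fα, ← d.fa, ← keq a (left_mem_Icc.2 hab.le), j1]
  have hβ : h β = b := by
    simp only [hh]; rw [d.fβ, ← d.fb, ← keq b (right_mem_Icc.2 hab.le), j1]
  have hmem : ∀ r ∈ Icc α β, h r ∈ Icc a b := by
    intro r hr
    have h1 := d.anti (mem_Ici.2 α0.le) (mem_Ici.2 (α0.le.trans hr.1)) hr.1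
    have h2 := d.anti (mem_Ici.2 (α0.le.trans hr.1)) (mem_Ici.2 (α0.le.trans d.αβ.le)) hr.2
    constructor
    · rw [← hα]; exact jmono.monotone (neg_le_neg h1)
    · rw [← hβ]; exact jmono.monotone (neg_le_neg h2)
  have hk'eq : ∀ r ∈ Icc α β, k' (h r) = - deriv f0 (h r) := by
    intro r hr; simp only [hk', projIcc_of_mem hab.le (hmem r hr)]
  have hm' : Measurable fun r => (k' (h r))⁻¹ * (- deriv f r) := by
    have h1 : Continuous h := continuous_iff_continuousAt.2 fun r => (hhd r).continuousAt
    exact ((k'c.comp h1).measurable.inv).mul (measurable_deriv f).neg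
  refine ⟨h, fun r => (k' (h r))⁻¹ * (- deriv f r), hhd, hα, hβ, hmem, ?_, ?_, ?_, hm', ?_⟩
  · intro r hr
    have := j2 (- f r)
    rw [← hh] at *
    have h3 := keq _ (hmem r hr)
    have h4 : k (h r) = - f r := j2 _
    linarith
  · intro r hr
    rw [← neg_neg (deriv f0 (h r)), ← hk'eq r hr]
    have := hk's (h r)
    have : k' (h r) ≠ 0 := by linarith
    field_simp
  · intro r hr
    have := hk's (h r)
    have h3 := anti_deriv d.anti (lt_of_lt_of_le α0 hr.1)
    exact mul_nonneg (inv_nonneg.2 (by linarith)) (by linarith)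
  · rw [intervalIntegrable_iff_integrableOn_Ioc_of_le d.αβ.le]
    have i1 : IntegrableOn (fun r => r ^ (e + 1) * (deriv f r) ^ 2) (Ioc α β) := d.hf.i1.mono_set fun r hr => lt_trans α0 hr.1
    refine Integrable.mono' (i1.const_mul ((α ^ (e + 1))⁻¹ * (s⁻¹) ^ 2)) (hm'.pow_const 2).aestronglyMeasurable ?_
    filter_upwards [ae_restrict_mem measurableSet_Ioc] with r hr
    rw [Real.norm_eq_abs, abs_of_nonneg (sq_nonneg _), mul_pow, neg_sq]
    have h1 : 1 ≤ (α ^ (e + 1))⁻¹ * r ^ (e + 1) := by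
      rw [inv_mul_eq_div, one_le_div (by positivity)]
      exact pow_le_pow_left₀ α0.le hr.1.le _
    have h2 : (k' (h r))⁻¹ ≤ s⁻¹ := inv_anti₀ s0 (hk's _)
    have h3 : 0 ≤ (k' (h r))⁻¹ := inv_nonneg.2 (s0.le.trans (hk's _))
    calc _ ≤ (s⁻¹) ^ 2 * deriv f r ^ 2 := by gcongr
      _ = 1 * ((s⁻¹) ^ 2 * deriv f r ^ 2) := by ring
      _ ≤ ((α ^ (e + 1))⁻¹ * r ^ (e + 1)) * ((s⁻¹) ^ 2 * deriv f r ^ 2) := by gcongr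
      _ = _ := by ring

/-- primitive used in the middle identity -/
def Th (e : ℕ) (W V : ℝ → ℝ) (ε l a : ℝ) (f0 : ℝ → ℝ) (r s : ℝ) : ℝ := 
  xi W V ε l f0 s * r ^ (e + 2) / (e + 2) + ∫ t in a..s, 2 * ε * (deriv f0 t) ^ 2 * t ^ (e + 1) / (e + 2)

lemma ii2 {α β : ℝ} (hαβ : α ≤ β) {A B C h' : ℝ → ℝ} (hA : ContinuousOn A (Icc α β)) (hB : ContinuousOn B (Icc α β)) (hC : ContinuousOn C (Icc α β))
    (hm : Measurable h') (i2 : IntervalIntegrable (fun r => (h' r) ^ 2) volume α β) : 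
    IntervalIntegrable (fun r => A r + B r * h' r + C r * (h' r) ^ 2) volume α β := by
  rw [← uIcc_of_le hαβ] at hA hB hC
  have i1 : IntervalIntegrable h' volume α β := by
    have h1 : IntervalIntegrable (fun r => 1 + (h' r) ^ 2) volume α β := intervalIntegrable_const.add i2
    refine h1.mono_fun hm.aestronglyMeasurable (Eventually.of_forall fun r => ?_)
    beta_reduce
    rw [Real.norm_eq_abs, Real.norm_eq_abs, abs_of_nonneg (by positivity : 0 ≤ 1 + (h' r) ^ 2), abs_le]
    constructor <;> nlinarith [sq_nonneg (h' r + 1), sq_nonneg (h' r - 1)]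
  exact (hA.intervalIntegrable.add (i1.continuousOn_mul hB)).add (i2.continuousOn_mul hC)

lemma mid_id {ε l a b α β : ℝ} {f0 h h' : ℝ → ℝ} (hr : Reg e W V ε l f0) (a0 : 0 < a) (α0 : 0 < α) (hαβ : α ≤ β) (M : Mid f0 f h h' a b α β) : 
    IntervalIntegrable (fun r => r ^ (e + 1) * (ε * (deriv f0 (h r)) ^ 2 * (h' r - 1) ^ 2) - 2 * ε * (deriv f0 (h r)) ^ 2 * h' r * 
        (((h r) ^ (e + 2) - (e + 2) * r ^ (e + 1) * h r + (e + 1) * r ^ (e + 2)) / ((e + 2) * h r))) volume α β ∧ 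
    ∫ r in α..β, (r ^ (e + 1) * (ε * (deriv f r) ^ 2 + FF W V ε l (f r))) = Th e W V ε l a f0 β b - Th e W V ε l a f0 α a + 
      ∫ r in α..β, (r ^ (e + 1) * (ε * (deriv f0 (h r)) ^ 2 * (h' r - 1) ^ 2) - 2 * ε * (deriv f0 (h r)) ^ 2 * h' r * 
        (((h r) ^ (e + 2) - (e + 2) * r ^ (e + 1) * h r + (e + 1) * r ^ (e + 2)) / ((e + 2) * h r))) := by
  have hh0 : ∀ r ∈ Icc α β, 0 < h r := fun r hr => lt_of_lt_of_le a0 (M.mem r hr).1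
  have hc : ContinuousOn h (Icc α β) := fun r _ => (M.hd r).continuousAt.continuousWithinAt
  have qc : ContinuousOn (fun r => deriv f0 (h r)) (Icc α β) := hr.qc.comp hc fun r hr => hh0 r hr
  set B : ℝ → ℝ := fun r => ((h r) ^ (e + 2) - (e + 2) * r ^ (e + 1) * h r + (e + 1) * r ^ (e + 2)) / ((e + 2) * h r) with hB
  have Bc : ContinuousOn B (Icc α β) := by
    refine ContinuousOn.div (by fun_prop) (by fun_prop) fun r hr => ?_
    have := hh0 r hr
    positivity
  have I1 : IntervalIntegrable (fun r => r ^ (e + 1) * (ε * (deriv f0 (h r)) ^ 2 * (h' r - 1) ^ 2) - 2 * ε * (deriv f0 (h r)) ^ 2 * h' r * B r) volume α β := by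
    have := ii2 hαβ (A := fun r => r ^ (e + 1) * (ε * (deriv f0 (h r)) ^ 2)) (B := fun r => - 2 * (r ^ (e + 1) * (ε * (deriv f0 (h r)) ^ 2)) - 2 * ε * (deriv f0 (h r)) ^ 2 * B r) (C := fun r => r ^ (e + 1) * (ε * (deriv f0 (h r)) ^ 2)) (by fun_prop) (by fun_prop) (by fun_prop) M.meas M.i2
    refine this.congr (fun r _ => ?_)
    ring
  refine ⟨I1, ?_⟩
  set Θ' : ℝ → ℝ := fun r => (2 * ε * (e + 1) / h r * (deriv f0 (h r)) ^ 2 * h' r) * r ^ (e + 2) / (e + 2) + xi W V ε l f0 (h r) * r ^ (e + 1) + 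
     2 * ε * (deriv f0 (h r)) ^ 2 * (h r) ^ (e + 1) / (e + 2) * h' r with hΘ'
  have hΘ : ∀ r ∈ Icc α β, HasDerivAt (fun r => Th e W V ε l a f0 r (h r)) (Θ' r) r := by
    intro r hr'
    have h1 := (hr.der (h r) (hh0 r hr')).comp r (M.hd r)
    have h2 : HasDerivAt (fun r : ℝ => r ^ (e + 2)) ((e + 2) * r ^ (e + 1)) r := by
      have := hasDerivAt_pow (e + 2) r
      push_cast at this
      exact this
    have h3 := (h1.mul h2).div_const ((e:ℝ) + 2)
    have hcc : ContinuousOn (fun t => 2 * ε * (deriv f0 t) ^ 2 * t ^ (e + 1) / (e + 2)) (Ioi 0) := by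
      have := hr.qc
      fun_prop
    have h4 : HasDerivAt (fun s => ∫ t in a..s, 2 * ε * (deriv f0 t) ^ 2 * t ^ (e + 1) / (e + 2)) (2 * ε * (deriv f0 (h r)) ^ 2 * (h r) ^ (e + 1) / (e + 2)) (h r) := by
      refine intervalIntegral.integral_hasDerivAt_right ?_ (ContinuousOn.stronglyMeasurableAtFilter isOpen_Ioi hcc _ (hh0 r hr')) (hcc.continuousAt (Ioi_mem_nhds (hh0 r hr')))
      apply ContinuousOn.intervalIntegrable
      refine hcc.mono fun x hx => ?_
      rw [uIcc_of_le (M.mem r hr').1] at hx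
      exact lt_of_lt_of_le a0 hx.1
    have h5 := h4.comp r (M.hd r)
    refine (h3.add h5).congr_deriv ?_
    simp only [hΘ', Function.comp]
    field_simp
  have xc : ContinuousOn (xi W V ε l f0) (Ioi 0) := fun r h => (hr.der r h).continuousAt.continuousWithinAt
  have xhc : ContinuousOn (fun r => xi W V ε l f0 (h r)) (Icc α β) := xc.comp hc fun r hr => hh0 r hr
  have I2 : IntervalIntegrable Θ' volume α β := by
    have := ii2 hαβ (A := fun r => xi W V ε l f0 (h r) * r ^ (e + 1)) (B := fun r => (2 * ε * (e + 1) / h r * (deriv f0 (h r)) ^ 2) * r ^ (e + 2) / (e + 2) + 2 * ε * (deriv f0 (h r)) ^ 2 * (h r) ^ (e + 1) / (e + 2)) (C := fun r => 0) (by fun_prop) ?_ (by fun_prop) M.meas M.i2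
    · refine this.congr (fun r _ => ?_)
      simp only [hΘ']; ring
    · have : ContinuousOn (fun r => 2 * ε * ((e:ℝ) + 1) / h r) (Icc α β) := by
        refine ContinuousOn.div (by fun_prop) (by fun_prop) fun r hr => (hh0 r hr).ne'
      fun_prop
  have hF := intervalIntegral.integral_eq_sub_of_hasDerivAt (f := fun r => Th e W V ε l a f0 r (h r)) (f' := Θ') (a := α) (b := β) (fun r hr => hΘ r (by rwa [uIcc_of_le hαβ] at hr)) I2
  simp only [M.hα, M.hβ] at hF
  rw [← hF, ← intervalIntegral.integral_add I2 I1]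
  apply intervalIntegral.integral_congr
  intro r hr'
  rw [uIcc_of_le hαβ] at hr'
  have h1 := hh0 r hr'
  simp only [hΘ', hB]
  rw [M.feq r hr', M.deq r hr']
  have : FF W V ε l (f0 (h r)) = xi W V ε l f0 (h r) + ε * (deriv f0 (h r)) ^ 2 := by unfold xi; ring
  rw [this]
  field_simp
  ring

lemma csw {S : Set ℝ} (hS : MeasurableSet S) {w u v : ℝ → ℝ} (hw : ∀ r ∈ S, 0 ≤ w r) (i1 : IntegrableOn (fun r => w r * (u r) ^ 2) S)
    (i2 : IntegrableOn (fun r => w r * (v r) ^ 2) S) (i3 : IntegrableOn (fun r => w r * (u r * v r)) S) : 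
    (∫ r in S, w r * (u r * v r)) ^ 2 ≤ (∫ r in S, w r * (u r) ^ 2) * ∫ r in S, w r * (v r) ^ 2 := by
  set X := ∫ r in S, w r * (u r) ^ 2
  set Y := ∫ r in S, w r * (v r) ^ 2
  set P := ∫ r in S, w r * (u r * v r)
  have h : ∀ t : ℝ, 0 ≤ Y * (t * t) + (-2 * P) * t + X := by
    intro t
    have h1 := (lin4 i1 i2 i3 i3 1 (t ^ 2) (-2 * t) 0).2
    have h2 : 0 ≤ ∫ r in S, (1 * (w r * (u r) ^ 2) + t ^ 2 * (w r * (v r) ^ 2) + (-2 * t) * (w r * (u r * v r)) + 0 * (w r * (u r * v r))) := by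
      refine setIntegral_nonneg hS fun r hr => ?_
      have : 0 ≤ w r * (u r - t * v r) ^ 2 := mul_nonneg (hw r hr) (sq_nonneg _)
      linarith
    rw [h1] at h2
    linarith
  have := discrim_le_zero h
  unfold discrim at this
  linarith

def DD (ε : ℝ) (h' : ℝ → ℝ) (α β : ℝ) : ℝ := (∫ r in α..β, (h' r - 1) ^ 2) / ε

lemma DD_nonneg {ε α β : ℝ} {h' : ℝ → ℝ} (hε : 0 < ε) (hαβ : α ≤ β) : 0 ≤ DD ε h' α β := 
  div_nonneg (intervalIntegral.integral_nonneg hαβ fun _ _ => sq_nonneg _) hε.le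

lemma mid_sup {m R C ε l a b α β : ℝ} {f0 h h' : ℝ → ℝ} (d : Dat e W V τ c K m R C ε l f0 f a b α β) (M : Mid f0 f h h' a b α β) : 
    (∫ r in α..β, |h' r - 1|) ^ 2 ≤ 2 * C * ε ^ 2 * DD ε h' α β ∧ IntervalIntegrable (fun r => |h' r - 1|) volume α β ∧ 
    ∀ r ∈ Icc α β, |h r - r| ≤ |α - a| + ∫ r in α..β, |h' r - 1| := by
  have hε := d.ε0
  have hαβ := d.αβ.le
  have hm := M.meas
  have J1 : IntervalIntegrable (fun r => h' r - 1) volume α β := by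
    have := ii2 hαβ (A := fun _ => -1) (B := fun _ => 1) (C := fun _ => 0) (by fun_prop) (by fun_prop) (by fun_prop) M.meas M.i2
    refine this.congr (fun r _ => ?_)
    ring
  have J2 : IntervalIntegrable (fun r => (h' r - 1) ^ 2) volume α β := by
    have := ii2 hαβ (A := fun _ => 1) (B := fun _ => -2) (C := fun _ => 1) (by fun_prop) (by fun_prop) (by fun_prop) M.meas M.i2
    refine this.congr (fun r _ => ?_)
    ring
  have J3 := J1.abs
  refine ⟨?_, J3, ?_⟩
  · have h1 : DD ε h' α β * ε = ∫ r in α..β, (h' r - 1) ^ 2 := by unfold DD; field_simp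
    have h2 : β - α ≤ 2 * C * ε := by
      have a := abs_le.1 d.αC; have b := abs_le.1 d.βC; linarith [a.1, b.2]
    have D0 := DD_nonneg (h' := h') hε hαβ
    have h3 : (∫ r in α..β, |h' r - 1|) ^ 2 ≤ (∫ r in α..β, (h' r - 1) ^ 2) * (β - α) := by
      rw [intervalIntegral.integral_of_le hαβ, intervalIntegral.integral_of_le hαβ]
      rw [intervalIntegrable_iff_integrableOn_Ioc_of_le hαβ] at J2 J3
      have := csw (S := Ioc α β) (w := fun _ => 1) (u := fun r => |h' r - 1|) (v := fun _ => 1) measurableSet_Ioc (fun _ _ => zero_le_one) (by simpa using J2) (by simp) (by simpa using J3)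
      simpa [max_eq_left (sub_nonneg.2 hαβ)] using this
    calc _ ≤ _ := h3
      _ = DD ε h' α β * ε * (β - α) := by rw [h1]
      _ ≤ DD ε h' α β * ε * (2 * C * ε) := by gcongr
      _ = _ := by ring
  · intro r hr
    have s1 : Icc α r ⊆ Icc α β := Icc_subset_Icc_right hr.2
    have J1' : IntervalIntegrable (fun r => h' r - 1) volume α r := J1.mono_set (by rwa [uIcc_of_le hr.1, uIcc_of_le hαβ])
    have := intervalIntegral.integral_eq_sub_of_hasDerivAt (f := fun r => h r - r) (f' := fun r => h' r - 1) (a := α) (b := r) (fun r _ => (M.hd r).sub (hasDerivAt_id r)) J1'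
    rw [M.hα] at this
    have h2 : |∫ r in α..r, (h' r - 1)| ≤ ∫ r in α..β, |h' r - 1| := by
      refine (intervalIntegral.abs_integral_le_integral_abs hr.1).trans ?_
      rw [intervalIntegral.integral_of_le hr.1, intervalIntegral.integral_of_le hαβ]
      refine setIntegral_mono_set ?_ (Eventually.of_forall fun _ => abs_nonneg _) (Ioc_subset_Ioc_right hr.2).eventuallyLE
      exact (intervalIntegrable_iff_integrableOn_Ioc_of_le hαβ).1 J3
    have h3 : h r - r = (∫ r in α..r, (h' r - 1)) - (α - a) := by linarith
    rw [h3]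
    refine (abs_sub _ _).trans ?_
    linarith

lemma mid_energy (e : ℕ) {R C c : ℝ} (hR : 0 < R) (hC : 1 ≤ C) (hc : 0 < c) : ∃ c5 C5 ε3 : ℝ, 0 < c5 ∧ 0 < C5 ∧ 0 < ε3 ∧ ∀ (W V : ℝ → ℝ) (τ K m ε l : ℝ) (f0 f h h' : ℝ → ℝ) (a b α β : ℝ), ε < ε3 → 
    Dat e W V τ c K m R C ε l f0 f a b α β → Mid f0 f h h' a b α β → ∀ S, (∀ r ∈ Icc α β, |h r - r| ≤ S) → 
    (∫ r in a..b, r ^ (e + 1) * (ε * (deriv f0 r) ^ 2 + FF W V ε l (f0 r))) + xi W V ε l f0 b * (β ^ (e + 2) - b ^ (e + 2)) / (e + 2) 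
      - xi W V ε l f0 a * (α ^ (e + 2) - a ^ (e + 2)) / (e + 2) + c5 * DD ε h' α β - C5 * S ^ 2 ≤ 
    ∫ r in α..β, r ^ (e + 1) * (ε * (deriv f r) ^ 2 + FF W V ε l (f r)) := by
  obtain ⟨Cn, hCn, hpe⟩ := pow_expand (e + 2)
  set C4 := Cn * (2 * R) ^ e / R with hC4
  have hC40 : 0 ≤ C4 := by positivity
  refine ⟨(R / 2) ^ (e + 1) * (c / 2), 4 * C * C * C4 + 1, R / (4 * C), by positivity, by positivity, by positivity, ?_⟩
  intro W V τ K m ε l f0 f h h' a b α β hε3 d M S hS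
  have hε := d.ε0
  have hαβ := d.αβ.le
  have a0 : 0 < a := by linarith [d.aR]
  have α0 : 0 < α := by linarith [d.αR]
  have hSab := fun r hr => (sq_le_sq' (by linarith [neg_abs_le (h r - r), hS r hr]) ((le_abs_self _).trans (hS r hr)) : (h r - r) ^ 2 ≤ S ^ 2)
  obtain ⟨I1, id1⟩ := mid_id d.reg a0 α0 hαβ M
  have M0 : Mid f0 f0 (fun r => r) (fun _ => 1) a b a b := by
    refine ⟨fun r => hasDerivAt_id r, rfl, rfl, fun r hr => hr, fun r hr => rfl, fun r hr => by simp, fun r hr => zero_le_one, measurable_const, ?_⟩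
    simp
  obtain ⟨-, id0⟩ := mid_id d.reg a0 a0 d.ab.le M0
  have z0 : ∫ r in a..b, (r ^ (e + 1) * (ε * (deriv f0 r) ^ 2 * ((1:ℝ) - 1) ^ 2) - 2 * ε * (deriv f0 r) ^ 2 * 1 * 
        ((r ^ (e + 2) - (e + 2) * r ^ (e + 1) * r + (e + 1) * r ^ (e + 2)) / ((e + 2) * r))) = 0 := by
    have : ∀ r : ℝ, (r ^ (e + 1) * (ε * (deriv f0 r) ^ 2 * ((1:ℝ) - 1) ^ 2) - 2 * ε * (deriv f0 r) ^ 2 * 1 * 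
        ((r ^ (e + 2) - (e + 2) * r ^ (e + 1) * r + (e + 1) * r ^ (e + 2)) / ((e + 2) * r))) = 0 := by
      intro r
      have : r ^ (e + 2) - (e + 2) * r ^ (e + 1) * r + (e + 1) * r ^ (e + 2) = 0 := by ring
      rw [this]; ring
    simp only [this, intervalIntegral.integral_zero]
  rw [z0] at id0
  rw [id0, id1]
  have hth : Th e W V ε l a f0 β b - Th e W V ε l a f0 α a = (Th e W V ε l a f0 b b - Th e W V ε l a f0 a a) + xi W V ε l f0 b * (β ^ (e + 2) - b ^ (e + 2)) / (e + 2) - xi W V ε l f0 a * (α ^ (e + 2) - a ^ (e + 2)) / (e + 2) := by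
    unfold Th; ring
  rw [hth]
  have hBb : ∀ r ∈ Icc α β, |((h r) ^ (e + 2) - (e + 2) * r ^ (e + 1) * h r + (e + 1) * r ^ (e + 2)) / ((e + 2) * h r)| ≤ C4 * S ^ 2 := by
    intro r hr
    have r0 : 0 < r := α0.trans_le hr.1
    have hh := M.mem r hr
    have h0 : R / 2 ≤ h r := d.aR.trans hh.1
    have hr2 : r ≤ 2 * R := hr.2.trans d.βR
    set x := (h r - r) / r with hx
    have hhx : h r = r * (1 + x) := by rw [hx]; field_simp; ring
    have hx1 : |x| ≤ 1 := by
      rw [hx, abs_div, abs_of_pos r0, div_le_one r0]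
      have a1 := abs_le.1 d.αC
      have a2 := abs_le.1 d.βC
      have a3 := abs_le.1 d.aC
      have a4 := abs_le.1 d.bC
      have h5 : C * ε ≤ R / 4 := by
        rw [lt_div_iff₀ (by positivity)] at hε3; linarith
      have h6 : R / 2 ≤ r := d.αR.trans hr.1
      rw [abs_le]; constructor <;> linarith [hr.1, hr.2, hh.1, hh.2, a1.1, a1.2, a2.1, a2.2, a3.1, a3.2, a4.1, a4.2]
    have h7 := hpe x hx1
    push_cast at h7
    have h8 : (h r) ^ (e + 2) - (e + 2) * r ^ (e + 1) * h r + (e + 1) * r ^ (e + 2) = r ^ (e + 2) * ((1 + x) ^ (e + 2) - 1 - (e + 2) * x) := by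
      rw [hhx, mul_pow]; ring
    have h9 : r ^ (e + 2) * x ^ 2 = r ^ e * (h r - r) ^ 2 := by rw [hx, div_pow, pow_add]; field_simp
    have h10 : R ≤ (e + 2) * h r := by
      have : (0:ℝ) ≤ e := by positivity
      nlinarith
    rw [abs_div, abs_of_pos (by linarith : 0 < ((e:ℝ) + 2) * h r), div_le_iff₀ (by linarith), h8, abs_mul, abs_of_pos (by positivity)]
    calc _ ≤ r ^ (e + 2) * (Cn * x ^ 2) := by gcongr
      _ = Cn * (r ^ e * (h r - r) ^ 2) := by rw [← h9]; ring
      _ ≤ Cn * ((2 * R) ^ e * S ^ 2) := mul_le_mul_of_nonneg_left (mul_le_mul (pow_le_pow_left₀ r0.le hr2 _) (hSab r hr) (sq_nonneg _) (by positivity)) hCn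
      _ = C4 * S ^ 2 * R := by rw [hC4]; field_simp
      _ ≤ _ := by gcongr
  set k1 := (R / 2) ^ (e + 1) * (c / (2 * ε)) with hk1
  set k2 := 2 * (C / ε) * (C4 * S ^ 2) with hk2
  have hI : k1 * (∫ r in α..β, (h' r - 1) ^ 2) - k2 * (b - a) ≤ ∫ r in α..β, (r ^ (e + 1) * (ε * (deriv f0 (h r)) ^ 2 * (h' r - 1) ^ 2) - 2 * ε * (deriv f0 (h r)) ^ 2 * h' r * 
        (((h r) ^ (e + 2) - (e + 2) * r ^ (e + 1) * h r + (e + 1) * r ^ (e + 2)) / ((e + 2) * h r))) := by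
    have J2 : IntervalIntegrable (fun r => (h' r - 1) ^ 2) volume α β := by
      have := ii2 hαβ (A := fun _ => 1) (B := fun _ => -2) (C := fun _ => 1) (by fun_prop) (by fun_prop) (by fun_prop) M.meas M.i2
      refine this.congr (fun r _ => ?_)
      ring
    have J1 : IntervalIntegrable h' volume α β := by
      have := ii2 hαβ (A := fun _ => 0) (B := fun _ => 1) (C := fun _ => 0) (by fun_prop) (by fun_prop) (by fun_prop) M.meas M.i2
      refine this.congr (fun r _ => ?_)
      ring
    have hh' : ∫ r in α..β, h' r = b - a := by
      rw [intervalIntegral.integral_eq_sub_of_hasDerivAt (fun r _ => M.hd r) J1, M.hα, M.hβ]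
    rw [← hh', ← intervalIntegral.integral_const_mul, ← intervalIntegral.integral_const_mul, ← intervalIntegral.integral_sub (J2.const_mul _) (J1.const_mul _)]
    refine intervalIntegral.integral_mono_on hαβ ((J2.const_mul _).sub (J1.const_mul _)) I1 fun r hr => ?_
    have r1 : R / 2 ≤ r := d.αR.trans hr.1
    have r2 : 0 < r := by linarith
    have q1 := d.qlo (h r) (M.mem r hr)
    have q2 := d.qhi (h r) (M.mem r hr)
    have q3 : c / (2 * ε) ≤ ε * (deriv f0 (h r)) ^ 2 := by
      rw [div_le_iff₀ (by positivity)]; linarith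
    have q4 : ε * (deriv f0 (h r)) ^ 2 ≤ C / ε := by
      rw [le_div_iff₀ hε]; linarith
    have e1 : k1 * (h' r - 1) ^ 2 ≤ r ^ (e + 1) * (ε * (deriv f0 (h r)) ^ 2 * (h' r - 1) ^ 2) := by
      rw [← mul_assoc]; unfold k1; gcongr
    have n := M.nn r hr
    have b := hBb r hr
    set B := ((h r) ^ (e + 2) - (e + 2) * r ^ (e + 1) * h r + (e + 1) * r ^ (e + 2)) / ((e + 2) * h r)
    have e2 : 2 * ε * (deriv f0 (h r)) ^ 2 * h' r * B ≤ k2 * h' r := by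
      calc _ = 2 * (ε * (deriv f0 (h r)) ^ 2) * h' r * B := by ring
        _ ≤ 2 * (ε * (deriv f0 (h r)) ^ 2) * h' r * (C4 * S ^ 2) := by
          refine mul_le_mul_of_nonneg_left ((le_abs_self _).trans b) (by positivity)
        _ ≤ 2 * (C / ε) * h' r * (C4 * S ^ 2) := by gcongr
        _ = _ := by rw [hk2]; ring
    linarith
  have e1 : k1 * (∫ r in α..β, (h' r - 1) ^ 2) = (R / 2) ^ (e + 1) * (c / 2) * DD ε h' α β := by
    rw [hk1, DD]; field_simp
  have e2 : k2 * (b - a) ≤ (4 * C * C * C4 + 1) * S ^ 2 := by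
    have h2 : b - a ≤ 2 * C * ε := by
      have a := abs_le.1 d.aC; have b := abs_le.1 d.bC; linarith [a.1, b.2]
    calc _ ≤ k2 * (2 * C * ε) := by gcongr
      _ = 4 * C * C * C4 * S ^ 2 := by rw [hk2]; field_simp; ring
      _ ≤ _ := by nlinarith [sq_nonneg S]
  linarith

end S15

namespace S15
open Topology
variable {W V : ℝ → ℝ} {τ c K : ℝ} {e : ℕ} {f g : ℝ → ℝ}

lemma split3 {F : ℝ → ℝ} (hF : IntegrableOn F (Ioi 0)) {α β : ℝ} (hα : 0 < α) (hαβ : α ≤ β) : 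
    ∫ r in Ioi 0, F r = (∫ r in Ioc 0 α, F r) + (∫ r in α..β, F r) + ∫ r in Ioi β, F r := by
  have h1 : Ioi (0:ℝ) = Ioc 0 α ∪ Ioi α := (Ioc_union_Ioi_eq_Ioi hα.le).symm
  have h2 : Ioi α = Ioc α β ∪ Ioi β := (Ioc_union_Ioi_eq_Ioi hαβ).symm
  have i1 : IntegrableOn F (Ioi α) := hF.mono_set (Ioi_subset_Ioi hα.le)
  rw [intervalIntegral.integral_of_le hαβ]
  have e1 : ∫ r in Ioi 0, F r = (∫ r in Ioc 0 α, F r) + ∫ r in Ioi α, F r := by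
    conv_lhs => rw [h1]
    exact setIntegral_union (Set.disjoint_left.2 fun x hx hx2 => not_lt.2 hx.2 hx2) measurableSet_Ioi (hF.mono_set Ioc_subset_Ioi_self) i1
  have e2 : ∫ r in Ioi α, F r = (∫ r in Ioc α β, F r) + ∫ r in Ioi β, F r := by
    conv_lhs => rw [h2]
    exact setIntegral_union (Set.disjoint_left.2 fun x hx hx2 => not_lt.2 hx.2 hx2) measurableSet_Ioi (i1.mono_set Ioc_subset_Ioi_self) (i1.mono_set (Ioi_subset_Ioi hαβ))
  rw [e1, e2]; ring

lemma split3_le {F : ℝ → ℝ} (hF : IntegrableOn F (Ioi 0)) {α β : ℝ} (hα : 0 < α) (hαβ : α ≤ β) : 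
    IntegrableOn F (Ioc 0 α) ∧ IntervalIntegrable F volume α β ∧ IntegrableOn F (Ioi β) := by
  refine ⟨hF.mono_set Ioc_subset_Ioi_self, ?_, hF.mono_set (Ioi_subset_Ioi (hα.le.trans hαβ))⟩
  rw [intervalIntegrable_iff_integrableOn_Ioc_of_le hαβ]
  exact hF.mono_set fun r hr => lt_trans hα hr.1

lemma LL_split (hP : Pot W V τ c K) {ε l : ℝ} (hf : Prof e f) {α β : ℝ} (hα : 0 < α) (hαβ : α ≤ β) : 
    LL e W V ε l f = (ε * SG e f (Ioc 0 α) + SP e (FF W V ε l) f (Ioc 0 α)) + (∫ r in α..β, r ^ (e + 1) * (ε * (deriv f r) ^ 2 + FF W V ε l (f r))) + 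
      (ε * SG e f (Ioi β) + SP e (FF W V ε l) f (Ioi β)) := by
  have iF := hf.intF (ε := ε) (l := l) hP
  rw [LL_eq hP hf, GG, PP, split3 hf.i1 hα hαβ, split3 iF hα hαβ]
  have h1 := (split3_le hf.i1 hα hαβ).2.1
  have h2 := (split3_le iF hα hαβ).2.1
  have : ∫ r in α..β, r ^ (e + 1) * (ε * (deriv f r) ^ 2 + FF W V ε l (f r)) = ε * (∫ r in α..β, r ^ (e + 1) * (deriv f r) ^ 2) + ∫ r in α..β, r ^ (e + 1) * FF W V ε l (f r) := by
    rw [← intervalIntegral.integral_const_mul, ← intervalIntegral.integral_add (h1.const_mul ε) h2]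
    congr 1; ext r; ring
  rw [this]
  unfold SG SP
  ring

/-- total defect -/
def TQ (e : ℕ) (c ε : ℝ) (f0 f h' : ℝ → ℝ) (a b α β : ℝ) : ℝ := 
  QQ e c ε f0 (fun r => f (α / a * r)) (Ioc 0 a) + QQ e c ε f0 (fun r => f (β / b * r)) (Ioi b) + DD ε h' α β

lemma TQ_parts {m R C ε l a b α β : ℝ} {f0 h' : ℝ → ℝ} (d : Dat e W V τ c K m R C ε l f0 f a b α β) : 
    0 ≤ QQ e c ε f0 (fun r => f (α / a * r)) (Ioc 0 a) ∧ 0 ≤ QQ e c ε f0 (fun r => f (β / b * r)) (Ioi b) ∧ 0 ≤ DD ε h' α β := by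
  have hε := d.ε0
  have b0 : 0 < b := by linarith [d.aR, d.R0, d.ab]
  exact ⟨(QQ_parts hε d.hP.c0 measurableSet_Ioc fun r hr => hr.1.le).1, (QQ_parts hε d.hP.c0 measurableSet_Ioi fun r hr => (b0.trans hr).le).1, DD_nonneg hε d.αβ.le⟩

lemma energy_comb (e : ℕ) {R C c : ℝ} (hR : 0 < R) (hC : 1 ≤ C) (hc : 0 < c) : ∃ c7 C7 ε4 : ℝ, 0 < c7 ∧ 0 < C7 ∧ 0 < ε4 ∧ ∀ (W V : ℝ → ℝ) (τ K m ε l : ℝ) (f0 f h h' : ℝ → ℝ) (a b α β : ℝ), ε < ε4 → 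
    Dat e W V τ c K m R C ε l f0 f a b α β → Mid f0 f h h' a b α β → 
    c7 * TQ e c ε f0 f h' a b α β - C7 * (α - a) ^ 2 ≤ EE e W ε f - EE e W ε f0 := by
  obtain ⟨D, ε2, hD, hε2, hside⟩ := side e hR hC
  obtain ⟨c5, C5, ε3, hc5, hC5, hε3, hmid⟩ := mid_energy e hR hC hc
  set c7 := min (1 / 2) (c5 / 2) with hc7
  have hc70 : 0 < c7 := by positivity
  have c71 : c7 ≤ 1 / 2 := min_le_left _ _
  have c72 : c7 ≤ c5 / 2 := min_le_right _ _
  refine ⟨c7, D + 2 * (D + C5), min (min ε2 ε3) (min 1 (c5 / (8 * (D + C5) * C))), hc70, by positivity, by positivity, ?_⟩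
  intro W V τ K m ε l f0 f h h' a b α β hε4 d M
  simp only [lt_min_iff] at hε4
  obtain ⟨⟨e2, e3⟩, e1, e4⟩ := hε4
  have hε := d.ε0
  have a0 : 0 < a := by linarith [d.aR]
  have α0 : 0 < α := by linarith [d.αR]
  obtain ⟨s1, s2⟩ := hside W V τ c K m ε l f0 f a b α β e2 d
  obtain ⟨j1, j2, j3⟩ := mid_sup d M
  set J := ∫ r in α..β, |h' r - 1| with hJ
  have hm := hmid W V τ K m ε l f0 f h h' a b α β e3 d M _ j3
  obtain ⟨q1, q2, q3⟩ := TQ_parts (h' := h') d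
  have hL : EE e W ε f - EE e W ε f0 = LL e W V ε l f - LL e W V ε l f0 := by
    unfold LL; rw [d.mass, d.h0.mass]; ring
  rw [hL, LL_split d.hP d.hf α0 d.αβ.le, LL_split d.hP d.h0.prof a0 d.ab.le]
  have hb : (β - b) ^ 2 ≤ (|α - a| + J) ^ 2 := by
    have := j3 β (right_mem_Icc.2 d.αβ.le)
    rw [M.hβ, abs_sub_comm] at this
    rw [← sq_abs (β - b)]
    gcongr
  have hS : (|α - a| + J) ^ 2 ≤ 2 * (α - a) ^ 2 + 2 * J ^ 2 := by
    rw [← sq_abs (α - a)]; nlinarith [sq_nonneg (|α - a| - J)]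
  unfold TQ
  set Q1 := QQ e c ε f0 (fun r => f (α / a * r)) (Ioc 0 a)
  set Q2 := QQ e c ε f0 (fun r => f (β / b * r)) (Ioi b)
  set D1 := DD ε h' α β
  have k1 : D * (β - b) ^ 2 + C5 * (|α - a| + J) ^ 2 ≤ (D + C5) * (2 * (α - a) ^ 2 + 2 * J ^ 2) := by
    calc _ ≤ D * (|α - a| + J) ^ 2 + C5 * (|α - a| + J) ^ 2 := by gcongr
      _ = (D + C5) * (|α - a| + J) ^ 2 := by ring
      _ ≤ _ := by gcongr
  have k2 : (D + C5) * (2 * J ^ 2) ≤ c5 / 2 * D1 := by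
    have : ε * (8 * (D + C5) * C) ≤ c5 := by
      rw [lt_div_iff₀ (by positivity)] at e4; exact e4.le
    have e22 : ε ^ 2 ≤ ε := by nlinarith
    calc _ ≤ (D + C5) * (2 * (2 * C * ε ^ 2 * D1)) := by gcongr
      _ ≤ (D + C5) * (2 * (2 * C * ε * D1)) := by gcongr
      _ = (ε * (8 * (D + C5) * C)) / 2 * D1 := by ring
      _ ≤ _ := by gcongr
  have k3 : c7 * (Q1 + Q2 + D1) ≤ Q1 / 2 + Q2 / 2 + c5 / 2 * D1 := by
    have a1 : c7 * Q1 ≤ 1 / 2 * Q1 := by gcongr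
    have a2 : c7 * Q2 ≤ 1 / 2 * Q2 := by gcongr
    have a3 : c7 * D1 ≤ c5 / 2 * D1 := by gcongr
    linarith
  linarith

lemma SPw_le {R : ℝ} {a : ℝ} (a0 : 0 < a) (haR : a ≤ 2 * R) : (∫ r in Ioc 0 a, r ^ (e + 1) * (1:ℝ) ^ 2) ≤ (2 * R) ^ (e + 2) := by
  have h : (∫ r in Ioc 0 a, r ^ (e + 1) * (1:ℝ) ^ 2) = a ^ (e + 2) / (e + 2) := by
    simp only [one_pow, mul_one]
    exact int_pow a a0.le
  rw [h, div_le_iff₀ (by positivity)]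
  have h2 : a ^ (e + 2) ≤ (2 * R) ^ (e + 2) := by gcongr
  have : 0 ≤ (2 * R) ^ (e + 2) := (by positivity : 0 ≤ a ^ (e + 2)).trans h2
  have he : (0:ℝ) ≤ e := by positivity
  nlinarith

/-- the profile errors -/
lemma errs (e : ℕ) {R C c K : ℝ} (hR : 0 < R) (hC : 1 ≤ C) (hc : 0 < c) (hK : 1 ≤ K) : ∃ C9 : ℝ, 0 < C9 ∧ ∀ (W V : ℝ → ℝ) (τ m ε l : ℝ) (f0 f h' : ℝ → ℝ) (a b α β : ℝ), 
    Dat e W V τ c K m R C ε l f0 f a b α β → 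
    (∫ r in Ioc 0 a, r ^ (e + 1) * |V (f (α / a * r)) - V (f0 r)|) ≤ C9 * √(ε * TQ e c ε f0 f h' a b α β) ∧ 
    (∫ r in Ioi b, r ^ (e + 1) * |V (f (β / b * r)) - V (f0 r)|) ≤ C9 * (√(ε * TQ e c ε f0 f h' a b α β) + ε * TQ e c ε f0 f h' a b α β) := by
  set A1 := 2 / c * (2 * R) ^ (e + 2) with hA1
  set A2 := (C / c) * (2 / c) with hA2
  have hA10 : 0 < A1 := by positivity
  have hA20 : 0 < A2 := by positivity
  refine ⟨2 * K * √A1 + 2 * K * √A2 + K * (2 / c), by positivity, ?_⟩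
  intro W V τ m ε l f0 f h' a b α β d
  have hε := d.ε0
  have a0 : 0 < a := by linarith [d.aR]
  have α0 : 0 < α := by linarith [d.αR]
  have b0 : 0 < b := a0.trans d.ab
  have β0 : 0 < β := α0.trans d.αβ
  obtain ⟨q1, q2, q3⟩ := TQ_parts (h' := h') d
  have hQ1 : QQ e c ε f0 (fun r => f (α / a * r)) (Ioc 0 a) ≤ TQ e c ε f0 f h' a b α β := by unfold TQ; linarith
  have hQ2 : QQ e c ε f0 (fun r => f (β / b * r)) (Ioi b) ≤ TQ e c ε f0 f h' a b α β := by unfold TQ; linarith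
  set Q := TQ e c ε f0 f h' a b α β with hQd
  have hQ0 : 0 ≤ Q := q1.trans hQ1
  have hgen : ∀ κ > 0, ∀ S : Set ℝ, MeasurableSet S → S ⊆ Ioi 0 → QQ e c ε f0 (fun r => f (κ * r)) S ≤ Q → 
      IntegrableOn (fun r => r ^ (e + 1) * |f (κ * r) - f0 r| ^ 2) S ∧ (∫ r in S, r ^ (e + 1) * |f (κ * r) - f0 r| ^ 2) ≤ 2 * ε / c * Q ∧ 
      IntegrableOn (fun r => r ^ (e + 1) * |V (f (κ * r)) - V (f0 r)|) S := by
    intro κ hκ S hS hS0 hq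
    have hg := d.hf.scale hκ
    have hS0' : S ⊆ Ici 0 := hS0.trans Ioi_subset_Ici_self
    have i := int_sub_sq hS hS0' hg.diff.continuous.measurable d.h0.prof.diff.continuous.measurable (hg.i0.mono_set hS0) (d.h0.prof.i0.mono_set hS0)
    simp only [sq_abs]
    refine ⟨i, ?_, ?_⟩
    · refine (QQ_parts hε hc hS hS0' (f0 := f0) (g := fun r => f (κ * r))).2.2.trans ?_
      gcongr
    · have i1 := (hg.intU d.hP.qlV).mono_set hS0
      have i2 := (d.h0.prof.intU d.hP.qlV).mono_set hS0
      refine IntegrableOn.congr_fun (i1.sub i2).abs (fun r hr => ?_) hS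
      have : (0:ℝ) < r := hS0 hr
      rw [Pi.sub_apply, ← mul_sub, abs_mul, abs_of_pos (by positivity)]
  have sqQ : √(ε * Q) ^ 2 = ε * Q := Real.sq_sqrt (by positivity)
  set y := √(ε * Q) with hy
  have y0 : 0 ≤ y := Real.sqrt_nonneg _
  constructor
  · obtain ⟨i1, i2, i3⟩ := hgen (α / a) (by positivity) (Ioc 0 a) measurableSet_Ioc Ioc_subset_Ioi_self hQ1
    have hg := d.hf.scale (show 0 < α / a by positivity)
    set g := fun r => f (α / a * r) with hgd
    have m1 : Measurable fun r => |g r - f0 r| := by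
      have h1 := hg.diff.continuous
      have h2 := d.h0.prof.diff.continuous
      exact (h1.sub h2).abs.measurable
    have iw : IntegrableOn (fun r : ℝ => r ^ (e + 1) * (1:ℝ) ^ 2) (Ioc 0 a) := 
      ((by fun_prop : ContinuousOn (fun r : ℝ => r ^ (e + 1) * (1:ℝ) ^ 2) (Icc 0 a)).integrableOn_compact isCompact_Icc).mono_set Ioc_subset_Icc_self
    have ip := int_prod (e := e) measurableSet_Ioc (fun r hr => hr.1.le) m1 (measurable_const (a := (1:ℝ))) i1 iw
    have cs := csw measurableSet_Ioc (w := fun r => r ^ (e + 1)) (u := fun r => |g r - f0 r|) (v := fun _ => 1) (fun r hr => by have := hr.1; positivity) i1 iw ip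
    set X := ∫ r in Ioc 0 a, r ^ (e + 1) * (|g r - f0 r| * 1) with hX
    have hX2 : X ^ 2 ≤ (√A1 * y) ^ 2 := by
      rw [mul_pow, sqQ, Real.sq_sqrt hA10.le]
      calc _ ≤ _ := cs
        _ ≤ (2 * ε / c * Q) * (2 * R) ^ (e + 2) := by
          refine mul_le_mul i2 (SPw_le a0 (by linarith [d.ab, d.bR])) ?_ (by positivity)
          exact setIntegral_nonneg measurableSet_Ioc fun r hr => by have := hr.1; positivity
        _ = _ := by rw [hA1]; ring
    have hX3 : X ≤ √A1 * y := (le_abs_self _).trans (abs_le_of_sq_le_sq hX2 (by positivity))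
    have h1 : (∫ r in Ioc 0 a, r ^ (e + 1) * |V (g r) - V (f0 r)|) ≤ 2 * K * X := by
      rw [hX, ← integral_const_mul]
      refine setIntegral_mono_on i3 (ip.const_mul _) measurableSet_Ioc fun r hr => ?_
      have r0 : 0 < r := hr.1
      have hv := d.hP.Vlip (g r) (hg.mem r) (f0 r) (d.h0.prof.mem r)
      have g1 := (hg.mem r).2
      have g2 := (d.h0.prof.mem r).2
      calc _ ≤ r ^ (e + 1) * (K * |g r - f0 r| * (g r + f0 r)) := by gcongr
        _ ≤ r ^ (e + 1) * (K * |g r - f0 r| * 2) := by gcongr; linarith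
        _ = _ := by ring
    calc _ ≤ 2 * K * X := h1
      _ ≤ 2 * K * (√A1 * y) := by gcongr
      _ ≤ _ := by
        have : 0 ≤ (2 * K * √A2 + K * (2 / c)) * y := by positivity
        linarith
  · obtain ⟨i1, i2, i3⟩ := hgen (β / b) (by positivity) (Ioi b) measurableSet_Ioi (Ioi_subset_Ioi b0.le) hQ2
    have hg := d.hf.scale (show 0 < β / b by positivity)
    set g := fun r => f (β / b * r) with hgd
    have m1 : Measurable fun r => |g r - f0 r| := by
      have h1 := hg.diff.continuous
      have h2 := d.h0.prof.diff.continuous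
      exact (h1.sub h2).abs.measurable
    have iw := d.h0.prof.i0.mono_set (Ioi_subset_Ioi b0.le)
    have ip := int_prod (e := e) measurableSet_Ioi (fun r hr => (b0.trans hr).le) m1 d.h0.prof.diff.continuous.measurable i1 iw
    have cs := csw measurableSet_Ioi (w := fun r => r ^ (e + 1)) (u := fun r => |g r - f0 r|) (v := f0) (fun r hr => by have := b0.trans hr; positivity) i1 iw ip
    have hf2 : (∫ r in Ioi b, r ^ (e + 1) * (f0 r) ^ 2) ≤ C * ε / c := by
      rw [le_div_iff₀ hc, mul_comm, ← integral_const_mul]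
      refine le_trans ?_ d.eP
      have iW := d.h0.prof.intU d.hP.qlW
      calc _ ≤ ∫ r in Ioi b, r ^ (e + 1) * W (f0 r) := by
            refine setIntegral_mono_on (iw.const_mul _) (iW.mono_set (Ioi_subset_Ioi b0.le)) measurableSet_Ioi fun r hr => ?_
            have r0 := b0.trans hr
            have h3 := d.h0.anti (mem_Ici.2 b0.le) (mem_Ici.2 r0.le) (le_of_lt hr)
            rw [d.fb] at h3
            have := d.hP.Wlow (f0 r) ⟨(d.h0.prof.mem r).1, h3⟩
            calc _ = r ^ (e + 1) * (c * f0 r ^ 2) := by ring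
              _ ≤ _ := by gcongr
        _ ≤ _ := by
            refine setIntegral_mono_set iW ?_ (Ioi_subset_Ioi b0.le).eventuallyLE
            filter_upwards [ae_restrict_mem measurableSet_Ioi] with r hr
            have r0 : (0:ℝ) < r := hr
            exact mul_nonneg (by positivity) (d.hP.Wnn _ (d.h0.prof.mem r))
    set X := ∫ r in Ioi b, r ^ (e + 1) * (|g r - f0 r| * f0 r) with hX
    have hX2 : X ^ 2 ≤ (√A2 * y) ^ 2 := by
      rw [mul_pow, sqQ, Real.sq_sqrt hA20.le]
      calc _ ≤ _ := cs
        _ ≤ (2 * ε / c * Q) * (C * ε / c) := by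
          refine mul_le_mul i2 hf2 ?_ (by positivity)
          exact setIntegral_nonneg measurableSet_Ioi fun r hr => by have := b0.trans hr; positivity
        _ = A2 * (ε * Q) * ε := by rw [hA2]; ring
        _ ≤ A2 * (ε * Q) * 1 := by gcongr; exact d.ε1
        _ = _ := by ring
    have hX3 : X ≤ √A2 * y := (le_abs_self _).trans (abs_le_of_sq_le_sq hX2 (by positivity))
    have h1 : (∫ r in Ioi b, r ^ (e + 1) * |V (g r) - V (f0 r)|) ≤ 2 * K * X + K * ∫ r in Ioi b, r ^ (e + 1) * |g r - f0 r| ^ 2 := by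
      have l4 := lin4 ip i1 i1 i1 (2 * K) K 0 0
      have : 2 * K * X + K * (∫ r in Ioi b, r ^ (e + 1) * |g r - f0 r| ^ 2) = _ := (by rw [hX]; ring : _ = _ + _ + 0 * (∫ r in Ioi b, r ^ (e + 1) * |g r - f0 r| ^ 2) + 0 * _).trans l4.2.symm
      rw [this]
      refine setIntegral_mono_on i3 l4.1 measurableSet_Ioi fun r hr => ?_
      have r0 : 0 < r := b0.trans hr
      have hv := d.hP.Vlip (g r) (hg.mem r) (f0 r) (d.h0.prof.mem r)
      have g1 : g r ≤ f0 r + |g r - f0 r| := by linarith [le_abs_self (g r - f0 r)]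
      calc _ ≤ r ^ (e + 1) * (K * |g r - f0 r| * (g r + f0 r)) := by gcongr
        _ ≤ r ^ (e + 1) * (K * |g r - f0 r| * (2 * f0 r + |g r - f0 r|)) := 
          mul_le_mul_of_nonneg_left (mul_le_mul_of_nonneg_left (by linarith) (mul_nonneg (by linarith) (abs_nonneg _))) (by positivity)
        _ = _ := by ring
    calc _ ≤ _ := h1
      _ ≤ 2 * K * (√A2 * y) + K * (2 * ε / c * Q) := by gcongr
      _ = (2 * K * √A2) * y + (K * (2 / c)) * (ε * Q) := by ring
      _ ≤ (2 * K * √A1 + 2 * K * √A2 + K * (2 / c)) * y + (2 * K * √A1 + 2 * K * √A2 + K * (2 / c)) * (ε * Q) := by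
        have z1 : 0 ≤ 2 * K * √A1 := by positivity
        have z2 : 0 ≤ 2 * K * √A2 := by positivity
        have z3 : 0 ≤ K * (2 / c) := by positivity
        gcongr <;> linarith
      _ = _ := by ring

end S15

namespace S15
open Topology
variable {W V : ℝ → ℝ} {τ c K : ℝ} {e : ℕ} {f g : ℝ → ℝ}

lemma pow_lip (k : ℕ) {x y T : ℝ} (hx : 0 ≤ x) (hxT : x ≤ T) (hy : 0 ≤ y) (hyT : y ≤ T) : 
    |x ^ (k + 1) - y ^ (k + 1)| ≤ (k + 1) * T ^ k * |x - y| := by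
  have h := abs_pow_sub_pow_le x y (k + 1)
  have h2 : max |x| |y| ≤ T := by rw [abs_of_nonneg hx, abs_of_nonneg hy]; exact max_le hxT hyT
  have h3 : max |x| |y| ^ (k + 1 - 1) ≤ T ^ k := by
    rw [Nat.add_sub_cancel]
    exact pow_le_pow_left₀ (le_max_of_le_left (abs_nonneg _)) h2 _
  calc _ ≤ _ := h
    _ ≤ |x - y| * ((k + 1 : ℕ) : ℝ) * T ^ k := by gcongr
    _ = _ := by push_cast; ring

lemma mid_mass {m R C ε l a b α β : ℝ} {f0 h h' : ℝ → ℝ} (d : Dat e W V τ c K m R C ε l f0 f a b α β) (M : Mid f0 f h h' a b α β) : 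
    |(∫ r in α..β, r ^ (e + 1) * V (f r)) - ∫ r in a..b, r ^ (e + 1) * V (f0 r)| ≤ 
      2 * C * ε * ((e + 1) * (2 * R) ^ e * (|α - a| + ∫ r in α..β, |h' r - 1|)) + (2 * R) ^ (e + 1) * ∫ r in α..β, |h' r - 1| := by
  have hε := d.ε0
  have hR := d.R0
  have a0 : 0 < a := by linarith [d.aR]
  have α0 : 0 < α := by linarith [d.αR]
  have hc : Continuous h := continuous_iff_continuousAt.2 fun r => (M.hd r).continuousAt
  have vc : Continuous fun r => V (f0 r) := d.hP.qlV.comp d.h0.prof.diff.continuous d.h0.prof.mem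
  obtain ⟨-, j2, j3⟩ := mid_sup d M
  set J := ∫ r in α..β, |h' r - 1| with hJ
  set S := |α - a| + J with hS
  set F : ℝ → ℝ := fun r => r ^ (e + 1) * V (f0 r) with hF
  have Fc : Continuous F := (continuous_pow _).mul vc
  have iB : IntervalIntegrable (fun r => F (h r) * h' r) volume α β := by
    have := ii2 d.αβ.le (A := fun _ => 0) (B := fun r => F (h r)) (C := fun _ => 0) continuousOn_const (by fun_prop) continuousOn_const M.meas M.i2
    exact this.congr fun r _ => by ring
  have e1 : ∫ r in a..b, F r = ∫ r in α..β, F (h r) * h' r := by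
    have hd : ∀ r ∈ uIcc α β, HasDerivAt (fun r => ∫ t in a..h r, F t) (F (h r) * h' r) r := fun r _ => 
      (intervalIntegral.integral_hasDerivAt_right (Fc.intervalIntegrable _ _) (Fc.stronglyMeasurableAtFilter _ _) Fc.continuousAt).comp r (M.hd r)
    rw [intervalIntegral.integral_eq_sub_of_hasDerivAt hd iB, M.hα, M.hβ]
    simp
  have iA : IntervalIntegrable (fun r => r ^ (e + 1) * V (f r)) volume α β := (split3_le (d.hf.intU d.hP.qlV) α0 d.αβ.le).2.1
  rw [e1, ← intervalIntegral.integral_sub iA iB]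
  have iC : IntervalIntegrable (fun r => (e + 1) * (2 * R) ^ e * S + (2 * R) ^ (e + 1) * |h' r - 1|) volume α β := 
    intervalIntegrable_const.add (j2.const_mul _)
  have k1 : |∫ r in α..β, (r ^ (e + 1) * V (f r) - F (h r) * h' r)| ≤ ∫ r in α..β, ((e + 1) * (2 * R) ^ e * S + (2 * R) ^ (e + 1) * |h' r - 1|) := by
    refine (intervalIntegral.abs_integral_le_integral_abs d.αβ.le).trans ?_
    refine intervalIntegral.integral_mono_on d.αβ.le (iA.sub iB).abs iC fun r hr => ?_
    have r0 : 0 < r := α0.trans_le hr.1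
    have h0 : 0 < h r := a0.trans_le (M.mem r hr).1
    have v0 := d.hP.Vnn _ (d.h0.prof.mem (h r))
    have v1 := d.hP.Vle _ (d.h0.prof.mem (h r))
    have p1 := pow_lip e r0.le (hr.2.trans d.βR) h0.le ((M.mem r hr).2.trans d.bR)
    have p2 : h r ^ (e + 1) ≤ (2 * R) ^ (e + 1) := by
      have := (M.mem r hr).2.trans d.bR
      gcongr
    have p3 := j3 r hr
    rw [abs_sub_comm] at p3
    rw [M.feq r hr, hF]
    have : r ^ (e + 1) * V (f0 (h r)) - h r ^ (e + 1) * V (f0 (h r)) * h' r = V (f0 (h r)) * ((r ^ (e + 1) - h r ^ (e + 1)) - h r ^ (e + 1) * (h' r - 1)) := by ring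
    rw [this, abs_mul, abs_of_nonneg v0]
    calc _ ≤ 1 * |(r ^ (e + 1) - h r ^ (e + 1)) - h r ^ (e + 1) * (h' r - 1)| := by gcongr
      _ ≤ |r ^ (e + 1) - h r ^ (e + 1)| + |h r ^ (e + 1) * (h' r - 1)| := by rw [one_mul]; exact abs_sub _ _
      _ ≤ (e + 1) * (2 * R) ^ e * S + (2 * R) ^ (e + 1) * |h' r - 1| := by
        rw [abs_mul, abs_of_pos (show 0 < h r ^ (e + 1) by positivity)]
        refine add_le_add (p1.trans ?_) ?_
        · gcongr
        · gcongr
  refine k1.trans ?_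
  rw [intervalIntegral.integral_add intervalIntegrable_const (j2.const_mul _), intervalIntegral.integral_const_mul ((2 * R) ^ (e + 1)), intervalIntegral.integral_const, smul_eq_mul]
  have S0 : 0 ≤ S := (abs_nonneg _).trans (j3 α ⟨le_rfl, d.αβ.le⟩)
  have w : β - α ≤ 2 * C * ε := by
    have h1 := abs_le.1 d.αC
    have h2 := abs_le.1 d.βC
    linarith
  refine add_le_add ?_ le_rfl
  exact mul_le_mul_of_nonneg_right w (by positivity)

lemma mass_side {m R C ε l a b α β : ℝ} {f0 : ℝ → ℝ} (d : Dat e W V τ c K m R C ε l f0 f a b α β) {κ : ℝ} (hκ : 0 < κ) (hκ4 : κ ≤ 4) {S T : Set ℝ} (hS : MeasurableSet S) (hT : MeasurableSet T) (hS0 : S ⊆ Ioi 0) (hT0 : T ⊆ Ioi 0)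
    (hST : ∀ r, κ * r ∈ T ↔ r ∈ S) : 
    |SP e V f T - κ ^ (e + 2) * SP e V f0 S| ≤ 4 ^ (e + 2) * ∫ r in S, r ^ (e + 1) * |V (f (κ * r)) - V (f0 r)| := by
  rw [SP_scal V hκ hS hT hS0 hT0 hST, ← mul_sub, abs_mul, abs_of_pos (by positivity)]
  have i1 := ((d.hf.scale hκ).intU d.hP.qlV).mono_set hS0
  have i2 := (d.h0.prof.intU d.hP.qlV).mono_set hS0
  unfold SP
  rw [← integral_sub i1 i2]
  have : |∫ r in S, (r ^ (e + 1) * V (f (κ * r)) - r ^ (e + 1) * V (f0 r))| ≤ ∫ r in S, r ^ (e + 1) * |V (f (κ * r)) - V (f0 r)| := by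
    refine abs_integral_le_integral_abs.trans (le_of_eq ?_)
    refine setIntegral_congr_fun hS fun r hr => ?_
    have : (0:ℝ) < r := hS0 hr
    beta_reduce
    rw [← mul_sub, abs_mul, abs_of_pos (by positivity)]
  gcongr

set_option maxHeartbeats 1000000 in
lemma mass_lin (e : ℕ) {R C c K : ℝ} (hR : 0 < R) (hC : 1 ≤ C) (hc : 0 < c) (hK : 1 ≤ K) : ∃ A B : ℝ, 0 < A ∧ 0 < B ∧ ∀ (W V : ℝ → ℝ) (τ m ε l : ℝ) (f0 f h h' : ℝ → ℝ) (a b α β : ℝ), 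
    Dat e W V τ c K m R C ε l f0 f a b α β → Mid f0 f h h' a b α β → 
    A * |α - a| ≤ B * ((∫ r in Ioc 0 a, r ^ (e + 1) * |V (f (α / a * r)) - V (f0 r)|) + (∫ r in Ioi b, r ^ (e + 1) * |V (f (β / b * r)) - V (f0 r)|)) + 
      B * ε * (|α - a| + ∫ r in α..β, |h' r - 1|) + B * ∫ r in α..β, |h' r - 1| := by
  set A := c * ((R / 2) ^ (e + 2) / (e + 2)) * (1 / (2 * R)) with hA
  set B1 := (e + 2) * 4 ^ (e + 1) * (2 / R) * (K * C) with hB1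
  set B2 := 2 * C * ((e + 1) * (2 * R) ^ e) with hB2
  refine ⟨A, 4 ^ (e + 2) + B1 + B2 + (2 * R) ^ (e + 1), by positivity, by positivity, ?_⟩
  intro W V τ m ε l f0 f h h' a b α β d M
  have hε := d.ε0
  have a0 : 0 < a := by linarith [d.aR]
  have α0 : 0 < α := by linarith [d.αR]
  have b0 : 0 < b := a0.trans d.ab
  have β0 : 0 < β := α0.trans d.αβ
  have iV := d.hf.intU d.hP.qlV
  have iV0 := d.h0.prof.intU d.hP.qlV
  have hm := mid_mass d M
  obtain ⟨-, j2, j3⟩ := mid_sup d M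
  have J0 : 0 ≤ ∫ r in α..β, |h' r - 1| := intervalIntegral.integral_nonneg d.αβ.le fun r _ => abs_nonneg _
  have hβS := j3 β ⟨d.αβ.le, le_rfl⟩
  rw [M.hβ, abs_sub_comm] at hβS
  set J := ∫ r in α..β, |h' r - 1| with hJ
  set S := |α - a| + J with hS
  have S0 : 0 ≤ S := by positivity
  have s1 := split3 iV α0 d.αβ.le
  have s0 := split3 iV0 a0 d.ab.le
  have ms : (∫ r in Ioi 0, r ^ (e + 1) * V (f r)) = ∫ r in Ioi 0, r ^ (e + 1) * V (f0 r) := d.mass.trans d.h0.mass.symm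
  rw [s1, s0] at ms
  have kab : ∀ p ρ, R / 2 ≤ p → ρ ≤ 2 * R → ρ / p ≤ 4 := by
    intro p ρ hp hρ
    rw [div_le_iff₀ (by linarith)]; linarith
  have n1 := mass_side d (κ := α / a) (by positivity) (kab a α d.aR (by linarith [d.αβ, d.βR])) (S := Ioc 0 a) (T := Ioc 0 α) measurableSet_Ioc measurableSet_Ioc Ioc_subset_Ioi_self Ioc_subset_Ioi_self 
    (fun r => by
      simp only [mem_Ioc]
      rw [div_mul_eq_mul_div, div_le_iff₀ a0, mul_le_mul_iff_right₀ α0]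
      constructor
      · rintro ⟨h1, h2⟩; exact ⟨by by_contra h3; push Not at h3; have := div_nonpos_of_nonpos_of_nonneg (mul_nonpos_of_nonneg_of_nonpos α0.le h3) a0.le; linarith, h2⟩
      · rintro ⟨h1, h2⟩; exact ⟨by positivity, h2⟩)
  have n2 := mass_side d (κ := β / b) (by positivity) (kab b β (by linarith [d.aR, d.ab]) d.βR) (S := Ioi b) (T := Ioi β) measurableSet_Ioi measurableSet_Ioi (Ioi_subset_Ioi b0.le) (Ioi_subset_Ioi β0.le) 
    (fun r => by
      simp only [mem_Ioi]
      rw [div_mul_eq_mul_div, lt_div_iff₀ b0, mul_lt_mul_iff_right₀ β0])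
  set EI := ∫ r in Ioc 0 a, r ^ (e + 1) * |V (f (α / a * r)) - V (f0 r)| with hEI
  set EO := ∫ r in Ioi b, r ^ (e + 1) * |V (f (β / b * r)) - V (f0 r)| with hEO
  have EI0 : 0 ≤ EI := setIntegral_nonneg measurableSet_Ioc fun r hr => by have := hr.1; positivity
  have EO0 : 0 ≤ EO := setIntegral_nonneg measurableSet_Ioi fun r hr => by have := b0.trans hr; positivity
  have I0l : c * ((R / 2) ^ (e + 2) / (e + 2)) ≤ SP e V f0 (Ioc 0 a) := by
    have q : c * (a ^ (e + 2) / (e + 2)) ≤ SP e V f0 (Ioc 0 a) := by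
      rw [← int_pow a a0.le, ← integral_const_mul]
      refine setIntegral_mono_on ?_ (split3_le iV0 a0 d.ab.le).1 measurableSet_Ioc fun r hr => ?_
      · exact ((by fun_prop : ContinuousOn (fun r : ℝ => c * r ^ (e + 1)) (Icc 0 a)).integrableOn_compact isCompact_Icc).mono_set Ioc_subset_Icc_self
      · have r0 : 0 < r := hr.1
        have t0 := d.hP.τ0
        have t1 := d.hP.τ1
        have h3 := d.h0.anti (mem_Ici.2 r0.le) (mem_Ici.2 a0.le) hr.2
        rw [d.fa] at h3
        have h4 := d.hP.Vmono ⟨t0.le, by linarith⟩ (d.h0.prof.mem r) (show τ ≤ f0 r by linarith)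
        have := d.hP.Vτ.trans h4
        rw [mul_comm]; gcongr
    refine le_trans ?_ q
    have := d.aR
    gcongr
  have O0l : 0 ≤ SP e V f0 (Ioi b) ∧ SP e V f0 (Ioi b) ≤ K * C * ε := by
    constructor
    · exact setIntegral_nonneg measurableSet_Ioi fun r hr => mul_nonneg (by have := b0.trans hr; positivity) (d.hP.Vnn _ (d.h0.prof.mem r))
    · have iW := d.h0.prof.intU d.hP.qlW
      calc _ ≤ ∫ r in Ioi b, K * (r ^ (e + 1) * W (f0 r)) := by
            refine setIntegral_mono_on (split3_le iV0 a0 d.ab.le).2.2 ((iW.mono_set (Ioi_subset_Ioi b0.le)).const_mul _) measurableSet_Ioi fun r hr => ?_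
            have r0 := b0.trans hr
            have t1 := d.hP.τ1
            have h3 := d.h0.anti (mem_Ici.2 b0.le) (mem_Ici.2 r0.le) (le_of_lt hr)
            rw [d.fb] at h3
            have := d.hP.VW (f0 r) ⟨(d.h0.prof.mem r).1, by linarith⟩
            calc _ ≤ r ^ (e + 1) * (K * W (f0 r)) := by gcongr
              _ = _ := by ring
        _ = K * ∫ r in Ioi b, r ^ (e + 1) * W (f0 r) := integral_const_mul _ _
        _ ≤ K * (C * ε) := by
            refine mul_le_mul_of_nonneg_left (le_trans ?_ d.eP) (by linarith)
            refine setIntegral_mono_set iW ?_ (Ioi_subset_Ioi b0.le).eventuallyLE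
            filter_upwards [ae_restrict_mem measurableSet_Ioi] with r hr
            have r0 : (0:ℝ) < r := hr
            exact mul_nonneg (by positivity) (d.hP.Wnn _ (d.h0.prof.mem r))
        _ = _ := by ring
  have k1 : 1 / (2 * R) * |α - a| ≤ |(α / a) ^ (e + 2) - 1| := by
    have := pow_sub_le e (show 0 ≤ α / a by positivity) one_pos
    rw [one_pow, one_pow, one_mul] at this
    refine le_trans ?_ this
    rw [div_sub_one a0.ne', abs_div, abs_of_pos a0, div_eq_mul_one_div, mul_comm]
    have : a ≤ 2 * R := by linarith [d.ab, d.bR]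
    refine mul_le_mul_of_nonneg_left ?_ (abs_nonneg _)
    rw [one_mul, ← one_div a]; exact one_div_le_one_div_of_le a0 this
  have k2 : |(β / b) ^ (e + 2) - 1| ≤ (e + 2) * 4 ^ (e + 1) * (2 / R) * S := by
    have := pow_lip (e + 1) (show 0 ≤ β / b by positivity) (kab b β (by linarith [d.aR, d.ab]) d.βR) zero_le_one (by norm_num : (1:ℝ) ≤ 4)
    rw [one_pow] at this
    refine this.trans ?_
    rw [div_sub_one b0.ne', abs_div, abs_of_pos b0, div_eq_mul_one_div]
    push_cast
    have hb : 1 / b ≤ 2 / R := by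
      rw [div_le_div_iff₀ b0 hR]; linarith [d.aR, d.ab]
    calc _ = (e + 2) * 4 ^ (e + 1) * (1 / b) * |β - b| := by ring
      _ ≤ _ := by gcongr
  unfold SP at n1 n2 I0l O0l
  set I0 := ∫ r in Ioc 0 a, r ^ (e + 1) * V (f0 r)
  set O0 := ∫ r in Ioi b, r ^ (e + 1) * V (f0 r)
  set I1 := ∫ r in Ioc 0 α, r ^ (e + 1) * V (f r)
  set O1 := ∫ r in Ioi β, r ^ (e + 1) * V (f r)
  set M1 := ∫ r in α..β, r ^ (e + 1) * V (f r)
  set M0 := ∫ r in a..b, r ^ (e + 1) * V (f0 r)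
  have z1 : |((α / a) ^ (e + 2) - 1) * I0| ≤ 4 ^ (e + 2) * EI + 4 ^ (e + 2) * EO + |((β / b) ^ (e + 2) - 1) * O0| + |M1 - M0| := by
    have : ((α / a) ^ (e + 2) - 1) * I0 = -(I1 - (α / a) ^ (e + 2) * I0) - (O1 - (β / b) ^ (e + 2) * O0) - (((β / b) ^ (e + 2) - 1) * O0) - (M1 - M0) := by
      linear_combination ms
    rw [this]
    have h1 := abs_le.1 n1
    have h2 := abs_le.1 n2
    have h3 := abs_le.1 (le_refl |((β / b) ^ (e + 2) - 1) * O0|)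
    have h4 := abs_le.1 (le_refl |M1 - M0|)
    rw [abs_le]
    constructor <;> linarith [h1.1, h1.2, h2.1, h2.2, h3.1, h3.2, h4.1, h4.2]
  have I00 : 0 ≤ I0 := le_trans (by positivity) I0l
  rw [abs_mul, abs_mul, abs_of_nonneg O0l.1, abs_of_nonneg I00] at z1
  have z2 : A * |α - a| ≤ |(α / a) ^ (e + 2) - 1| * I0 := by
    calc _ = (1 / (2 * R) * |α - a|) * (c * ((R / 2) ^ (e + 2) / (e + 2))) := by rw [hA]; ring
      _ ≤ _ := by gcongr
  have z3 : |(β / b) ^ (e + 2) - 1| * O0 ≤ B1 * ε * S := by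
    calc _ ≤ ((e + 2) * 4 ^ (e + 1) * (2 / R) * S) * (K * C * ε) := mul_le_mul k2 O0l.2 O0l.1 (by positivity)
      _ = _ := by rw [hB1]; ring
  have z4 : |M1 - M0| ≤ B2 * ε * S + (2 * R) ^ (e + 1) * J := hm.trans (le_of_eq (by rw [hB2]; ring))
  have y1 : 0 ≤ B1 := by positivity
  have y2 : 0 ≤ B2 := by positivity
  have y3 : 0 ≤ (2 * R) ^ (e + 1) := by positivity
  have y4 : (0:ℝ) ≤ 4 ^ (e + 2) := by positivity
  have x1 : 0 ≤ (B1 + B2 + (2 * R) ^ (e + 1)) * (EI + EO) := by positivity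
  have x2 : 0 ≤ (4 ^ (e + 2) + (2 * R) ^ (e + 1)) * (ε * S) := by positivity
  have x3 : 0 ≤ (4 ^ (e + 2) + B1 + B2) * J := by positivity
  linarith

lemma constraint (e : ℕ) {R C c K : ℝ} (hR : 0 < R) (hC : 1 ≤ C) (hc : 0 < c) (hK : 1 ≤ K) : ∃ C8 ε5 : ℝ, 0 < C8 ∧ 0 < ε5 ∧ ∀ (W V : ℝ → ℝ) (τ m ε l : ℝ) (f0 f h h' : ℝ → ℝ) (a b α β : ℝ), ε < ε5 → 
    Dat e W V τ c K m R C ε l f0 f a b α β → Mid f0 f h h' a b α β → 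
    (|α - a| + ∫ r in α..β, |h' r - 1|) ^ 2 ≤ C8 * (ε * TQ e c ε f0 f h' a b α β) := by
  obtain ⟨C9, hC9, her⟩ := errs e hR hC hc hK
  obtain ⟨A, B, hA, hB, hl⟩ := mass_lin e hR hC hc hK
  set D := (B * (2 * C9) + 2 * B * (2 * C)) * (2 / A) with hD
  have hD0 : 0 < D := by positivity
  refine ⟨(2 * D + 2 * C + 2 * C) ^ 2, A / (2 * B), by positivity, by positivity, ?_⟩
  intro W V τ m ε l f0 f h h' a b α β hε5 d M
  have hε := d.ε0
  have := her W V τ m ε l f0 f h' a b α β d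
  have h2 := hl W V τ m ε l f0 f h h' a b α β d M
  obtain ⟨j1, j2, -⟩ := mid_sup d M
  have J0 : 0 ≤ ∫ r in α..β, |h' r - 1| := intervalIntegral.integral_nonneg d.αβ.le fun r _ => abs_nonneg _
  set J := ∫ r in α..β, |h' r - 1| with hJ
  obtain ⟨q1, q2, q3⟩ := TQ_parts (h' := h') d
  have hQ3 : DD ε h' α β ≤ TQ e c ε f0 f h' a b α β := by unfold TQ; linarith
  set Q := TQ e c ε f0 f h' a b α β with hQd
  have Q0 : 0 ≤ Q := q3.trans hQ3
  have sqQ : √(ε * Q) ^ 2 = ε * Q := Real.sq_sqrt (by positivity)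
  set y := √(ε * Q) with hy
  have y0 : 0 ≤ y := Real.sqrt_nonneg _
  have hJy : J ≤ 2 * C * y := by
    refine (le_abs_self _).trans (abs_le_of_sq_le_sq ?_ (by positivity))
    calc _ ≤ _ := j1
      _ ≤ 2 * C * (1 * ε) * Q := by
        rw [sq ε, ← mul_assoc]
        have := d.ε1
        have : 2 * C * ε * ε ≤ 2 * C * (1 * ε) := by rw [mul_assoc]; gcongr
        gcongr
      _ = 2 * C * y ^ 2 := by rw [sqQ]; ring
      _ ≤ (2 * C) ^ 2 * y ^ 2 := by
        have : 2 * C ≤ (2 * C) ^ 2 := by nlinarith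
        gcongr
      _ = _ := by ring
  have hx0 := abs_nonneg (α - a)
  have hx : |α - a| ≤ 2 * C := by
    have h1 := abs_le.1 d.αC
    have h2 := abs_le.1 d.aC
    have h3 : C * ε ≤ C * 1 := by have := d.ε1; gcongr
    rw [abs_le]; constructor <;> linarith
  set x := |α - a| with hxd
  rw [← sqQ] at this
  have hBε : B * ε ≤ A / 2 := by
    rw [lt_div_iff₀ (by positivity)] at hε5
    linarith
  have k1 : A * x ≤ B * (C9 * y + C9 * (y + y ^ 2)) + A / 2 * x + 2 * B * J := by
    have t1 : B * ε * x ≤ A / 2 * x := by gcongr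
    have t2 : B * ε * J ≤ B * 1 * J := by have := d.ε1; gcongr
    have t3 := mul_le_mul_of_nonneg_left (add_le_add this.1 this.2) hB.le
    linarith
  have k2 : x ≤ D * (y + y ^ 2) := by
    have t1 : 2 * B * J ≤ 2 * B * (2 * C) * (y + y ^ 2) := by
      calc _ ≤ 2 * B * (2 * C * y) := by gcongr
        _ ≤ _ := by have : 0 ≤ 2 * B * (2 * C) * y ^ 2 := by positivity
                    linarith
    have t2 : B * (C9 * y + C9 * (y + y ^ 2)) ≤ B * (2 * C9) * (y + y ^ 2) := by
      have : 0 ≤ B * C9 * y ^ 2 := by positivity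
      linarith
    have t3 : A / 2 * x ≤ (B * (2 * C9) + 2 * B * (2 * C)) * (y + y ^ 2) := by linarith
    calc x = (A / 2 * x) * (2 / A) := by field_simp
      _ ≤ ((B * (2 * C9) + 2 * B * (2 * C)) * (y + y ^ 2)) * (2 / A) := by gcongr
      _ = _ := by rw [hD]; ring
  have k3 : x ≤ (2 * D + 2 * C) * y := by
    rcases le_total y 1 with h | h
    · have : y ^ 2 ≤ y := by nlinarith
      calc x ≤ _ := k2
        _ ≤ D * (y + y) := by gcongr
        _ ≤ _ := by have : 0 ≤ 2 * C * y := by positivity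
                    linarith
    · have : 2 * C * 1 ≤ 2 * C * y := by gcongr
      have : 0 ≤ 2 * D * y := by positivity
      linarith
  rw [← sqQ, ← mul_pow]
  have : x + J ≤ (2 * D + 2 * C + 2 * C) * y := by linarith
  gcongr

end S15

namespace S15
open Topology
variable {W V : ℝ → ℝ} {τ c K : ℝ} {e : ℕ} {f g : ℝ → ℝ}

lemma dist_side {m R C ε l a b α β : ℝ} {f0 : ℝ → ℝ} (d : Dat e W V τ c K m R C ε l f0 f a b α β) {κ : ℝ} (hκ : 0 < κ) (hκ4 : κ ≤ 4) {S T : Set ℝ} (hS : MeasurableSet S) (hT : MeasurableSet T) (hS0 : S ⊆ Ioi 0) (hT0 : T ⊆ Ioi 0)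
    (hST : ∀ r, κ * r ∈ T ↔ r ∈ S) : 
    IntegrableOn (fun r => r ^ (e + 1) * |V (f r) - V (f0 (κ⁻¹ * r))|) T ∧ 
    (∫ r in T, r ^ (e + 1) * |V (f r) - V (f0 (κ⁻¹ * r))|) ≤ 4 ^ (e + 2) * ∫ r in S, r ^ (e + 1) * |V (f (κ * r)) - V (f0 r)| := by
  constructor
  · have i1 := (d.hf.intU d.hP.qlV).mono_set hT0
    have i2 := ((d.h0.prof.scale (inv_pos.2 hκ)).intU d.hP.qlV).mono_set hT0
    refine IntegrableOn.congr_fun (i1.sub i2).abs (fun r hr => ?_) hT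
    have : (0:ℝ) < r := hT0 hr
    rw [Pi.sub_apply, ← mul_sub, abs_mul, abs_of_pos (by positivity)]
  · have := set_scal (e := e) (fun r => |V (f r) - V (f0 (κ⁻¹ * r))|) hκ hS hT hS0 hT0 hST
    rw [this]
    have h2 : ∀ r, κ⁻¹ * (κ * r) = r := fun r => by field_simp
    simp only [h2]
    have : 0 ≤ ∫ r in S, r ^ (e + 1) * |V (f (κ * r)) - V (f0 r)| := 
      setIntegral_nonneg hS fun r hr => by
        have : (0:ℝ) < r := hS0 hr
        positivity
    gcongr

lemma G_int {m s ε : ℝ} {f0 : ℝ → ℝ} (hP : Pot W V τ c K) (hm : 0 < m) (h0 : Mini e W V m ε f0) (hs : 0 ≤ s) (hs2 : s ≤ 1 / 2) : 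
    IntegrableOn (fun r => r ^ (e + 1) * (V (f0 ((1 - s) * r)) - V (f0 ((1 + s) * r)))) (Ioi 0) ∧ 
    (∫ r in Ioi 0, r ^ (e + 1) * (V (f0 ((1 - s) * r)) - V (f0 ((1 + s) * r)))) ≤ (e + 2) * 2 ^ (e + 1) * (4 * s) * m := by
  have p1 : 0 < 1 - s := by linarith
  have p2 : 0 < 1 + s := by linarith
  have i1 := (h0.prof.scale p1).intU hP.qlV
  have i2 := (h0.prof.scale p2).intU hP.qlV
  have e1 : (fun r => r ^ (e + 1) * (V (f0 ((1 - s) * r)) - V (f0 ((1 + s) * r)))) = fun r => r ^ (e + 1) * V (f0 ((1 - s) * r)) - r ^ (e + 1) * V (f0 ((1 + s) * r)) := by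
    ext r; ring
  rw [e1]
  refine ⟨i1.sub i2, ?_⟩
  rw [integral_sub i1 i2]
  have q1 := PP_scale (e := e) (f := f0) V p1
  have q2 := PP_scale (e := e) (f := f0) V p2
  rw [h0.mass] at q1 q2
  unfold PP at q1 q2
  rw [q1, q2, ← sub_mul]
  refine mul_le_mul_of_nonneg_right ?_ hm.le
  rw [← inv_pow, ← inv_pow]
  have u1 : (1 - s)⁻¹ ≤ 2 := by
    rw [inv_le_comm₀ p1 (by norm_num)]; linarith
  have u2 : (1 + s)⁻¹ ≤ 2 := by
    rw [inv_le_comm₀ p2 (by norm_num)]; linarith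
  have := pow_lip (e + 1) (inv_pos.2 p1).le u1 (inv_pos.2 p2).le u2
  refine (le_abs_self _).trans (this.trans ?_)
  push_cast
  have h3 : |(1 - s)⁻¹ - (1 + s)⁻¹| ≤ 4 * s := by
    have : (1 - s)⁻¹ - (1 + s)⁻¹ = 2 * s / ((1 - s) * (1 + s)) := by
      field_simp; ring
    rw [this, abs_of_nonneg (by positivity), div_le_iff₀ (by positivity)]
    have : s * s ≤ s * (1 / 2) := by gcongr
    have : 0 ≤ s * s := by positivity
    have : s * (s * s) ≤ s * (1 / 4) := by gcongr; nlinarith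
    nlinarith
  have : (e:ℝ) + 1 + 1 = e + 2 := by ring
  rw [this]
  gcongr

set_option maxHeartbeats 1000000 in
lemma dist_bound {m R C ε l a b α β S : ℝ} {f0 h h' : ℝ → ℝ} (d : Dat e W V τ c K m R C ε l f0 f a b α β) (M : Mid f0 f h h' a b α β) 
    (hS : |α - a| + (∫ r in α..β, |h' r - 1|) ≤ S) (hS4 : S ≤ R / 4) : 
    (∫ r in Ioi 0, r ^ (e + 1) * |V (f r) - V (f0 r)|) ≤ 
      4 ^ (e + 2) * ((∫ r in Ioc 0 a, r ^ (e + 1) * |V (f (α / a * r)) - V (f0 r)|) + (∫ r in Ioi b, r ^ (e + 1) * |V (f (β / b * r)) - V (f0 r)|)) + 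
      (e + 2) * 2 ^ (e + 1) * (4 * (2 * S / R)) * m := by
  have hε := d.ε0
  have hR := d.R0
  have a0 : 0 < a := by linarith [d.aR]
  have α0 : 0 < α := by linarith [d.αR]
  have b0 : 0 < b := a0.trans d.ab
  have β0 : 0 < β := α0.trans d.αβ
  have iV := d.hf.intU d.hP.qlV
  have iV0 := d.h0.prof.intU d.hP.qlV
  obtain ⟨-, -, j3⟩ := mid_sup d M
  have J0 : 0 ≤ ∫ r in α..β, |h' r - 1| := intervalIntegral.integral_nonneg d.αβ.le fun r _ => abs_nonneg _
  have S0 : 0 ≤ S := le_trans (by positivity) hS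
  have hβS := (j3 β ⟨d.αβ.le, le_rfl⟩).trans hS
  rw [M.hβ, abs_sub_comm] at hβS
  have hαS : |α - a| ≤ S := by linarith
  set s := 2 * S / R with hs
  have s0 : 0 ≤ s := by positivity
  have s2 : s ≤ 1 / 2 := by rw [hs, div_le_iff₀ hR]; linarith
  have sR : ∀ r, R / 2 ≤ r → S ≤ s * r := by
    intro r hr
    calc S = s * (R / 2) := by rw [hs]; field_simp
      _ ≤ _ := by gcongr
  obtain ⟨iG, hG⟩ := G_int d.hP d.hm d.h0 s0 s2
  set G := fun r => V (f0 ((1 - s) * r)) - V (f0 ((1 + s) * r)) with hGd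
  have key : ∀ r > 0, ∀ ρ, |ρ - r| ≤ s * r → |V (f r) - V (f0 r)| ≤ |V (f r) - V (f0 ρ)| + G r := by
    intro r hr ρ hρ
    have hb := abs_le.1 hρ
    have l1 : 0 ≤ (1 - s) * r := by have : 0 ≤ 1 - s := by linarith
                                    positivity
    have l2 : 0 ≤ (1 + s) * r := by positivity
    have l3 : (1 - s) * r ≤ ρ := by linarith
    have l4 : ρ ≤ (1 + s) * r := by linarith
    have l5 : (1 - s) * r ≤ r := by nlinarith
    have l6 : r ≤ (1 + s) * r := by nlinarith
    have mo : ∀ x y, 0 ≤ x → x ≤ y → V (f0 y) ≤ V (f0 x) := fun x y hx hxy => 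
      d.hP.Vmono (d.h0.prof.mem y) (d.h0.prof.mem x) (d.h0.anti hx (hx.trans hxy : 0 ≤ y) hxy)
    have m1 := mo _ _ l1 l3
    have m2 := mo _ _ (l1.trans l3) l4
    have m3 := mo _ _ l1 l5
    have m4 := mo _ _ hr.le l6
    have : |V (f0 ρ) - V (f0 r)| ≤ G r := by
      rw [hGd, abs_le]; constructor <;> linarith
    exact (abs_sub_le _ (V (f0 ρ)) _).trans (by linarith)
  have iL : IntegrableOn (fun r => r ^ (e + 1) * |V (f r) - V (f0 r)|) (Ioi 0) := by
    refine IntegrableOn.congr_fun (iV.sub iV0).abs (fun r hr => ?_) measurableSet_Ioi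
    have : (0:ℝ) < r := hr
    rw [Pi.sub_apply, ← mul_sub, abs_mul, abs_of_pos (by positivity)]
  have kab : ∀ p ρ, R / 2 ≤ p → ρ ≤ 2 * R → ρ / p ≤ 4 := by
    intro p ρ hp hρ
    rw [div_le_iff₀ (by linarith)]; linarith
  have n1 := dist_side d (κ := α / a) (by positivity) (kab a α d.aR (by linarith [d.αβ, d.βR])) (S := Ioc 0 a) (T := Ioc 0 α) measurableSet_Ioc measurableSet_Ioc Ioc_subset_Ioi_self Ioc_subset_Ioi_self 
    (fun r => by
      simp only [mem_Ioc]
      rw [div_mul_eq_mul_div, div_le_iff₀ a0, mul_le_mul_iff_right₀ α0]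
      constructor
      · rintro ⟨h1, h2⟩; exact ⟨by by_contra h3; push Not at h3; have := div_nonpos_of_nonpos_of_nonneg (mul_nonpos_of_nonneg_of_nonpos α0.le h3) a0.le; linarith, h2⟩
      · rintro ⟨h1, h2⟩; exact ⟨by positivity, h2⟩)
  have n2 := dist_side d (κ := β / b) (by positivity) (kab b β (by linarith [d.aR, d.ab]) d.βR) (S := Ioi b) (T := Ioi β) measurableSet_Ioi measurableSet_Ioi (Ioi_subset_Ioi b0.le) (Ioi_subset_Ioi β0.le) 
    (fun r => by
      simp only [mem_Ioi]
      rw [div_mul_eq_mul_div, lt_div_iff₀ b0, mul_lt_mul_iff_right₀ β0])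
  have L := split3_le iL α0 d.αβ.le
  have g3 := split3_le iG α0 d.αβ.le
  have hκ : ∀ p ρ r, 0 < p → R / 2 ≤ ρ → 0 < r → |ρ - p| ≤ S → |(ρ / p)⁻¹ * r - r| ≤ s * r := by
    intro p ρ r hp hρ hr hpρ
    have ρ0 : 0 < ρ := by linarith
    have : (ρ / p)⁻¹ * r - r = (p - ρ) * (r / ρ) := by field_simp
    rw [this, abs_mul, abs_sub_comm, abs_of_pos (show 0 < r / ρ by positivity)]
    calc _ ≤ (s * ρ) * (r / ρ) := by
          have := hpρ.trans (sR ρ hρ)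
          gcongr
      _ = _ := by field_simp
  have t1 : (∫ r in Ioc 0 α, r ^ (e + 1) * |V (f r) - V (f0 r)|) ≤ (∫ r in Ioc 0 α, r ^ (e + 1) * |V (f r) - V (f0 ((α / a)⁻¹ * r))|) + ∫ r in Ioc 0 α, r ^ (e + 1) * G r := by
    rw [← integral_add n1.1 g3.1]
    refine setIntegral_mono_on L.1 (n1.1.add g3.1) measurableSet_Ioc fun r hr => ?_
    have r0 : 0 < r := hr.1
    rw [← mul_add]
    exact mul_le_mul_of_nonneg_left (key r r0 _ (hκ a α r a0 d.αR r0 hαS)) (by positivity)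
  have t2 : (∫ r in Ioi β, r ^ (e + 1) * |V (f r) - V (f0 r)|) ≤ (∫ r in Ioi β, r ^ (e + 1) * |V (f r) - V (f0 ((β / b)⁻¹ * r))|) + ∫ r in Ioi β, r ^ (e + 1) * G r := by
    rw [← integral_add n2.1 g3.2.2]
    refine setIntegral_mono_on L.2.2 (n2.1.add g3.2.2) measurableSet_Ioi fun r hr => ?_
    have r0 : 0 < r := β0.trans hr
    rw [← mul_add]
    exact mul_le_mul_of_nonneg_left (key r r0 _ (hκ b β r b0 (by linarith [d.αR, d.αβ]) r0 hβS)) (by positivity)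
  have t3 : (∫ r in α..β, r ^ (e + 1) * |V (f r) - V (f0 r)|) ≤ ∫ r in α..β, r ^ (e + 1) * G r := by
    refine intervalIntegral.integral_mono_on d.αβ.le L.2.1 g3.2.1 fun r hr => ?_
    have r0 : 0 < r := α0.trans_le hr.1
    have := key r r0 (h r) (((j3 r hr).trans hS).trans (sR r (d.αR.trans hr.1)))
    rw [M.feq r hr, sub_self, abs_zero, zero_add] at this
    rw [M.feq r hr]
    exact mul_le_mul_of_nonneg_left this (by positivity)
  have s1 := split3 iL α0 d.αβ.le
  have s3 := split3 iG α0 d.αβ.le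
  rw [s1]
  linarith [n1.2, n2.2]

theorem oneD (hP : Pot W V τ c K) {m : ℝ} (hm : 0 < m) : ∃ ε0 > 0, ∃ D > 0, ∀ ε f0 f, 0 < ε → ε < ε0 → Mini e W V m ε f0 → 
    Prof e f → AntitoneOn f (Ici 0) → PP e V f = m → 
    (∫ r in Ioi 0, r ^ (e + 1) * |V (f r) - V (f0 r)|) ≤ D * √(EE e W ε f - EE e W ε f0) := by
  obtain ⟨R, C, ε1, hε1, hset⟩ := setup (e := e) hP hm
  have big : ∀ ε f0 f, Mini e W V m ε f0 → Prof e f → PP e V f = m → 1 ≤ EE e W ε f - EE e W ε f0 → 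
      (∫ r in Ioi 0, r ^ (e + 1) * |V (f r) - V (f0 r)|) ≤ 2 * m * √(EE e W ε f - EE e W ε f0) := by
    intro ε f0 f h0 hf hfm h1
    have iV := hf.intU hP.qlV
    have iV0 := h0.prof.intU hP.qlV
    have h2 : (∫ r in Ioi 0, r ^ (e + 1) * |V (f r) - V (f0 r)|) ≤ 2 * m := by
      have : 2 * m = ∫ r in Ioi 0, (r ^ (e + 1) * V (f r) + r ^ (e + 1) * V (f0 r)) := by
        rw [integral_add iV iV0]
        have q1 := hfm
        have q2 := h0.mass
        unfold PP at q1 q2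
        rw [q1, q2]; ring
      rw [this]
      refine setIntegral_mono_on ?_ (iV.add iV0) measurableSet_Ioi fun r hr => ?_
      · refine IntegrableOn.congr_fun (iV.sub iV0).abs (fun r hr => ?_) measurableSet_Ioi
        have : (0:ℝ) < r := hr
        rw [Pi.sub_apply, ← mul_sub, abs_mul, abs_of_pos (by positivity)]
      · have : (0:ℝ) < r := hr
        rw [← mul_add]
        have v1 := hP.Vnn _ (hf.mem r)
        have v2 := hP.Vnn _ (h0.prof.mem r)
        refine mul_le_mul_of_nonneg_left ?_ (by positivity)
        rw [abs_le]; constructor <;> linarith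
    have h3 : 1 ≤ √(EE e W ε f - EE e W ε f0) := by rwa [Real.one_le_sqrt]
    calc _ ≤ 2 * m * 1 := by linarith
      _ ≤ _ := by gcongr
  by_cases hRC : 0 < R ∧ 1 ≤ C
  swap
  · refine ⟨ε1, hε1, 2 * m, by positivity, fun ε f0 f hε hεε h0 hf ha hfm => ?_⟩
    rcases le_total 1 (EE e W ε f - EE e W ε f0) with h | h
    · exact big ε f0 f h0 hf hfm h
    · obtain ⟨a, b, α, β, d⟩ := hset ε f0 f hε hεε h0 hf ha hfm (by linarith)
      exact absurd ⟨d.R0, d.C1⟩ hRC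
  obtain ⟨hR, hC⟩ := hRC
  have hc := hP.c0
  have hK := hP.K1
  obtain ⟨C9, hC9, her⟩ := errs e hR hC hc hK
  obtain ⟨c7, C7, ε4, hc7, hC7, hε4, hen⟩ := energy_comb e hR hC hc
  obtain ⟨C8, ε5, hC8, hε5, hco⟩ := constraint e hR hC hc hK
  set ε6 := c7 / (2 * C7 * C8) with hε6
  set ε7 := R ^ 2 * c7 / (32 * C8) with hε7
  set A := √(2 / c7) with hA
  set B := √(C8 * (2 / c7)) with hB
  set D := 4 ^ (e + 2) * (C9 * (2 * A + 2 / c7)) + (e + 2) * 2 ^ (e + 1) * (4 * (2 * B / R)) * m with hD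
  refine ⟨min (min ε1 ε4) (min ε5 (min ε6 ε7)), by positivity, D + 2 * m, by positivity, fun ε f0 f hε hεε h0 hf ha hfm => ?_⟩
  simp only [lt_min_iff] at hεε
  obtain ⟨⟨l1, l4⟩, l5, l6, l7⟩ := hεε
  have D0 : 0 ≤ D := by positivity
  rcases le_total 1 (EE e W ε f - EE e W ε f0) with h | h
  · refine (big ε f0 f h0 hf hfm h).trans ?_
    gcongr; linarith
  obtain ⟨a, b, α, β, d⟩ := hset ε f0 f hε l1 h0 hf ha hfm (by linarith)
  obtain ⟨h1, h', M⟩ := mid_exists d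
  have e1 := hen _ _ _ _ _ _ _ _ _ _ _ _ _ _ _ l4 d M
  have e2 := hco _ _ _ _ _ _ _ _ _ _ _ _ _ _ l5 d M
  have e3 := her _ _ _ _ _ _ _ _ h' _ _ _ _ d
  have δ0 : 0 ≤ EE e W ε f - EE e W ε f0 := by linarith [h0.mini f hf hfm]
  have J0 : 0 ≤ ∫ r in α..β, |h' r - 1| := intervalIntegral.integral_nonneg d.αβ.le fun r _ => abs_nonneg _
  obtain ⟨q1, q2, q3⟩ := TQ_parts (h' := h') d
  have Q0 : 0 ≤ TQ e c ε f0 f h' a b α β := by unfold TQ; linarith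
  set Q := TQ e c ε f0 f h' a b α β with hQ
  set J := ∫ r in α..β, |h' r - 1|
  set δ := EE e W ε f - EE e W ε f0 with hδ
  have sδ : √δ ^ 2 = δ := Real.sq_sqrt δ0
  have sδ0 := Real.sqrt_nonneg δ
  have sδ1 : √δ ≤ 1 := Real.sqrt_le_iff.2 ⟨by norm_num, by linarith⟩
  have x2 : (α - a) ^ 2 ≤ C8 * (ε * Q) := by
    refine le_trans ?_ e2
    rw [← sq_abs (α - a)]
    gcongr; linarith
  have u1 : Q ≤ 2 / c7 * δ := by
    have : C7 * (C8 * (ε * Q)) ≤ c7 / 2 * Q := by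
      rw [hε6, lt_div_iff₀ (by positivity)] at l6
      calc _ = (ε * (2 * C7 * C8)) / 2 * Q := by ring
        _ ≤ _ := by gcongr
    have : C7 * (α - a) ^ 2 ≤ C7 * (C8 * (ε * Q)) := by gcongr
    have : c7 / 2 * Q ≤ δ := by linarith
    calc Q = 2 / c7 * (c7 / 2 * Q) := by field_simp
      _ ≤ _ := by gcongr
  have u2 : ε * Q ≤ 2 / c7 * δ := by
    calc _ ≤ 1 * Q := by have := d.ε1; gcongr
      _ ≤ _ := by linarith
  have u3 : √(ε * Q) ≤ A * √δ := by
    rw [hA, ← Real.sqrt_mul (by positivity)]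
    exact Real.sqrt_le_sqrt u2
  have u4 : ε * Q ≤ 2 / c7 * √δ := by
    refine u2.trans ?_
    have : δ ≤ √δ := by nlinarith
    gcongr
  have S1 : |α - a| + J ≤ B * √δ := by
    rw [hB, ← Real.sqrt_mul (by positivity)]
    refine Real.le_sqrt_of_sq_le (e2.trans ?_)
    rw [mul_assoc]; gcongr
  have S2 : |α - a| + J ≤ R / 4 := by
    refine (le_abs_self _).trans (abs_le_of_sq_le_sq (e2.trans ?_) (by positivity))
    rw [hε7, lt_div_iff₀ (by positivity)] at l7
    calc C8 * (ε * Q) ≤ C8 * (ε * (2 / c7 * 1)) := by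
          have : Q ≤ 2 / c7 * 1 := u1.trans (by gcongr)
          gcongr
      _ = (ε * (32 * C8)) / (16 * c7) := by field_simp; ring
      _ ≤ (R ^ 2 * c7) / (16 * c7) := by gcongr
      _ = _ := by field_simp; ring
  refine (dist_bound d M le_rfl S2).trans ?_
  have f1 : (∫ r in Ioc 0 a, r ^ (e + 1) * |V (f (α / a * r)) - V (f0 r)|) + (∫ r in Ioi b, r ^ (e + 1) * |V (f (β / b * r)) - V (f0 r)|) ≤ C9 * (2 * A + 2 / c7) * √δ := by
    calc _ ≤ C9 * √(ε * Q) + C9 * (√(ε * Q) + ε * Q) := add_le_add e3.1 e3.2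
      _ ≤ C9 * (A * √δ) + C9 * (A * √δ + 2 / c7 * √δ) := by gcongr
      _ = _ := by ring
  calc _ ≤ 4 ^ (e + 2) * (C9 * (2 * A + 2 / c7) * √δ) + (e + 2) * 2 ^ (e + 1) * (4 * (2 * (B * √δ) / R)) * m := by gcongr
    _ = D * √δ := by rw [hD]; ring
    _ ≤ _ := by
      have : 0 ≤ 2 * m * √δ := by positivity
      linarith

end S15

namespace S15
open Topology
variable {W V : ℝ → ℝ} {τ c K : ℝ} {e : ℕ} {f g : ℝ → ℝ}

def cst (e : ℕ) : ℝ := (e + 2) * ballVol (e + 2)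

lemma cst_pos (e : ℕ) : 0 < cst e := by
  have : 0 < ballVol (e + 2) := by
    unfold ballVol
    exact ENNReal.toReal_pos (Metric.measure_ball_pos _ _ one_pos).ne' measure_ball_lt_top.ne
  unfold cst
  positivity

lemma rad_int (F : ℝ → ℝ) : ∫ x : En (e + 2), F ‖x‖ = cst e * ∫ r in Ioi (0:ℝ), r ^ (e + 1) * F r := by
  have := integral_fun_norm_addHaar (volume : Measure (En (e + 2))) F
  rw [this]
  simp only [finrank_euclideanSpace_fin, smul_eq_mul, nsmul_eq_mul]
  unfold cst ballVol Measure.real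
  push_cast
  rw [mul_assoc]

lemma rad_integrable (F : ℝ → ℝ) : Integrable (fun x : En (e + 2) => F ‖x‖) ↔ IntegrableOn (fun r : ℝ => r ^ (e + 1) * F r) (Ioi 0) := by
  have := integrable_fun_norm_addHaar (volume : Measure (En (e + 2))) (f := F)
  simp only [finrank_euclideanSpace_fin, smul_eq_mul] at this
  exact this

lemma fd_norm (hf : Differentiable ℝ f) (d0 : deriv f 0 = 0) (x : En (e + 2)) : 
    DifferentiableAt ℝ (fun x : En (e + 2) => f ‖x‖) x ∧ ‖fderiv ℝ (fun x : En (e + 2) => f ‖x‖) x‖ = |deriv f ‖x‖| := by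
  by_cases hx : x = 0
  · subst hx
    have h1 : HasFDerivAt (fun x : En (e + 2) => f ‖x‖) (0 : En (e + 2) →L[ℝ] ℝ) 0 := by
      have h2 : HasDerivAt f 0 0 := (hf 0).hasDerivAt.congr_deriv d0
      rw [hasDerivAt_iff_isLittleO_nhds_zero] at h2
      rw [hasFDerivAt_iff_isLittleO_nhds_zero]
      have h3 : Tendsto (fun x : En (e + 2) => ‖x‖) (𝓝 0) (𝓝 0) := by
        have := (continuous_norm (E := En (e + 2))).tendsto 0
        simpa using this
      have := (h2.comp_tendsto h3)
      refine Asymptotics.IsLittleO.of_norm_right ?_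
      simpa [Function.comp_def] using this
    refine ⟨h1.differentiableAt, ?_⟩
    rw [h1.fderiv]
    simp [d0]
  · have hn : DifferentiableAt ℝ (fun x : En (e + 2) => ‖x‖) x := differentiableAt_id.norm ℝ hx
    have h1 : HasFDerivAt (fun x : En (e + 2) => f ‖x‖) (deriv f ‖x‖ • fderiv ℝ (fun x : En (e + 2) => ‖x‖) x) x := 
      (hf ‖x‖).hasDerivAt.comp_hasFDerivAt x hn.hasFDerivAt
    refine ⟨h1.differentiableAt, ?_⟩
    rw [h1.fderiv, norm_smul, norm_fderiv_norm hn, mul_one, Real.norm_eq_abs]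

lemma h1_iff (hf : Differentiable ℝ f) (d0 : deriv f 0 = 0) : 
    (∀ r, 0 ≤ r → f r ∈ Icc (0:ℝ) 1) ∧ IntegrableOn (fun r => r ^ (e + 1) * (f r) ^ 2) (Ioi 0) ∧ IntegrableOn (fun r => r ^ (e + 1) * (deriv f r) ^ 2) (Ioi 0) ↔ 
      H1Box (e + 2) (fun x => f ‖x‖) := by
  have hd : Differentiable ℝ (fun x : En (e + 2) => f ‖x‖) := fun x => (fd_norm hf d0 x).1
  have m1 : AEStronglyMeasurable (fun x : En (e + 2) => f ‖x‖) volume := hd.continuous.aestronglyMeasurable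
  have m2 : AEStronglyMeasurable (fun x : En (e + 2) => fderiv ℝ (fun x : En (e + 2) => f ‖x‖) x) volume := 
    (measurable_fderiv ℝ _).aestronglyMeasurable
  have e1 := memLp_two_iff_integrable_sq m1
  have e2 := memLp_two_iff_integrable_sq_norm m2
  have e3 : (fun x : En (e + 2) => ‖fderiv ℝ (fun x : En (e + 2) => f ‖x‖) x‖ ^ 2) = fun x => (deriv f ‖x‖) ^ 2 := by
    ext x; rw [(fd_norm hf d0 x).2, sq_abs]
  rw [e3, rad_integrable (fun r => (deriv f r) ^ 2)] at e2
  rw [rad_integrable (fun r => (f r) ^ 2)] at e1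
  constructor
  · rintro ⟨h1, h2, h3⟩
    exact ⟨fun x => h1 _ (norm_nonneg x), hd, e1.2 h2, e2.2 h3⟩
  · intro h
    refine ⟨fun r hr => ?_, e1.1 h.memL2, e2.1 h.grad_memL2⟩
    have := h.mem_Icc (r • EuclideanSpace.single 0 1)
    simpa [norm_smul, abs_of_nonneg hr] using this

lemma AC_eq (hf : Differentiable ℝ f) (d0 : deriv f 0 = 0) (ε : ℝ) : AC (e + 2) W ε (fun x => f ‖x‖) = cst e * EE e W ε f := by
  unfold AC EE GG PP
  have e3 : (fun x : En (e + 2) => ‖fderiv ℝ (fun x : En (e + 2) => f ‖x‖) x‖ ^ 2) = fun x => (deriv f ‖x‖) ^ 2 := by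
    ext x; rw [(fd_norm hf d0 x).2, sq_abs]
  rw [e3, rad_int (fun r => (deriv f r) ^ 2), rad_int (fun r => W (f r))]
  ring

lemma V_eq (V : ℝ → ℝ) : ∫ x : En (e + 2), V (f ‖x‖) = cst e * PP e V f := rad_int (fun r => V (f r))

lemma prof_of {u : En (e + 2) → ℝ} (hu : H1Box (e + 2) u) (hr : RadialDecreasing (e + 2) u) : 
    ∃ f, Prof e f ∧ AntitoneOn f (Ici 0) ∧ u = fun x => f ‖x‖ := by
  obtain ⟨ζ, hζ, hu2⟩ := hr
  set E0 : En (e + 2) := EuclideanSpace.single 0 1 with hE0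
  have nE : ‖E0‖ = 1 := by simp [hE0]
  have hfz : ∀ r : ℝ, u (r • E0) = ζ |r| := by
    intro r; rw [hu2, norm_smul, nE, mul_one, Real.norm_eq_abs]
  set f : ℝ → ℝ := fun r => u (r • E0) with hf
  have hfd : Differentiable ℝ f := hu.diff.comp (by fun_prop)
  have hue : u = fun x => f ‖x‖ := by
    ext x; rw [hf]; beta_reduce; rw [hfz, hu2, abs_norm]
  have hev : ∀ r, f (-r) = f r := by
    intro r; rw [hf]; beta_reduce; rw [hfz, hfz, abs_neg]
  have d0 : deriv f 0 = 0 := by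
    have h1 : deriv (fun r => f (-r)) 0 = - deriv f 0 := by
      rw [deriv_comp_neg]; simp
    rw [funext hev] at h1
    change deriv f 0 = _ at h1
    linarith
  have hH := hu
  rw [hue] at hH
  have := (h1_iff hfd d0).2 hH
  refine ⟨f, ⟨hfd, d0, fun r => hu.mem_Icc _, this.2.1, this.2.2⟩, ?_, hue⟩
  intro a ha b hb hab
  rw [hf]; beta_reduce; rw [hfz, hfz, abs_of_nonneg (mem_Ici.1 ha), abs_of_nonneg (mem_Ici.1 hb)]
  exact hζ ha hb hab

lemma Prof.h1 (hf : Prof e f) : H1Box (e + 2) (fun x => f ‖x‖) := 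
  (h1_iff hf.diff hf.d0).1 ⟨fun r _ => hf.mem r, hf.i0, hf.i1⟩

lemma AC_nonneg (hW : ∀ t ∈ Icc (0:ℝ) 1, 0 ≤ W t) {n : ℕ} {ε : ℝ} (hε : 0 < ε) {u : En n → ℝ} (hu : H1Box n u) : 0 ≤ AC n W ε u := by
  unfold AC
  have h1 : 0 ≤ ∫ x : En n, ‖fderiv ℝ u x‖ ^ 2 := integral_nonneg fun x => by positivity
  have h2 : 0 ≤ ∫ x : En n, W (u x) := integral_nonneg fun x => hW _ (hu.mem_Icc x)
  positivity

lemma Psi_le (hW : ∀ t ∈ Icc (0:ℝ) 1, 0 ≤ W t) {n : ℕ} {ε m : ℝ} (hε : 0 < ε) {u : En n → ℝ} (hu : H1Box n u) (hm : (∫ x : En n, Vpot n W (u x)) = m) : 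
    Psi n W ε m ≤ AC n W ε u := by
  refine csInf_le ⟨0, ?_⟩ ⟨u, ⟨hu, hm⟩, rfl⟩
  rintro _ ⟨v, hv, rfl⟩
  exact AC_nonneg hW hε hv.1

lemma mini_of (hW : ∀ t ∈ Icc (0:ℝ) 1, 0 ≤ W t) {ε : ℝ} (hε : 0 < ε) (hf : Prof e f) (ha : AntitoneOn f (Ici 0)) 
    (hm : Minimizes (e + 2) W ε (fun x => f ‖x‖)) : Mini e W (Vpot (e + 2) W) (1 / cst e) ε f := by
  have hc := cst_pos e
  obtain ⟨h1, h2, h3⟩ := hm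
  rw [V_eq] at h2
  refine ⟨hf, ha, by rw [eq_div_iff hc.ne']; linarith, fun g hg hgm => ?_⟩
  have := Psi_le (m := 1) hW hε hg.h1 (by rw [V_eq, hgm]; field_simp)
  rw [← h3, AC_eq hf.diff hf.d0, AC_eq hg.diff hg.d0] at this
  exact le_of_mul_le_mul_left this hc

theorem reduce (hP : Pot W (Vpot (e + 2) W) τ c K) (hΦ : ∀ t ∈ Icc (0:ℝ) 1, 0 ≤ Phi W t) : 
    ∃ ε₀ > (0:ℝ), ∃ C > (0:ℝ), ∀ ε : ℝ, 0 < ε → ε < ε₀ →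
      ∀ uε : En (e + 2) → ℝ, Minimizes (e + 2) W ε uε → RadialDecreasing (e + 2) uε →
      ∀ u : En (e + 2) → ℝ, H1Box (e + 2) u → RadialDecreasing (e + 2) u →
        (∫ x : En (e + 2), Vpot (e + 2) W (u x)) = 1 →
        dPhi (e + 2) W u uε ≤ C * Real.sqrt (AC (e + 2) W ε u - Psi (e + 2) W ε 1) := by
  have hc := cst_pos e
  obtain ⟨ε0, hε0, D, hD, H⟩ := oneD (e := e) hP (m := 1 / cst e) (by positivity)
  refine ⟨ε0, hε0, cst e * D * (1 / √(cst e)), by positivity, ?_⟩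
  intro ε hε hεε uε hmin hrε u hu hr hV
  obtain ⟨f0, p0, a0, rfl⟩ := prof_of hmin.1 hrε
  obtain ⟨f, pf, af, rfl⟩ := prof_of hu hr
  have h0 := mini_of hP.Wnn hε p0 a0 hmin
  rw [V_eq] at hV
  have h1 := H ε f0 f hε hεε h0 pf af (by rw [eq_div_iff hc.ne']; linarith)
  have e1 : AC (e + 2) W ε (fun x => f ‖x‖) - Psi (e + 2) W ε 1 = cst e * (EE e W ε f - EE e W ε f0) := by
    rw [← hmin.2.2, AC_eq pf.diff pf.d0, AC_eq p0.diff p0.d0]; ring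
  rw [e1, Real.sqrt_mul hc.le]
  have e2 : cst e * D * (1 / √(cst e)) * (√(cst e) * √(EE e W ε f - EE e W ε f0)) = cst e * (D * √(EE e W ε f - EE e W ε f0)) := by
    have : 0 < √(cst e) := by positivity
    field_simp
  rw [e2]
  refine le_trans ?_ (mul_le_mul_of_nonneg_left h1 hc.le)
  rw [← rad_int (fun r => |Vpot (e + 2) W (f r) - Vpot (e + 2) W (f0 r)|)]
  unfold dPhi
  refine integral_mono_of_nonneg (Eventually.of_forall fun x => by positivity) ?_ (Eventually.of_forall fun x => ?_)
  · rw [rad_integrable (fun r => |Vpot (e + 2) W (f r) - Vpot (e + 2) W (f0 r)|)]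
    refine IntegrableOn.congr_fun ((pf.intU hP.qlV).sub (p0.intU hP.qlV)).abs (fun r hr => ?_) measurableSet_Ioi
    have : (0:ℝ) < r := hr
    rw [Pi.sub_apply, ← mul_sub, abs_mul, abs_of_pos (by positivity)]
  · beta_reduce
    unfold Vpot
    have p1 : 1 ≤ ((e + 2 : ℕ) : ℝ) / (((e + 2 : ℕ) : ℝ) - 1) := by
      push_cast
      rw [le_div_iff₀ (by linarith [(Nat.cast_nonneg e : (0:ℝ) ≤ e)])]; linarith
    set p := ((e + 2 : ℕ) : ℝ) / (((e + 2 : ℕ) : ℝ) - 1)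
    have gen : ∀ x y : ℝ, 0 ≤ y → y ≤ x → |x - y| ^ p ≤ |x ^ p - y ^ p| := by
      intro x y hy hxy
      have := Real.add_rpow_le_rpow_add (sub_nonneg.2 hxy) hy p1
      rw [sub_add_cancel] at this
      rw [abs_of_nonneg (sub_nonneg.2 hxy)]
      exact le_trans (by linarith) (le_abs_self _)
    have q1 := hΦ _ (pf.mem ‖x‖)
    have q2 := hΦ _ (p0.mem ‖x‖)
    rcases le_total (Phi W (f0 ‖x‖)) (Phi W (f ‖x‖)) with h | h
    · exact gen _ _ q2 h
    · rw [abs_sub_comm, abs_sub_comm (Phi W (f ‖x‖) ^ p)]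
      exact gen _ _ q1 h

end S15

namespace S15
open Topology
variable {W V : ℝ → ℝ} {τ c K : ℝ} {e : ℕ} {f g : ℝ → ℝ}

/-- working form of the double well -/
structure DW (W D1 D2 : ℝ → ℝ) (w τ K : ℝ) : Prop where
  Wc : ContinuousOn W (Icc 0 1)
  D1c : ContinuousOn D1 (Icc 0 1)
  hd1 : ∀ t ∈ Ioo (0:ℝ) 1, HasDerivAt W (D1 t) t
  hd2 : ∀ t ∈ Ioo (0:ℝ) 1, HasDerivAt D1 (D2 t) t
  W0 : W 0 = 0
  W1 : W 1 = 0
  pos : ∀ t ∈ Ioo (0:ℝ) 1, 0 < W t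
  nrm : ∫ t in (0:ℝ)..1, √(W t) = 1
  w0 : 0 < w
  τ0 : 0 < τ
  τ1 : τ < 1 / 2
  K1 : 1 ≤ K
  D2K : ∀ t ∈ Icc (0:ℝ) 1, |D2 t| ≤ K
  D1K : ∀ t ∈ Icc (0:ℝ) 1, |D1 t| ≤ K
  D2w : ∀ t ∈ Icc (0:ℝ) 1, t ≤ τ ∨ 1 - τ ≤ t → w ≤ D2 t
  D10 : 0 ≤ D1 0
  D11 : D1 1 ≤ 0

lemma mvt {F F' : ℝ → ℝ} {a b : ℝ} (hab : a < b) (ha : 0 ≤ a) (hb : b ≤ 1) (hF : ContinuousOn F (Icc 0 1)) (hd : ∀ t ∈ Ioo (0:ℝ) 1, HasDerivAt F (F' t) t) : 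
    ∃ ξ ∈ Ioo a b, F b - F a = F' ξ * (b - a) := by
  obtain ⟨ξ, hξ, h⟩ := exists_hasDerivAt_eq_slope F F' hab (hF.mono (Icc_subset_Icc ha hb)) fun t ht => hd t ⟨ha.trans_lt ht.1, ht.2.trans_le hb⟩
  refine ⟨ξ, hξ, ?_⟩
  rw [h, div_mul_cancel₀ _ (by linarith)]

lemma dw_of (hW : DoubleWell W) : ∃ w τ K, DW W (derivWithin W (Icc 0 1)) (iteratedDerivWithin 2 W (Icc 0 1)) w τ K := by
  have ud : UniqueDiffOn ℝ (Icc (0:ℝ) 1) := uniqueDiffOn_Icc zero_lt_one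
  set D1 := derivWithin W (Icc 0 1) with hD1
  set D2 := iteratedDerivWithin 2 W (Icc 0 1) with hD2
  have Wc : ContinuousOn W (Icc 0 1) := hW.contDiffOn.continuousOn
  have D1C : ContDiffOn ℝ 1 D1 (Icc 0 1) := hW.contDiffOn.derivWithin ud (by norm_num)
  have D1c := D1C.continuousOn
  obtain ⟨L, hL⟩ := hW.lipschitzSecond
  have D2c : ContinuousOn D2 (Icc 0 1) := hL.continuousOn
  have e2 : ∀ t ∈ Icc (0:ℝ) 1, D2 t = derivWithin D1 (Icc 0 1) t := by
    intro t ht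
    rw [hD2, iteratedDerivWithin_succ]
    refine derivWithin_congr (fun s hs => ?_) ?_
    · rw [iteratedDerivWithin_one]
    · rw [iteratedDerivWithin_one]
  have hd1 : ∀ t ∈ Ioo (0:ℝ) 1, HasDerivAt W (D1 t) t := fun t ht => 
    ((hW.contDiffOn.differentiableOn (by norm_num)) t (Ioo_subset_Icc_self ht)).hasDerivWithinAt.hasDerivAt (Icc_mem_nhds ht.1 ht.2)
  have hd2 : ∀ t ∈ Ioo (0:ℝ) 1, HasDerivAt D1 (D2 t) t := fun t ht => by
    rw [e2 t (Ioo_subset_Icc_self ht)]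
    exact ((D1C.differentiableOn (by norm_num)) t (Ioo_subset_Icc_self ht)).hasDerivWithinAt.hasDerivAt (Icc_mem_nhds ht.1 ht.2)
  obtain ⟨K1, hK1⟩ := isCompact_Icc.exists_bound_of_continuousOn D1c
  obtain ⟨K2, hK2⟩ := isCompact_Icc.exists_bound_of_continuousOn D2c
  set w := min (D2 0) (D2 1) / 2 with hw
  have w0 : 0 < w := by
    have := lt_min hW.second_pos_zero hW.second_pos_one
    rw [hw]; linarith
  have near : ∀ p ∈ Icc (0:ℝ) 1, w < D2 p → ∃ η > 0, ∀ t ∈ Icc (0:ℝ) 1, |t - p| < η → w < D2 t := by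
    intro p hp h
    have := (D2c p hp).eventually (lt_mem_nhds h)
    rw [eventually_nhdsWithin_iff, Metric.eventually_nhds_iff] at this
    obtain ⟨η, hη, H⟩ := this
    exact ⟨η, hη, fun t ht h2 => H (by rw [Real.dist_eq]; exact h2) ht⟩
  obtain ⟨η0, hη0, H0⟩ := near 0 (by simp) (by have := min_le_left (D2 0) (D2 1); have := hW.second_pos_zero; rw [hw]; linarith)
  obtain ⟨η1, hη1, H1⟩ := near 1 (by simp) (by have := min_le_right (D2 0) (D2 1); have := hW.second_pos_one; rw [hw]; linarith)
  set τ := min (1 / 4) (min η0 η1 / 2) with hτ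
  have τ0 : 0 < τ := by positivity
  have τa : τ ≤ 1 / 4 := min_le_left _ _
  have τb : τ ≤ min η0 η1 / 2 := min_le_right _ _
  have τc := min_le_left η0 η1
  have τd := min_le_right η0 η1
  refine ⟨w, τ, max 1 (max K1 K2), ⟨Wc, D1c, hd1, hd2, hW.zero_at_zero, hW.zero_at_one, hW.pos_on, hW.normalized, w0, τ0, by linarith, le_max_left _ _, 
    fun t ht => (hK2 t ht).trans ((le_max_right _ _).trans (le_max_right _ _)), fun t ht => (hK1 t ht).trans ((le_max_left _ _).trans (le_max_right _ _)), ?_, ?_, ?_⟩⟩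
  · rintro t ht (h | h)
    · exact (H0 t ht (by rw [sub_zero, abs_of_nonneg ht.1]; linarith)).le
    · exact (H1 t ht (by rw [abs_sub_comm, abs_of_nonneg (by linarith [ht.2])]; linarith)).le
  · by_contra h
    push Not at h
    have := (D1c 0 (by simp)).eventually (gt_mem_nhds h)
    rw [eventually_nhdsWithin_iff, Metric.eventually_nhds_iff] at this
    obtain ⟨η, hη, H⟩ := this
    have hm : 0 < min (η / 2) (1 / 2) := by positivity
    have m1 := min_le_left (η / 2) (1 / 2)
    have m2 := min_le_right (η / 2) (1 / 2)
    obtain ⟨ξ, hξ, he⟩ := mvt hm le_rfl (by linarith) Wc hd1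
    have h1 := H (y := ξ) (by rw [Real.dist_eq, sub_zero, abs_of_pos hξ.1]; linarith [hξ.2]) ⟨hξ.1.le, by linarith [hξ.2]⟩
    have h2 := hW.pos_on _ (⟨hm, by linarith⟩ : min (η / 2) (1 / 2) ∈ Ioo (0:ℝ) 1)
    rw [hW.zero_at_zero] at he
    nlinarith
  · by_contra h
    push Not at h
    have := (D1c 1 (by simp)).eventually (lt_mem_nhds h)
    rw [eventually_nhdsWithin_iff, Metric.eventually_nhds_iff] at this
    obtain ⟨η, hη, H⟩ := this
    have hm : 0 < min (η / 2) (1 / 2) := by positivity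
    have m1 := min_le_left (η / 2) (1 / 2)
    have m2 := min_le_right (η / 2) (1 / 2)
    obtain ⟨ξ, hξ, he⟩ := mvt (a := 1 - min (η / 2) (1 / 2)) (b := 1) (by linarith) (by linarith) le_rfl Wc hd1
    have h1 := H (y := ξ) (by rw [Real.dist_eq, abs_sub_comm, abs_of_pos (by linarith [hξ.2])]; linarith [hξ.1]) ⟨by linarith [hξ.1], hξ.2.le⟩
    have h2 := hW.pos_on _ (⟨by linarith, by linarith⟩ : 1 - min (η / 2) (1 / 2) ∈ Ioo (0:ℝ) 1)
    rw [hW.zero_at_one] at he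
    nlinarith

section
variable {D1 D2 : ℝ → ℝ} {w : ℝ}

lemma DW.Wnn (d : DW W D1 D2 w τ K) : ∀ t ∈ Icc (0:ℝ) 1, 0 ≤ W t := by
  intro t ht
  rcases eq_or_lt_of_le ht.1 with h | h
  · rw [← h, d.W0]
  rcases eq_or_lt_of_le ht.2 with h' | h'
  · rw [h', d.W1]
  exact (d.pos t ⟨h, h'⟩).le

lemma DW.Sc (d : DW W D1 D2 w τ K) : ContinuousOn (fun t => √(W t)) (Icc 0 1) := d.Wc.sqrt

lemma DW.Si (d : DW W D1 D2 w τ K) {a b : ℝ} (ha : a ∈ Icc (0:ℝ) 1) (hb : b ∈ Icc (0:ℝ) 1) : IntervalIntegrable (fun t => √(W t)) volume a b := 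
  (d.Sc.mono (uIcc_subset_Icc ha hb)).intervalIntegrable

lemma DW.Phid (d : DW W D1 D2 w τ K) : ∀ t ∈ Ioo (0:ℝ) 1, HasDerivAt (Phi W) (√(W t)) t := by
  intro t ht
  have ht' := Ioo_subset_Icc_self ht
  exact intervalIntegral.integral_hasDerivAt_right (d.Si (by simp) ht') 
    ((d.Sc.mono Ioo_subset_Icc_self).stronglyMeasurableAtFilter isOpen_Ioo t ht) 
    ((d.Sc t ht').continuousAt (Icc_mem_nhds ht.1 ht.2))

lemma DW.Phic (d : DW W D1 D2 w τ K) : ContinuousOn (Phi W) (Icc 0 1) := by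
  have := intervalIntegral.continuousOn_primitive_interval (μ := volume) (f := fun t => √(W t)) (a := 0) (b := 1) 
    (by rw [uIcc_of_le zero_le_one]; exact d.Sc.integrableOn_compact isCompact_Icc)
  rw [uIcc_of_le zero_le_one] at this
  exact this

lemma DW.Phi0 : Phi W 0 = 0 := by simp [Phi]
lemma DW.Phi1 (d : DW W D1 D2 w τ K) : Phi W 1 = 1 := d.nrm

lemma DW.Phim (d : DW W D1 D2 w τ K) : MonotoneOn (Phi W) (Icc 0 1) := by
  intro a ha b hb hab
  rcases eq_or_lt_of_le hab with h | h
  · rw [h]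
  obtain ⟨ξ, hξ, he⟩ := mvt h ha.1 hb.2 d.Phic d.Phid
  have := mul_nonneg (Real.sqrt_nonneg (W ξ)) (sub_nonneg.2 hab)
  linarith

lemma DW.Phinn (d : DW W D1 D2 w τ K) : ∀ t ∈ Icc (0:ℝ) 1, 0 ≤ Phi W t := fun t ht => by
  have := d.Phim (show (0:ℝ) ∈ Icc (0:ℝ) 1 by simp) ht ht.1
  rwa [DW.Phi0] at this

lemma DW.Phile (d : DW W D1 D2 w τ K) : ∀ t ∈ Icc (0:ℝ) 1, Phi W t ≤ 1 := fun t ht => by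
  have := d.Phim ht (show (1:ℝ) ∈ Icc (0:ℝ) 1 by simp) ht.2
  rwa [d.Phi1] at this

lemma DW.D1low (d : DW W D1 D2 w τ K) : ∀ t ∈ Icc 0 τ, w * t ≤ D1 t := by
  intro t ht
  have := d.τ1
  rcases eq_or_lt_of_le ht.1 with h | h
  · rw [← h]; simpa using d.D10
  obtain ⟨ξ, hξ, he⟩ := mvt h le_rfl (by linarith [ht.2]) d.D1c d.hd2
  have h2 := d.D2w ξ ⟨hξ.1.le, by linarith [hξ.2, ht.2]⟩ (Or.inl (hξ.2.le.trans ht.2))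
  have := d.D10
  have : w * (t - 0) ≤ D2 ξ * (t - 0) := by gcongr
  linarith

lemma DW.D1high (d : DW W D1 D2 w τ K) : ∀ t ∈ Icc (1 - τ) 1, D1 t ≤ - (w * (1 - t)) := by
  intro t ht
  have := d.τ1
  rcases eq_or_lt_of_le ht.2 with h | h
  · rw [h]; simpa using d.D11
  obtain ⟨ξ, hξ, he⟩ := mvt h (by linarith [ht.1]) le_rfl d.D1c d.hd2
  have h2 := d.D2w ξ ⟨by linarith [hξ.1, ht.1], hξ.2.le⟩ (Or.inr (ht.1.trans hξ.1.le))
  have := d.D11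
  have : w * (1 - t) ≤ D2 ξ * (1 - t) := by gcongr
  linarith

/-- quadratic lower bound near zero -/
lemma DW.Wlow (d : DW W D1 D2 w τ K) : ∀ t ∈ Icc 0 τ, w / 2 * t ^ 2 ≤ W t := by
  intro t ht
  have := d.τ1
  rcases eq_or_lt_of_le ht.1 with h | h
  · rw [← h, d.W0]; simp
  obtain ⟨ξ, hξ, he⟩ := mvt (F := fun t => W t - w / 2 * t ^ 2) (F' := fun t => D1 t - w * t) h le_rfl (by linarith [ht.2]) (d.Wc.sub (by fun_prop)) 
    (fun t ht => by
      refine ((d.hd1 t ht).sub ((hasDerivAt_pow 2 t).const_mul (w / 2))).congr_deriv ?_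
      push_cast; ring)
  have h2 := d.D1low ξ ⟨hξ.1.le, hξ.2.le.trans ht.2⟩
  have : 0 ≤ (D1 ξ - w * ξ) * (t - 0) := mul_nonneg (by linarith) (by linarith)
  have := d.W0
  simp only [this] at he
  linarith

lemma DW.Whigh (d : DW W D1 D2 w τ K) : ∀ t ∈ Icc (1 - τ) 1, w / 2 * (1 - t) ^ 2 ≤ W t := by
  intro t ht
  have := d.τ1
  rcases eq_or_lt_of_le ht.2 with h | h
  · rw [h, d.W1]; simp
  obtain ⟨ξ, hξ, he⟩ := mvt (F := fun t => W t - w / 2 * (1 - t) ^ 2) (F' := fun t => D1 t + w * (1 - t)) h (by linarith [ht.1]) le_rfl (d.Wc.sub (by fun_prop)) 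
    (fun t ht => by
      refine ((d.hd1 t ht).sub ((((hasDerivAt_id t).const_sub 1).pow 2).const_mul (w / 2))).congr_deriv ?_
      simp; ring)
  have h2 := d.D1high ξ ⟨ht.1.trans hξ.1.le, hξ.2.le⟩
  have : (D1 ξ + w * (1 - ξ)) * (1 - t) ≤ 0 := mul_nonpos_of_nonpos_of_nonneg (by linarith) (by linarith)
  have := d.W1
  simp only [this] at he
  linarith

lemma DW.Wanti (d : DW W D1 D2 w τ K) : AntitoneOn W (Icc (1 - τ) 1) := by
  intro a ha b hb hab
  have := d.τ1
  rcases eq_or_lt_of_le hab with h | h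
  · rw [h]
  obtain ⟨ξ, hξ, he⟩ := mvt h (by linarith [ha.1]) hb.2 d.Wc d.hd1
  have h2 := d.D1high ξ ⟨ha.1.trans hξ.1.le, hξ.2.le.trans hb.2⟩
  have h3 : 0 ≤ w * (1 - ξ) := mul_nonneg d.w0.le (by linarith [hξ.2, hb.2])
  have : D1 ξ * (b - a) ≤ 0 := mul_nonpos_of_nonpos_of_nonneg (by linarith) (by linarith)
  linarith

lemma DW.Slow (d : DW W D1 D2 w τ K) : ∀ t ∈ Icc 0 τ, √(w / 2) * t ≤ √(W t) := by
  intro t ht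
  have := Real.sqrt_le_sqrt (d.Wlow t ht)
  rwa [Real.sqrt_mul (by linarith [d.w0]), Real.sqrt_sq ht.1] at this

/-- lower bound for `Phi` -/
lemma DW.Philow (d : DW W D1 D2 w τ K) : ∀ t ∈ Icc (0:ℝ) 1, √(w / 2) / 2 * τ ^ 2 * t ^ 2 ≤ Phi W t := by
  have hτ0 := d.τ0
  have hτ1 := d.τ1
  have hw : 0 < √(w / 2) := Real.sqrt_pos.2 (by linarith [d.w0])
  have h1 : ∀ t ∈ Icc 0 τ, √(w / 2) / 2 * t ^ 2 ≤ Phi W t := by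
    intro t ht
    rcases eq_or_lt_of_le ht.1 with h | h
    · rw [← h, DW.Phi0]; simp
    obtain ⟨ξ, hξ, he⟩ := mvt (F := fun t => Phi W t - √(w / 2) / 2 * t ^ 2) (F' := fun t => √(W t) - √(w / 2) * t) h le_rfl (by linarith [ht.2]) (d.Phic.sub (by fun_prop)) 
      (fun t ht => by
        refine ((d.Phid t ht).sub ((hasDerivAt_pow 2 t).const_mul (√(w / 2) / 2))).congr_deriv ?_
        push_cast; ring)
    have h2 := d.Slow ξ ⟨hξ.1.le, hξ.2.le.trans ht.2⟩
    have : 0 ≤ (√(W ξ) - √(w / 2) * ξ) * (t - 0) := mul_nonneg (by linarith) (by linarith)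
    simp only [DW.Phi0] at he
    linarith
  intro t ht
  rcases le_total t τ with h | h
  · refine le_trans ?_ (h1 t ⟨ht.1, h⟩)
    have : τ ^ 2 ≤ 1 := by nlinarith
    have h3 : 0 ≤ √(w / 2) / 2 * t ^ 2 := by positivity
    nlinarith
  · refine le_trans ?_ ((h1 τ ⟨hτ0.le, le_rfl⟩).trans (d.Phim ⟨hτ0.le, by linarith⟩ ht h))
    have : t ^ 2 ≤ 1 := by nlinarith [ht.1, ht.2]
    have h3 : 0 ≤ √(w / 2) / 2 * τ ^ 2 := by positivity
    nlinarith
end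

end S15

namespace S15
open Topology
variable {W V : ℝ → ℝ} {τ c K : ℝ} {e : ℕ} {f g : ℝ → ℝ}
variable {D1 D2 : ℝ → ℝ} {w : ℝ}

/-- exponent `n/(n-1)` -/
def pp (e : ℕ) : ℝ := ((e + 2 : ℕ) : ℝ) / (((e + 2 : ℕ) : ℝ) - 1)

lemma pp_bd (e : ℕ) : 1 < pp e ∧ pp e ≤ 2 := by
  have he : (0:ℝ) ≤ e := by positivity
  unfold pp
  push_cast
  constructor
  · rw [lt_div_iff₀ (by linarith)]; linarith
  · rw [div_le_iff₀ (by linarith)]; linarith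

lemma Vpot_eq (t : ℝ) : Vpot (e + 2) W t = Phi W t ^ pp e := rfl

lemma DW.Vd (d : DW W D1 D2 w τ K) : ∀ t ∈ Ioo (0:ℝ) 1, HasDerivAt (Vpot (e + 2) W) (pp e * Phi W t ^ (pp e - 1) * √(W t)) t := by
  intro t ht
  have := (d.Phid t ht).rpow_const (p := pp e) (Or.inr (pp_bd e).1.le)
  exact this.congr_deriv (by ring)

lemma DW.Vc (d : DW W D1 D2 w τ K) : ContinuousOn (Vpot (e + 2) W) (Icc 0 1) := 
  d.Phic.rpow_const fun t _ => Or.inr (le_of_lt (lt_trans one_pos (pp_bd e).1))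

lemma DW.Vmono (d : DW W D1 D2 w τ K) : MonotoneOn (Vpot (e + 2) W) (Icc 0 1) := fun a ha b hb hab => 
  Real.rpow_le_rpow (d.Phinn a ha) (d.Phim ha hb hab) (le_of_lt (lt_trans one_pos (pp_bd e).1))

lemma DW.V0 : Vpot (e + 2) W 0 = 0 := by
  rw [Vpot_eq, DW.Phi0, Real.zero_rpow (by linarith [(pp_bd e).1])]

lemma DW.V1 (d : DW W D1 D2 w τ K) : Vpot (e + 2) W 1 = 1 := by
  rw [Vpot_eq, d.Phi1, Real.one_rpow]

lemma DW.vle (d : DW W D1 D2 w τ K) {t : ℝ} (ht : t ∈ Icc (0:ℝ) 1) : 0 ≤ pp e * Phi W t ^ (pp e - 1) * √(W t) ∧ pp e * Phi W t ^ (pp e - 1) * √(W t) ≤ 2 * √(W t) := by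
  have p := pp_bd e
  have h0 : 0 ≤ Phi W t ^ (pp e - 1) := Real.rpow_nonneg (d.Phinn t ht) _
  have h1 : Phi W t ^ (pp e - 1) ≤ 1 := Real.rpow_le_one (d.Phinn t ht) (d.Phile t ht) (by linarith)
  have p0 : 0 ≤ pp e := by linarith
  constructor
  · positivity
  · have : pp e * Phi W t ^ (pp e - 1) ≤ 2 * 1 := by gcongr; exact p.2
    calc _ ≤ 2 * 1 * √(W t) := by gcongr
      _ = _ := by ring





lemma DW.D1up (d : DW W D1 D2 w τ K) (hb0 : D1 0 = 0) : ∀ t ∈ Icc (0:ℝ) 1, |D1 t| ≤ K * t := by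
  intro t ht
  rcases eq_or_lt_of_le ht.1 with h | h
  · rw [← h, hb0]; simp
  obtain ⟨ξ, hξ, he⟩ := mvt h le_rfl ht.2 d.D1c d.hd2
  rw [hb0, sub_zero, sub_zero] at he
  rw [he, abs_mul, abs_of_pos h]
  have := d.D2K ξ ⟨hξ.1.le, hξ.2.le.trans ht.2⟩
  gcongr

lemma DW.Wlip' (d : DW W D1 D2 w τ K) (hb0 : D1 0 = 0) : ∀ a b, 0 ≤ a → a < b → b ≤ 1 → |W b - W a| ≤ K * b * (b - a) := by
  intro a b ha hab hb
  obtain ⟨ξ, hξ, he⟩ := mvt hab ha hb d.Wc d.hd1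
  rw [he, abs_mul, abs_of_pos (sub_pos.2 hab)]
  have h1 := DW.D1up d hb0 ξ ⟨ha.trans hξ.1.le, hξ.2.le.trans hb⟩
  have hK := d.K1
  have : |D1 ξ| ≤ K * b := h1.trans (by have := hξ.2.le; gcongr)
  have := sub_pos.2 hab
  gcongr

lemma DW.Sup (d : DW W D1 D2 w τ K) (hb0 : D1 0 = 0) : ∀ t ∈ Icc (0:ℝ) 1, √(W t) ≤ K * t := by
  intro t ht
  have hK := d.K1
  have ht0 := ht.1
  rcases eq_or_lt_of_le ht.1 with h | h
  · rw [← h, d.W0]; simp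
  have h1 := DW.Wlip' d hb0 0 t le_rfl h ht.2
  rw [d.W0, sub_zero, sub_zero] at h1
  refine Real.sqrt_le_iff.2 ⟨by positivity, ?_⟩
  have h2 : K ≤ K ^ 2 := by nlinarith
  calc W t ≤ K * t * t := (le_abs_self _).trans h1
    _ = K * t ^ 2 := by ring
    _ ≤ K ^ 2 * t ^ 2 := by gcongr
    _ = _ := by ring

lemma lip_sym (d : DW W D1 D2 w τ K) (hb0 : D1 0 = 0) {U : ℝ → ℝ} {L : ℝ} (hL : 0 ≤ L) (h : ∀ a b, 0 ≤ a → a < b → b ≤ 1 → |U b - U a| ≤ L * b * (b - a)) : 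
    ∀ a ∈ Icc (0:ℝ) 1, ∀ b ∈ Icc (0:ℝ) 1, |U a - U b| ≤ L * |a - b| * (a + b) := by
  intro a ha b hb
  have a0 := ha.1
  have b0 := hb.1
  rcases lt_trichotomy a b with hab | hab | hab
  · rw [abs_sub_comm, abs_sub_comm a b, abs_of_pos (sub_pos.2 hab)]
    have := sub_pos.2 hab
    refine (h a b a0 hab hb.2).trans ?_
    calc _ = L * (b - a) * b := by ring
      _ ≤ _ := by gcongr; linarith
  · rw [hab]; simp
  · rw [abs_of_pos (sub_pos.2 hab)]
    have := sub_pos.2 hab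
    refine (h b a b0 hab ha.2).trans ?_
    calc _ = L * (a - b) * a := by ring
      _ ≤ _ := by gcongr; linarith

lemma DW.Vlip' (d : DW W D1 D2 w τ K) (hb0 : D1 0 = 0) : ∀ a b, 0 ≤ a → a < b → b ≤ 1 → |Vpot (e + 2) W b - Vpot (e + 2) W a| ≤ 2 * K * b * (b - a) := by
  intro a b ha hab hb
  obtain ⟨ξ, hξ, he⟩ := mvt hab ha hb (d.Vc (e := e)) (d.Vd (e := e))
  have hξ1 : ξ ∈ Icc (0:ℝ) 1 := ⟨ha.trans hξ.1.le, hξ.2.le.trans hb⟩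
  have h0 := d.vle (e := e) hξ1
  rw [he, abs_mul, abs_of_pos (sub_pos.2 hab), abs_of_nonneg h0.1]
  have hK := d.K1
  have h1 := DW.Sup d hb0 ξ hξ1
  have : K * ξ ≤ K * b := by have := hξ.2.le; gcongr
  have := sub_pos.2 hab
  have : pp e * Phi W ξ ^ (pp e - 1) * √(W ξ) ≤ 2 * K * b := by linarith
  gcongr

lemma DW.Sdiff (d : DW W D1 D2 w τ K) (hb0 : D1 0 = 0) {a b : ℝ} (ha : 0 < a) (hab : a < b) (hb : b ≤ τ) : √(W b) - √(W a) ≤ K / √(w / 2) * (b - a) := by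
  have hw : 0 < √(w / 2) := Real.sqrt_pos.2 (by linarith [d.w0])
  have hτ := d.τ1
  have b0 : 0 < b := ha.trans hab
  have h1 := (le_abs_self _).trans (DW.Wlip' d hb0 a b ha.le hab (by linarith))
  have h2 := d.Slow b ⟨b0.le, hb⟩
  have h3 := Real.sq_sqrt (d.Wnn b ⟨b0.le, by linarith⟩)
  have h4 := Real.sq_sqrt (d.Wnn a ⟨ha.le, by linarith⟩)
  have h5 := Real.sqrt_nonneg (W a)
  have sb : 0 < √(W b) := lt_of_lt_of_le (by positivity) h2
  have hba := sub_pos.2 hab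
  have hK := d.K1
  rcases le_total (√(W b)) (√(W a)) with h | h
  · have : 0 ≤ K / √(w / 2) * (b - a) := by positivity
    linarith
  have h6 : (√(W b) - √(W a)) * (√(w / 2) * b) ≤ K * b * (b - a) := by
    calc _ ≤ (√(W b) - √(W a)) * (√(W b) + √(W a)) := by
          refine mul_le_mul_of_nonneg_left (by linarith) (by linarith)
      _ = W b - W a := by linear_combination h3 - h4
      _ ≤ _ := h1
  calc _ = (√(W b) - √(W a)) * (√(w / 2) * b) / (√(w / 2) * b) := by field_simp
    _ ≤ K * b * (b - a) / (√(w / 2) * b) := by gcongr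
    _ = _ := by field_simp

lemma DW.Pdiff (d : DW W D1 D2 w τ K) (hb0 : D1 0 = 0) {a b : ℝ} (ha : 0 < a) (hab : a < b) (hb : b < 1) : 
    √(W b) * (Phi W b ^ (pp e - 1) - Phi W a ^ (pp e - 1)) ≤ K ^ 2 / (√(w / 2) / 2 * τ ^ 2) * (b - a) := by
  have hw : 0 < √(w / 2) := Real.sqrt_pos.2 (by linarith [d.w0])
  have hτ := d.τ0
  have hK := d.K1
  have b0 : 0 < b := ha.trans hab
  have hba := sub_pos.2 hab
  have bI : b ∈ Icc (0:ℝ) 1 := ⟨b0.le, hb.le⟩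
  have aI : a ∈ Icc (0:ℝ) 1 := ⟨ha.le, (hab.trans hb).le⟩
  set c' := √(w / 2) / 2 * τ ^ 2 with hc'
  have c'0 : 0 < c' := by positivity
  have pa : 0 < Phi W a := lt_of_lt_of_le (by positivity) (d.Philow a aI)
  have hPb := d.Philow b bI
  have pb : 0 < Phi W b := lt_of_lt_of_le (by positivity) hPb
  have pm := d.Phim aI bI hab.le
  have hp := pp_bd e
  have key : Phi W b ^ (pp e - 1) - Phi W a ^ (pp e - 1) ≤ (Phi W b - Phi W a) * Phi W b ^ (pp e - 2) := by
    have e1 : Phi W b ^ (pp e - 1) = Phi W b * Phi W b ^ (pp e - 2) := by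
      rw [show pp e - 1 = 1 + (pp e - 2) by ring, Real.rpow_add pb, Real.rpow_one]
    have e2 : Phi W a ^ (pp e - 1) = Phi W a * Phi W a ^ (pp e - 2) := by
      rw [show pp e - 1 = 1 + (pp e - 2) by ring, Real.rpow_add pa, Real.rpow_one]
    have e3 : Phi W b ^ (pp e - 2) ≤ Phi W a ^ (pp e - 2) := Real.rpow_le_rpow_of_nonpos pa pm (by linarith)
    rw [e1, e2]
    have : Phi W a * Phi W b ^ (pp e - 2) ≤ Phi W a * Phi W a ^ (pp e - 2) := by gcongr
    linarith
  have k2 : Phi W b ^ (pp e - 2) ≤ 1 / (c' * b ^ 2) := by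
    calc _ ≤ Phi W b ^ (-1 : ℝ) := Real.rpow_le_rpow_of_exponent_ge pb (d.Phile b bI) (by linarith)
      _ = 1 / Phi W b := by rw [Real.rpow_neg_one, one_div]
      _ ≤ _ := one_div_le_one_div_of_le (by positivity) hPb
  have k3 : Phi W b - Phi W a ≤ K * b * (b - a) := by
    obtain ⟨ξ, hξ, he⟩ := mvt hab ha.le hb.le d.Phic d.Phid
    rw [he]
    have h1 := DW.Sup d hb0 ξ ⟨ha.le.trans hξ.1.le, hξ.2.le.trans hb.le⟩
    have : K * ξ ≤ K * b := by have := hξ.2.le; gcongr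
    have : √(W ξ) ≤ K * b := by linarith
    gcongr
  have k4 := DW.Sup d hb0 b bI
  have k5 : 0 ≤ Phi W b ^ (pp e - 2) := Real.rpow_nonneg pb.le _
  calc _ ≤ √(W b) * ((Phi W b - Phi W a) * Phi W b ^ (pp e - 2)) := by gcongr
    _ ≤ (K * b) * ((K * b * (b - a)) * (1 / (c' * b ^ 2))) := by
      have := sub_nonneg.2 pm
      gcongr
    _ = _ := by field_simp

lemma DW.vdiff (d : DW W D1 D2 w τ K) (hb0 : D1 0 = 0) : ∃ L ≥ 0, ∀ a b, 0 < a → a < b → b < 1 → (b ≤ τ ∨ 1 - τ ≤ a) → 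
    pp e * Phi W b ^ (pp e - 1) * √(W b) - pp e * Phi W a ^ (pp e - 1) * √(W a) ≤ L * (b - a) := by
  have hw : 0 < √(w / 2) := Real.sqrt_pos.2 (by linarith [d.w0])
  have hτ := d.τ0
  have hK := d.K1
  refine ⟨2 * (K ^ 2 / (√(w / 2) / 2 * τ ^ 2) + K / √(w / 2)), by positivity, ?_⟩
  intro a b ha hab hb hz
  have hp := pp_bd e
  have h1 := DW.Pdiff (e := e) d hb0 ha hab hb
  have hba := sub_pos.2 hab
  have aI : a ∈ Icc (0:ℝ) 1 := ⟨ha.le, (hab.trans hb).le⟩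
  have a0 : 0 ≤ Phi W a ^ (pp e - 1) := Real.rpow_nonneg (d.Phinn a aI) _
  have a1 : Phi W a ^ (pp e - 1) ≤ 1 := Real.rpow_le_one (d.Phinn a aI) (d.Phile a aI) (by linarith)
  have h2 : √(W b) - √(W a) ≤ K / √(w / 2) * (b - a) := by
    rcases hz with h | h
    · exact DW.Sdiff d hb0 ha hab h
    · have := Real.sqrt_le_sqrt (d.Wanti ⟨h, aI.2⟩ ⟨by linarith, hb.le⟩ hab.le)
      have : 0 ≤ K / √(w / 2) * (b - a) := by positivity
      linarith
  have h3 : Phi W a ^ (pp e - 1) * (√(W b) - √(W a)) ≤ K / √(w / 2) * (b - a) := by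
    have z : 0 ≤ K / √(w / 2) * (b - a) := by positivity
    calc _ ≤ Phi W a ^ (pp e - 1) * (K / √(w / 2) * (b - a)) := by gcongr
      _ ≤ 1 * (K / √(w / 2) * (b - a)) := by gcongr
      _ = _ := one_mul _
  set X := K ^ 2 / (√(w / 2) / 2 * τ ^ 2) * (b - a) + K / √(w / 2) * (b - a) with hX
  have X0 : 0 ≤ X := by positivity
  calc _ = pp e * (√(W b) * (Phi W b ^ (pp e - 1) - Phi W a ^ (pp e - 1)) + Phi W a ^ (pp e - 1) * (√(W b) - √(W a))) := by ring
    _ ≤ pp e * X := by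
      refine mul_le_mul_of_nonneg_left (by linarith) (by linarith)
    _ ≤ 2 * X := by gcongr; exact hp.2
    _ = _ := by rw [hX]; ring



lemma conc_of {a b : ℝ} {F F' : ℝ → ℝ} (ha : 0 ≤ a) (hb : b ≤ 1) (hc : ContinuousOn F (Icc 0 1)) (hd : ∀ t ∈ Ioo (0:ℝ) 1, HasDerivAt F (F' t) t) {L : ℝ} 
    (h : ∀ x y, x ∈ Ioo a b → y ∈ Ioo a b → x < y → F' y - F' x ≤ 2 * L * (y - x)) {x y θ : ℝ} (hx : x ∈ Icc a b) (hy : y ∈ Icc a b) (hθ : θ ∈ Icc (0:ℝ) 1) : 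
    (1 - θ) * F x + θ * F y - L * θ * (1 - θ) * (x - y) ^ 2 ≤ F ((1 - θ) * x + θ * y) := by
  have hd' : ∀ t ∈ Ioo a b, HasDerivAt (fun t => F t - L * t ^ 2) (F' t - 2 * L * t) t := fun t ht => by
    refine ((hd t ⟨ha.trans_lt ht.1, ht.2.trans_le hb⟩).sub ((hasDerivAt_pow 2 t).const_mul L)).congr_deriv ?_
    push_cast; ring
  have hcv : ConcaveOn ℝ (Icc a b) (fun t => F t - L * t ^ 2) := by
    refine AntitoneOn.concaveOn_of_deriv (convex_Icc a b) ((hc.mono (Icc_subset_Icc ha hb)).sub (by fun_prop)) ?_ ?_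
    · rw [interior_Icc]
      exact fun t ht => (hd' t ht).differentiableAt.differentiableWithinAt
    · rw [interior_Icc]
      intro x hx y hy hxy
      rw [(hd' x hx).deriv, (hd' y hy).deriv]
      rcases eq_or_lt_of_le hxy with h1 | h1
      · rw [h1]
      · have := h x y hx hy h1
        linarith
  have := hcv.2 hx hy (sub_nonneg.2 hθ.2) hθ.1 (by ring)
  simp only [smul_eq_mul] at this
  nlinarith

theorem pot_of (d : DW W D1 D2 w τ K) (hb0 : D1 0 = 0) : ∃ c K', Pot W (Vpot (e + 2) W) τ c K' := by
  have hτ0 := d.τ0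
  have hτ1 := d.τ1
  have hK := d.K1
  have hw := d.w0
  obtain ⟨L, hL, hv⟩ := DW.vdiff (e := e) d hb0
  obtain ⟨p, hp, hmin⟩ := isCompact_Icc.exists_isMinOn (nonempty_Icc.2 (show τ ≤ 1 - τ by linarith)) (d.Wc.mono (Icc_subset_Icc hτ0.le (by linarith)))
  have hp0 : 0 < W p := d.pos p ⟨by linarith [hp.1], by linarith [hp.2]⟩
  have Vt0 : 0 < Vpot (e + 2) W τ := by
    rw [Vpot_eq]
    have hw2 : 0 < √(w / 2) := Real.sqrt_pos.2 (by linarith [d.w0])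
    have : 0 < Phi W τ := lt_of_lt_of_le (by positivity) (d.Philow τ ⟨hτ0.le, by linarith⟩)
    positivity
  set c := min (w / 2) (min (W p) (Vpot (e + 2) W τ)) with hc
  have c0 : 0 < c := lt_min (by positivity) (lt_min hp0 Vt0)
  have c1 : c ≤ w / 2 := min_le_left _ _
  have c2 : c ≤ W p := (min_le_right _ _).trans (min_le_left _ _)
  have c3 : c ≤ Vpot (e + 2) W τ := (min_le_right _ _).trans (min_le_right _ _)
  set K' := 2 * K + L + (2 * K + 1) / c + (2 / w + 1) with hK'
  have k0 : 0 ≤ (2 * K + 1) / c := by positivity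
  have k1 : 0 ≤ 2 / w + 1 := by positivity
  have KK : 0 ≤ K := by linarith
  have K2 : 2 * K ≤ K' := by linarith
  have Wlow : ∀ t ∈ Icc 0 τ, c * t ^ 2 ≤ W t := fun t ht => le_trans (by gcongr) (d.Wlow t ht)
  have Wmid : ∀ t ∈ Icc τ (1 - τ), c ≤ W t := fun t ht => c2.trans (hmin ht)
  have Vle : ∀ t ∈ Icc (0:ℝ) 1, Vpot (e + 2) W t ≤ 1 := fun t ht => by
    have := d.Vmono (e := e) ht (show (1:ℝ) ∈ Icc (0:ℝ) 1 by simp) ht.2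
    rwa [d.V1] at this
  have mon : ∀ {L' : ℝ} {U : ℝ → ℝ}, L' ≤ K' → (∀ a ∈ Icc (0:ℝ) 1, ∀ b ∈ Icc (0:ℝ) 1, |U a - U b| ≤ L' * |a - b| * (a + b)) → 
      (∀ a ∈ Icc (0:ℝ) 1, ∀ b ∈ Icc (0:ℝ) 1, |U a - U b| ≤ K' * |a - b| * (a + b)) := fun hl h a ha b hb => by
    have := ha.1
    have := hb.1
    exact (h a ha b hb).trans (by gcongr)
  refine ⟨c, K', ⟨hτ0, hτ1, c0, by linarith, d.Wnn, d.W0, d.W1, ?_, Wlow, Wmid, ?_, d.Vmono, DW.V0, d.V1, ?_, ?_, ?_, ?_, c3⟩⟩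
  · exact mon (by linarith) (lip_sym d hb0 (by linarith) (DW.Wlip' d hb0))
  · intro a b θ hz hθ
    have gen : ∀ p q : ℝ, 0 ≤ p → q ≤ 1 → (∀ t ∈ Ioo p q, t ≤ τ ∨ 1 - τ ≤ t) → a ∈ Icc p q → b ∈ Icc p q → 
        W ((1 - θ) * a + θ * b) ≤ (1 - θ) * W a + θ * W b - c * θ * (1 - θ) * (a - b) ^ 2 := by
      intro p q hp hq hpq ha hb
      have := conc_of (F := fun t => - W t) (F' := fun t => - D1 t) (L := -c) hp hq d.Wc.neg (fun t ht => (d.hd1 t ht).neg) ?_ ha hb hθ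
      · linarith
      · intro x y hx hy hxy
        obtain ⟨ξ, hξ, he⟩ := mvt hxy (hp.trans hx.1.le) (hy.2.le.trans hq) d.D1c d.hd2
        have := d.D2w ξ ⟨by linarith [hξ.1, hx.1], by linarith [hξ.2, hy.2]⟩ (hpq ξ ⟨hx.1.trans hξ.1, hξ.2.trans hy.2⟩)
        have : (2 * c) * (y - x) ≤ D2 ξ * (y - x) := mul_le_mul_of_nonneg_right (by linarith) (by linarith)
        linarith
    rcases hz with ⟨ha, hb⟩ | ⟨ha, hb⟩
    · exact gen 0 τ le_rfl (by linarith) (fun t ht => Or.inl ht.2.le) ha hb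
    · exact gen (1 - τ) 1 (by linarith) le_rfl (fun t ht => Or.inr ht.1.le) ha hb
  · exact mon K2 (lip_sym d hb0 (by linarith) (DW.Vlip' d hb0))
  · intro a b θ hz hθ
    have gen : ∀ p q : ℝ, 0 ≤ p → q ≤ 1 → (q ≤ τ ∨ 1 - τ ≤ p) → a ∈ Icc p q → b ∈ Icc p q → 
        (1 - θ) * Vpot (e + 2) W a + θ * Vpot (e + 2) W b - K' * θ * (1 - θ) * (a - b) ^ 2 ≤ Vpot (e + 2) W ((1 - θ) * a + θ * b) := by
      intro p q hp hq hpq ha hb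
      refine conc_of hp hq d.Vc d.Vd ?_ ha hb hθ
      intro x y hx hy hxy
      refine (hv x y (hp.trans_lt hx.1) hxy (hy.2.trans_le hq) ?_).trans ?_
      · rcases hpq with h | h
        · exact Or.inl (hy.2.le.trans h)
        · exact Or.inr (h.trans hx.1.le)
      · have := sub_pos.2 hxy
        gcongr; linarith
    rcases hz with ⟨ha, hb⟩ | ⟨ha, hb⟩
    · exact gen 0 τ le_rfl (by linarith) (Or.inl le_rfl) ha hb
    · exact gen (1 - τ) 1 (by linarith) le_rfl (Or.inr le_rfl) ha hb
  · intro t ht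
    have tI : t ∈ Icc (0:ℝ) 1 := ⟨ht.1, by linarith [ht.2]⟩
    have Wt := d.Wnn t tI
    have hk : (2 * K + 1) / c * W t ≤ K' * W t := by gcongr; linarith
    refine le_trans ?_ hk
    rcases le_total t τ with h | h
    · have h1 := Wlow t ⟨ht.1, h⟩
      have h2 := lip_sym d hb0 (by linarith) (DW.Vlip' (e := e) d hb0) t tI 0 (by simp)
      rw [DW.V0, sub_zero, sub_zero, add_zero, abs_of_nonneg ht.1] at h2
      calc _ ≤ 2 * K * t * t := (le_abs_self _).trans h2
        _ = 2 * K / c * (c * t ^ 2) := by field_simp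
        _ ≤ (2 * K + 1) / c * W t := by gcongr; linarith
    · have h1 := Wmid t ⟨h, ht.2⟩
      calc _ ≤ (1:ℝ) := Vle t tI
        _ = 1 / c * c := by field_simp
        _ ≤ (2 * K + 1) / c * W t := by gcongr; linarith
  · intro t ht
    have tI : t ∈ Icc (0:ℝ) 1 := ⟨by linarith [ht.1], ht.2⟩
    have Wt := d.Wnn t tI
    rcases eq_or_lt_of_le ht.2 with h | h
    · rw [h, d.V1, d.W1]; simp
    obtain ⟨ξ, hξ, he⟩ := mvt h tI.1 le_rfl (d.Vc (e := e)) (d.Vd (e := e))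
    have h1 := (d.vle (e := e) (t := ξ) ⟨tI.1.trans hξ.1.le, hξ.2.le⟩).2
    have h2 := Real.sqrt_le_sqrt (d.Wanti ht ⟨ht.1.trans hξ.1.le, hξ.2.le⟩ hξ.1.le)
    have h3 := d.Whigh t ht
    have h4 := Real.sq_sqrt Wt
    rw [d.V1] at he
    rw [he]
    have h5 : (1 - t) ^ 2 ≤ 2 / w * W t := by
      calc _ = 2 / w * (w / 2 * (1 - t) ^ 2) := by field_simp
        _ ≤ _ := by gcongr
    have h6 := sub_pos.2 h
    calc _ ≤ 2 * √(W t) * (1 - t) := by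
          refine mul_le_mul_of_nonneg_right (by linarith) h6.le
      _ ≤ √(W t) ^ 2 + (1 - t) ^ 2 := by nlinarith [sq_nonneg (√(W t) - (1 - t))]
      _ ≤ (2 / w + 1) * W t := by rw [h4]; linarith
      _ ≤ _ := by gcongr; linarith

end S15

namespace S15
open Topology
variable {W V : ℝ → ℝ} {τ c K : ℝ} {e : ℕ} {f g : ℝ → ℝ}
variable {D1 D2 : ℝ → ℝ} {w : ℝ}

lemma DW.Wlin (d : DW W D1 D2 w τ K) : ∀ t ∈ Icc 0 τ, D1 0 * t ≤ W t := by
  intro t ht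
  have := d.τ1
  rcases eq_or_lt_of_le ht.1 with h | h
  · rw [← h, d.W0]; simp
  obtain ⟨ξ, hξ, h1⟩ := mvt h le_rfl (by linarith [ht.2]) d.Wc d.hd1
  obtain ⟨ζ, hζ, h2⟩ := mvt hξ.1 le_rfl (by linarith [ht.2, hξ.2]) d.D1c d.hd2
  have h3 := d.D2w ζ ⟨hζ.1.le, by linarith [ht.2, hξ.2, hζ.2]⟩ (Or.inl (by linarith [ht.2, hξ.2, hζ.2]))
  have h4 : 0 ≤ D2 ζ * (ξ - 0) := mul_nonneg (by linarith [d.w0]) (by linarith [hξ.1])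
  rw [d.W0, sub_zero, sub_zero] at h1
  rw [h1]
  exact mul_le_mul_of_nonneg_right (by linarith) h.le

lemma DW.Vup (d : DW W D1 D2 w τ K) : ∀ t ∈ Icc (0:ℝ) 1, Vpot (e + 2) W t ≤ √K * (t * √t) := by
  intro t ht
  have p := pp_bd e
  have hK := d.K1
  have h0 : Vpot (e + 2) W t ≤ Phi W t := by
    have := Real.rpow_le_rpow_of_exponent_ge' (d.Phinn t ht) (d.Phile t ht) zero_le_one p.1.le
    rwa [Real.rpow_one] at this
  refine h0.trans ?_
  rcases eq_or_lt_of_le ht.1 with h | h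
  · rw [← h, DW.Phi0]; simp
  obtain ⟨ξ, hξ, h1⟩ := mvt h le_rfl ht.2 d.Phic d.Phid
  rw [DW.Phi0, sub_zero, sub_zero] at h1
  rw [h1]
  have h2 : W ξ ≤ K * t := by
    obtain ⟨ζ, hζ, h2⟩ := mvt hξ.1 le_rfl (by linarith [ht.2, hξ.2]) d.Wc d.hd1
    rw [d.W0, sub_zero, sub_zero] at h2
    have h3 := (le_abs_self _).trans (d.D1K ζ ⟨hζ.1.le, by linarith [ht.2, hξ.2, hζ.2]⟩)
    rw [h2]
    have := hξ.1.le
    have := hξ.2.le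
    gcongr
  have h3 := Real.sqrt_le_sqrt h2
  rw [Real.sqrt_mul (by linarith)] at h3
  calc _ ≤ √K * √t * t := by gcongr
    _ = _ := by ring

/-- slowly decaying profile -/
def ph (e : ℕ) (r : ℝ) : ℝ := (√(1 + r ^ 2) ^ (e + 2))⁻¹

lemma hh_ge (r : ℝ) : 1 ≤ √(1 + r ^ 2) ∧ |r| ≤ √(1 + r ^ 2) ∧ √(1 + r ^ 2) ^ 2 = 1 + r ^ 2 := by
  refine ⟨Real.one_le_sqrt.2 (by nlinarith [sq_nonneg r]), ?_, Real.sq_sqrt (by positivity)⟩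
  apply Real.abs_le_sqrt; linarith

lemma ph_pos (r : ℝ) : 0 < ph e r := by
  have := (hh_ge r).1
  unfold ph; positivity

lemma ph_le (r : ℝ) : ph e r ≤ 1 := by
  have := (hh_ge r).1
  unfold ph; exact inv_le_one_of_one_le₀ (one_le_pow₀ this)

lemma ph_d (r : ℝ) : HasDerivAt (ph e) (-((e + 2 : ℝ) * r / √(1 + r ^ 2) ^ (e + 4))) r := by
  have h := hh_ge r
  have h0 : 0 < √(1 + r ^ 2) := by linarith [h.1]
  have h1 : HasDerivAt (fun r : ℝ => 1 + r ^ 2) (2 * r) r := by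
    have := ((hasDerivAt_id r).pow 2).const_add 1
    refine this.congr_deriv (by simp)
  have h2 := ((h1.sqrt (by positivity)).pow (e + 2)).inv (pow_ne_zero _ h0.ne')
  refine h2.congr_deriv ?_
  push_cast
  simp only [Nat.add_sub_cancel, Pi.pow_apply, show e + 2 - 1 = e + 1 by omega]
  field_simp
  ring

lemma ph_diff : Differentiable ℝ (ph e) := fun r => (ph_d r).differentiableAt

lemma ph_w {r : ℝ} (hr : 0 < r) : r ^ (e + 1) * ph e r ≤ (√(1 + r ^ 2))⁻¹ := by
  have h := hh_ge r
  have h0 : 0 < √(1 + r ^ 2) := by linarith [h.1]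
  have h1 : r ≤ √(1 + r ^ 2) := (le_abs_self r).trans h.2.1
  unfold ph
  calc _ ≤ √(1 + r ^ 2) ^ (e + 1) * (√(1 + r ^ 2) ^ (e + 2))⁻¹ := by gcongr
    _ = _ := by field_simp; ring

lemma ph_1 (r : ℝ) : ph e r ≤ (√(1 + r ^ 2))⁻¹ ^ 2 := by
  have h := hh_ge r
  have h0 : 0 < √(1 + r ^ 2) := by linarith [h.1]
  unfold ph
  rw [inv_pow]
  exact inv_anti₀ (by positivity) (pow_le_pow_right₀ h.1 (by omega))

lemma i2_int : IntegrableOn (fun r : ℝ => (√(1 + r ^ 2))⁻¹ ^ 2) (Ioi 0) := by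
  have := integrable_inv_one_add_sq.integrableOn (s := Ioi (0:ℝ))
  refine this.congr_fun (fun r _ => ?_) measurableSet_Ioi
  beta_reduce
  rw [inv_pow, (hh_ge r).2.2]

lemma ph_prof : Prof e (ph e) where
  diff := ph_diff
  d0 := by rw [(ph_d 0).deriv]; simp
  mem r := ⟨(ph_pos r).le, ph_le r⟩
  i0 := by
    refine i2_int.mono' ?_ ?_
    · exact ((continuous_pow _).mul (ph_diff.continuous.pow 2)).aestronglyMeasurable
    · refine (ae_restrict_iff' measurableSet_Ioi).2 (Eventually.of_forall fun r hr => ?_)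
      have hr : 0 < r := hr
      have h := hh_ge r
      have h0 : 0 < √(1 + r ^ 2) := by linarith [h.1]
      have p0 := ph_pos (e := e) r
      rw [Real.norm_of_nonneg (by positivity)]
      calc _ = (r ^ (e + 1) * ph e r) * ph e r := by ring
        _ ≤ (√(1 + r ^ 2))⁻¹ * (√(1 + r ^ 2))⁻¹ := by
          refine mul_le_mul (ph_w hr) ((ph_1 r).trans ?_) p0.le (by positivity)
          rw [sq]
          exact mul_le_of_le_one_left (by positivity) (inv_le_one_of_one_le₀ h.1)
        _ = _ := by ring
  i1 := by
    refine (i2_int.const_mul ((e + 2 : ℝ) ^ 2)).mono' ?_ ?_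
    · exact ((continuous_pow _).aestronglyMeasurable).mul ((measurable_deriv _).pow_const 2).aestronglyMeasurable
    · refine (ae_restrict_iff' measurableSet_Ioi).2 (Eventually.of_forall fun r hr => ?_)
      have hr : 0 < r := hr
      have h := hh_ge r
      have h0 : 0 < √(1 + r ^ 2) := by linarith [h.1]
      have h1 : r ≤ √(1 + r ^ 2) := (le_abs_self r).trans h.2.1
      rw [Real.norm_of_nonneg (by positivity), (ph_d r).deriv]
      set s := √(1 + r ^ 2)
      calc _ = (e + 2 : ℝ) ^ 2 * (r ^ (e + 3) / s ^ (2 * e + 8)) := by field_simp; ring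
        _ ≤ (e + 2 : ℝ) ^ 2 * (s ^ (e + 3) / s ^ (e + 5)) := by
          have : s ^ (e + 5) ≤ s ^ (2 * e + 8) := pow_le_pow_right₀ h.1 (by omega)
          gcongr
        _ = _ := by field_simp; ring

lemma aprof {A : ℝ} (hA : 0 < A) (hA1 : A ≤ 1) : Prof e (fun r => A * ph e r) where
  diff := ph_diff.const_mul A
  d0 := by rw [deriv_const_mul A (ph_diff 0), ph_prof.d0, mul_zero]
  mem r := ⟨by have := ph_pos (e := e) r; positivity, by have := ph_pos (e := e) r; have := ph_le (e := e) r; nlinarith⟩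
  i0 := by
    refine IntegrableOn.congr_fun ((ph_prof (e := e)).i0.const_mul (A ^ 2)) (fun r _ => ?_) measurableSet_Ioi
    beta_reduce; ring
  i1 := by
    refine IntegrableOn.congr_fun ((ph_prof (e := e)).i1.const_mul (A ^ 2)) (fun r _ => ?_) measurableSet_Ioi
    beta_reduce; rw [deriv_const_mul A (ph_diff r)]; ring

lemma aGG (A : ℝ) : GG e (fun r => A * ph e r) = A ^ 2 * GG e (ph e) := by
  unfold GG
  rw [← integral_const_mul]
  congr 1; ext r
  rw [deriv_const_mul A (ph_diff r)]; ring

lemma aVint (d : DW W D1 D2 w τ K) {A : ℝ} (hA : 0 < A) (hA1 : A ≤ 1) : 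
    IntegrableOn (fun r => r ^ (e + 1) * Vpot (e + 2) W (A * ph e r)) (Ioi 0) := by
  have pr := aprof (e := e) hA hA1
  refine (i2_int.const_mul (√K)).mono' ?_ ?_
  · refine ContinuousOn.aestronglyMeasurable (ContinuousOn.mul (continuous_pow _).continuousOn ?_) measurableSet_Ioi
    exact d.Vc.comp pr.diff.continuous.continuousOn fun r _ => pr.mem r
  · refine (ae_restrict_iff' measurableSet_Ioi).2 (Eventually.of_forall fun r hr => ?_)
    have hr : 0 < r := hr
    have h := hh_ge r
    have h0 : 0 < √(1 + r ^ 2) := by linarith [h.1]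
    have p0 := ph_pos (e := e) r
    have v0 : 0 ≤ Vpot (e + 2) W (A * ph e r) := Real.rpow_nonneg (d.Phinn _ (pr.mem r)) _
    rw [Real.norm_of_nonneg (by positivity)]
    have v1 := d.Vup (e := e) _ (pr.mem r)
    have ap : A * ph e r ≤ ph e r := mul_le_of_le_one_left p0.le hA1
    have sq : √(A * ph e r) ≤ (√(1 + r ^ 2))⁻¹ := by
      rw [Real.sqrt_le_left (by positivity)]
      exact ap.trans (ph_1 r)
    calc _ ≤ r ^ (e + 1) * (√K * (ph e r * (√(1 + r ^ 2))⁻¹)) := by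
          refine mul_le_mul_of_nonneg_left (v1.trans ?_) (by positivity)
          gcongr
      _ = √K * ((r ^ (e + 1) * ph e r) * (√(1 + r ^ 2))⁻¹) := by ring
      _ ≤ √K * ((√(1 + r ^ 2))⁻¹ * (√(1 + r ^ 2))⁻¹) := by
          have := ph_w (e := e) hr
          gcongr
      _ = _ := by ring

lemma aW (d : DW W D1 D2 w τ K) (hb : 0 < D1 0) {A : ℝ} (hA : 0 < A) (hA1 : A ≤ τ) : PP e W (fun r => A * ph e r) = 0 := by
  refine integral_undef fun hi => ?_
  have hi1 : IntegrableOn (fun r => r ^ (e + 1) * W (A * ph e r)) (Ioi 1) := IntegrableOn.mono_set hi (Ioi_subset_Ioi zero_le_one)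
  refine not_integrableOn_Ioi_inv (a := 1) ?_
  set M : ℝ := D1 0 * A / 2 ^ (e + 2) with hM
  have M0 : 0 < M := by positivity
  refine (hi1.const_mul M⁻¹).mono' (by fun_prop) ?_
  refine (ae_restrict_iff' measurableSet_Ioi).2 (Eventually.of_forall fun r hr => ?_)
  have hr : 1 < r := hr
  have r0 : 0 < r := by linarith
  have h := hh_ge r
  have h0 : 0 < √(1 + r ^ 2) := by linarith [h.1]
  have h2 : √(1 + r ^ 2) ≤ 2 * r := by
    rw [Real.sqrt_le_left (by positivity)]; nlinarith
  have p0 := ph_pos (e := e) r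
  have p1 := ph_le (e := e) r
  have h3 := d.Wlin (A * ph e r) ⟨by positivity, by nlinarith⟩
  have h4 : ((2 * r) ^ (e + 2))⁻¹ ≤ ph e r := by
    unfold ph
    gcongr
  rw [Real.norm_of_nonneg (by positivity), inv_mul_eq_div, le_div_iff₀ M0]
  calc r⁻¹ * M = r ^ (e + 1) * (D1 0 * (A * ((2 * r) ^ (e + 2))⁻¹)) := by rw [hM, mul_pow]; field_simp; ring
    _ ≤ r ^ (e + 1) * (D1 0 * (A * ph e r)) := by gcongr
    _ ≤ _ := by gcongr

lemma aVlow (d : DW W D1 D2 w τ K) : ∃ J > 0, ∀ a : ℝ, 0 < a → a ≤ 1 → J * a ^ (2 * (e + 2)) ≤ PP e (Vpot (e + 2) W) (fun r => a ^ (e + 1) * ph e r) := by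
  have hw : 0 < √(w / 2) := Real.sqrt_pos.2 (by linarith [d.w0])
  have hτ := d.τ0
  set k := √(w / 2) / 2 * τ ^ 2 with hk
  have k0 : 0 < k := by positivity
  have k1 : k ≤ 1 := by
    have := d.Philow 1 (by simp)
    rw [d.Phi1] at this
    linarith
  have p := pp_bd e
  have i4 : IntegrableOn (fun r => r ^ (e + 1) * ph e r ^ 4) (Ioi 0) := by
    refine (ph_prof (e := e)).i0.mono' ((continuous_pow _).mul (ph_diff.continuous.pow 4)).aestronglyMeasurable ?_
    refine (ae_restrict_iff' measurableSet_Ioi).2 (Eventually.of_forall fun r hr => ?_)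
    have hr : 0 < r := hr
    have p0 := ph_pos (e := e) r
    have p1 := ph_le (e := e) r
    rw [Real.norm_of_nonneg (by positivity)]
    exact mul_le_mul_of_nonneg_left (pow_le_pow_of_le_one p0.le p1 (by norm_num)) (by positivity)
  have J0 : 0 < ∫ r in Ioi (0:ℝ), r ^ (e + 1) * ph e r ^ 4 := by
    rw [setIntegral_pos_iff_support_of_nonneg_ae _ i4]
    · refine lt_of_lt_of_le ?_ (measure_mono (s := Ioi 0) fun r hr => ⟨?_, hr⟩)
      · simp
      · have hr : 0 < r := hr
        have p0 := ph_pos (e := e) r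
        exact (by positivity : (0:ℝ) < _).ne'
    · refine (ae_restrict_iff' measurableSet_Ioi).2 (Eventually.of_forall fun r hr => ?_)
      have hr : 0 < r := hr
      have p0 := ph_pos (e := e) r
      simp only [Pi.zero_apply]
      positivity
  refine ⟨k ^ 2 * ∫ r in Ioi (0:ℝ), r ^ (e + 1) * ph e r ^ 4, by positivity, fun a ha ha1 => ?_⟩
  have hA : 0 < a ^ (e + 1) := by positivity
  have hA1 : a ^ (e + 1) ≤ 1 := pow_le_one₀ ha.le ha1
  have pr := aprof (e := e) hA hA1
  unfold PP
  calc _ = ∫ r in Ioi (0:ℝ), (k ^ 2 * a ^ (2 * (e + 2))) * (r ^ (e + 1) * ph e r ^ 4) := by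
        rw [integral_const_mul]; ring
    _ ≤ _ := by
      refine setIntegral_mono_on (i4.const_mul _) (aVint d hA hA1) measurableSet_Ioi fun r hr => ?_
      have hr : 0 < r := hr
      have p0 := ph_pos (e := e) r
      have p1 := ph_le (e := e) r
      have h1 := d.Philow _ (pr.mem r)
      have h2 : (k * (a ^ (e + 1) * ph e r) ^ 2) ^ pp e ≤ Vpot (e + 2) W (a ^ (e + 1) * ph e r) := 
        Real.rpow_le_rpow (by positivity) h1 (le_of_lt (lt_trans one_pos p.1))
      have h3 : (k * (a ^ (e + 1) * ph e r) ^ 2) ^ pp e = (k * ph e r ^ 2) ^ pp e * a ^ (2 * (e + 2)) := by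
        rw [show k * (a ^ (e + 1) * ph e r) ^ 2 = (k * ph e r ^ 2) * a ^ (2 * (e + 1)) by ring, Real.mul_rpow (by positivity) (by positivity)]
        congr 1
        rw [← Real.rpow_natCast, ← Real.rpow_natCast, ← Real.rpow_mul ha.le]
        congr 1
        unfold pp
        push_cast
        have : (e:ℝ) + 2 - 1 = e + 1 := by ring
        rw [this]
        field_simp
      have h4 : (k * ph e r ^ 2) ^ 2 ≤ (k * ph e r ^ 2) ^ pp e := by
        rw [← Real.rpow_two (k * ph e r ^ 2)]
        exact Real.rpow_le_rpow_of_exponent_ge (by positivity) (mul_le_one₀ k1 (by positivity) (pow_le_one₀ p0.le p1)) p.2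
      calc _ = r ^ (e + 1) * ((k * ph e r ^ 2) ^ 2 * a ^ (2 * (e + 2))) := by ring
        _ ≤ r ^ (e + 1) * Vpot (e + 2) W (a ^ (e + 1) * ph e r) := by
          refine mul_le_mul_of_nonneg_left (le_trans ?_ h2) (by positivity)
          rw [h3]
          gcongr

lemma psi_le0 (d : DW W D1 D2 w τ K) (hb : 0 < D1 0) {ε : ℝ} (hε : 0 < ε) : Psi (e + 2) W ε 1 ≤ 0 := by
  have hc := cst_pos e
  obtain ⟨J, J0, HJ⟩ := aVlow (e := e) d
  have hτ := d.τ0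
  have hτ1 := d.τ1
  set L : ℝ := (cst e * J) ^ (1 / ((e:ℝ) + 2)) with hL
  have L0 : 0 < L := Real.rpow_pos_of_pos (by positivity) _
  have Le : L ^ (e + 2) = cst e * J := by
    rw [← Real.rpow_natCast, hL, ← Real.rpow_mul (by positivity)]
    push_cast
    rw [one_div_mul_cancel (by positivity), Real.rpow_one]
  have G0 : 0 ≤ GG e (ph e) := setIntegral_nonneg measurableSet_Ioi fun r hr => by
    have hr : 0 < r := hr
    positivity
  set B : ℝ := cst e * (ε * (GG e (ph e) / L ^ e)) with hB
  have B0 : 0 ≤ B := by positivity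
  have key : ∀ a : ℝ, 0 < a → a ≤ τ → Psi (e + 2) W ε 1 ≤ B * a ^ 2 := by
    intro a ha ha1
    have hA : 0 < a ^ (e + 1) := by positivity
    have hA1 : a ^ (e + 1) ≤ τ := le_trans (pow_le_of_le_one ha.le (by linarith) (by omega)) ha1
    have pr := aprof (e := e) hA (by linarith)
    set X := PP e (Vpot (e + 2) W) (fun r => a ^ (e + 1) * ph e r) with hX
    have hJ := HJ a ha (by linarith)
    rw [← hX] at hJ
    have X0 : 0 < X := lt_of_lt_of_le (by positivity) hJ
    set κ : ℝ := (cst e * X) ^ (1 / ((e:ℝ) + 2)) with hκd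
    have κ0 : 0 < κ := Real.rpow_pos_of_pos (by positivity) _
    have κe : κ ^ (e + 2) = cst e * X := by
      rw [← Real.rpow_natCast, hκd, ← Real.rpow_mul (by positivity)]
      push_cast
      rw [one_div_mul_cancel (by positivity), Real.rpow_one]
    have κL : L * a ^ 2 ≤ κ := by
      refine le_of_pow_le_pow_left₀ (n := e + 2) (by omega) κ0.le ?_
      rw [mul_pow, Le, κe, ← pow_mul, mul_assoc]
      exact mul_le_mul_of_nonneg_left hJ hc.le
    have pk := pr.scale κ0
    have h1 := Psi_le (m := 1) d.Wnn hε pk.h1 (by 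
      rw [V_eq (f := fun r => a ^ (e + 1) * ph e (κ * r)), PP_scale (f := fun r => a ^ (e + 1) * ph e r) (Vpot (e + 2) W) κ0, κe, ← hX]; field_simp)
    rw [AC_eq pk.diff pk.d0] at h1
    refine h1.trans ?_
    unfold EE
    rw [PP_scale (f := fun r => a ^ (e + 1) * ph e r) W κ0, GG_scale (f := fun r => a ^ (e + 1) * ph e r) pr.diff κ0, aW d hb hA hA1, aGG, mul_zero, zero_div, add_zero]
    calc _ ≤ cst e * (ε * (((L * a ^ 2) ^ e)⁻¹ * ((a ^ (e + 1)) ^ 2 * GG e (ph e)))) := by gcongr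
      _ = _ := by
        rw [hB, mul_pow]; field_simp; ring
  by_contra hh
  push Not at hh
  set P := Psi (e + 2) W ε 1
  set a := min τ (P / (2 * (B + 1))) with had
  have a0 : 0 < a := by positivity
  have k1 := key a a0 (min_le_left _ _)
  have a1 : a ≤ 1 := (min_le_left _ _).trans (by linarith)
  have a2 : a * (2 * (B + 1)) ≤ P := by
    rw [← le_div_iff₀ (by positivity)]; exact min_le_right _ _
  have a3 : a ^ 2 ≤ a := pow_le_of_le_one a0.le a1 (by omega)
  have a4 : B * a ^ 2 ≤ B * a := mul_le_mul_of_nonneg_left a3 B0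
  have a5 : 0 ≤ B * a := by positivity
  nlinarith

lemma not_min (d : DW W D1 D2 w τ K) (hb : 0 < D1 0) {ε : ℝ} (hε : 0 < ε) {u : En (e + 2) → ℝ} (hm : Minimizes (e + 2) W ε u) 
    (hr : RadialDecreasing (e + 2) u) : False := by
  have hc := cst_pos e
  obtain ⟨f, pf, af, rfl⟩ := prof_of hm.1 hr
  have h1 := psi_le0 (e := e) d hb hε
  obtain ⟨_, h2, h3⟩ := hm
  rw [← h3, AC_eq pf.diff pf.d0] at h1
  rw [V_eq] at h2
  have P0 : 0 ≤ PP e W f := setIntegral_nonneg measurableSet_Ioi fun r hr => by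
    have hr : 0 < r := hr
    have := d.Wnn _ (pf.mem r)
    positivity
  have G0 : 0 ≤ GG e f := setIntegral_nonneg measurableSet_Ioi fun r hr => by
    have hr : 0 < r := hr
    positivity
  have E0 : EE e W ε f ≤ 0 := by
    by_contra h; push Not at h
    have := mul_pos hc h
    linarith
  have G1 : GG e f = 0 := by
    unfold EE at E0
    have : 0 ≤ PP e W f / ε := by positivity
    by_contra h
    have : 0 < ε * GG e f := mul_pos hε (lt_of_le_of_ne G0 (Ne.symm h))
    linarith
  have G2 : ∀ᵐ r ∂(volume.restrict (Ioi (0:ℝ))), deriv f r = 0 := by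
    unfold GG at G1
    rw [setIntegral_eq_zero_iff_of_nonneg_ae _ pf.i1] at G1
    · filter_upwards [G1, ae_restrict_mem measurableSet_Ioi] with r hr h0
      have h0 : 0 < r := h0
      simp only [Pi.zero_apply, mul_eq_zero] at hr
      rcases hr with h | h
      · exact absurd h (by positivity)
      · simpa using h
    · refine (ae_restrict_iff' measurableSet_Ioi).2 (Eventually.of_forall fun r hr => ?_)
      have hr : 0 < r := hr
      simp only [Pi.zero_apply]
      positivity
  have cons : ∀ r, 0 < r → f r = f 0 := by
    intro r hr
    have ae1 : ∀ᵐ x ∂(volume.restrict (uIoc 0 r)), deriv f x = 0 := by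
      rw [uIoc_of_le hr.le]
      exact ae_restrict_of_ae_restrict_of_subset (fun x hx => hx.1) G2
    have h4 := intervalIntegral.integral_eq_sub_of_hasDerivAt (f := f) (f' := deriv f) (a := 0) (b := r) (fun x _ => (pf.diff x).hasDerivAt) 
      (by
        rw [intervalIntegrable_iff]
        exact (integrable_zero ℝ ℝ _).congr (ae1.mono fun x hx => hx.symm))
    have h5 : ∫ x in (0:ℝ)..r, deriv f x = 0 := by
      rw [intervalIntegral.integral_of_le hr.le]
      rw [uIoc_of_le hr.le] at ae1
      exact integral_eq_zero_of_ae ae1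
    linarith
  have h6 : PP e (Vpot (e + 2) W) f = 0 := by
    unfold PP
    rw [setIntegral_congr_fun (g := fun r => r ^ (e + 1) * Vpot (e + 2) W (f 0)) measurableSet_Ioi (fun r hr => by beta_reduce; rw [cons r hr]), integral_mul_const]
    rw [integral_undef, zero_mul]
    intro hi
    have hi1 : IntegrableOn (fun r : ℝ => r ^ (e + 1)) (Ioi 1) := IntegrableOn.mono_set hi (Ioi_subset_Ioi zero_le_one)
    refine not_integrableOn_Ioi_inv (a := 1) (hi1.mono' (by fun_prop) ?_)
    refine (ae_restrict_iff' measurableSet_Ioi).2 (Eventually.of_forall fun r hr => ?_)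
    have hr : 1 < r := hr
    rw [Real.norm_of_nonneg (by positivity)]
    exact (inv_le_one_of_one_le₀ hr.le).trans (one_le_pow₀ hr.le)
  rw [h6] at h2
  simp at h2

end S15

theorem statement15 (n : ℕ) (hn : 2 ≤ n) (W : ℝ → ℝ) (hW : DoubleWell W) :
    ∃ ε₀ > (0:ℝ), ∃ C > (0:ℝ), ∀ ε : ℝ, 0 < ε → ε < ε₀ →
      ∀ uε : En n → ℝ, Minimizes n W ε uε → RadialDecreasing n uε →
      ∀ u : En n → ℝ, H1Box n u → RadialDecreasing n u →
        (∫ x : En n, Vpot n W (u x)) = 1 →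
        dPhi n W u uε ≤ C * Real.sqrt (AC n W ε u - Psi n W ε 1) := by
  obtain ⟨e, rfl⟩ : ∃ e, n = e + 2 := ⟨n - 2, by omega⟩
  obtain ⟨w, τ, K, d⟩ := S15.dw_of hW
  by_cases hb : derivWithin W (Icc 0 1) 0 = 0
  · obtain ⟨c, K', hP⟩ := S15.pot_of (e := e) d hb
    exact S15.reduce hP d.Phinn
  · have hb' : 0 < derivWithin W (Icc 0 1) 0 := lt_of_le_of_ne d.D10 (Ne.symm hb)
    exact ⟨1, one_pos, 1, one_pos, fun ε hε _ uε hm hr => (S15.not_min d hb' hε hm hr).elim⟩
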